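/- arXiv:2509.16802 — 2 statements merged into one kernel-verified Lean document; each statement's English description precedes it below -/
import Mathlib

section
/- There exists a universal constant C > 0 such that the following holds. Let k = p^ν be a power of a prime, let M be a finite set of m items, and let v_1, …, v_n : 2^M → ℝ be n valuation functions with marginals bounded by 1. Then there exists a partition of M into k subsets M = S_1 ∪ … ∪ S_k such that for all ℓ, ℓ' ∈ [k] and all i ∈ [n], |v_i(S_ℓ) − v_i(S_{ℓ'})| ≤ C·√(n·log(nk)). -/
namespace ListCochain

open scoped BigOperators

section Basic

variable {X Y W R : Type*} [CommRing R]

/-- The simplicial coboundary of a cochain on ordered simplices, which are encoded as lists of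
vertices; the empty list plays the role of the augmentation. -/
def cobd : (List X → R) → List X → R
  | _, [] => 0
  | φ, x :: l => φ l - cobd (fun t => φ (x :: t)) l

@[simp] lemma cobd_nil (φ : List X → R) : cobd φ [] = 0 := rfl

lemma cobd_cons (φ : List X → R) (x : X) (l : List X) :
    cobd φ (x :: l) = φ l - cobd (fun t => φ (x :: t)) l := rfl

lemma cobd_add (φ ψ : List X → R) (l : List X) :
    cobd (fun t => φ t + ψ t) l = cobd φ l + cobd ψ l := by
  induction l generalizing φ ψ with
  | nil => simp
  | cons x l ih => rw [cobd_cons, ih]; simp only [cobd_cons]; ring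

lemma cobd_mul_left (c : R) (φ : List X → R) (l : List X) :
    cobd (fun t => c * φ t) l = c * cobd φ l := by
  induction l generalizing φ with
  | nil => simp
  | cons x l ih => rw [cobd_cons, ih]; simp only [cobd_cons]; ring

lemma cobd_mul_right (c : R) (φ : List X → R) (l : List X) :
    cobd (fun t => φ t * c) l = cobd φ l * c := by
  simp only [mul_comm _ c, cobd_mul_left]

lemma cobd_sub (φ ψ : List X → R) (l : List X) :
    cobd (fun t => φ t - ψ t) l = cobd φ l - cobd ψ l := by
  induction l generalizing φ ψ with
  | nil => simp
  | cons x l ih => rw [cobd_cons, ih]; simp only [cobd_cons]; ring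

@[simp] lemma cobd_zero (l : List X) : cobd (fun _ => (0 : R)) l = 0 := by
  simpa using cobd_mul_left (0 : R) (fun _ => (0 : R)) l

lemma cobd_sign_mul (φ : List X → R) (l : List X) :
    cobd (fun t => (-1) ^ t.length * φ t) l = -((-1) ^ l.length * cobd φ l) := by
  induction l generalizing φ with
  | nil => simp
  | cons x l ih =>
    simp only [cobd_cons, List.length_cons, pow_succ]
    have := ih (fun t => -φ (x :: t))
    have h : cobd (fun t => -φ (x :: t)) l = - cobd (fun t => φ (x :: t)) l := by
      simpa using cobd_mul_left (-1 : R) (fun t => φ (x :: t)) l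
    rw [h] at this
    have e : (fun t : List X => (-1 : R) ^ t.length * -1 * φ (x :: t)) =
        fun t => (-1) ^ t.length * -φ (x :: t) := by funext t; ring
    rw [e, this]; ring

lemma cobd_congr {φ ψ : List X → R} {l : List X}
    (h : ∀ t, t.length + 1 = l.length → φ t = ψ t) : cobd φ l = cobd ψ l := by
  induction l generalizing φ ψ with
  | nil => rfl
  | cons x l ih =>
    rw [cobd_cons, cobd_cons, h l rfl]
    congr 1
    exact ih fun t ht => h _ (by simpa using ht)

lemma cobd_ite_length (C : R) (l : List X) :
    cobd (fun t => if t.length = 0 then C else 0) l = if l.length = 1 then C else 0 := by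
  cases l with
  | nil => simp
  | cons x l => rw [cobd_cons]; simp

lemma cobd_map (f : X → Y) (φ : List Y → R) (l : List X) :
    cobd (fun t => φ (t.map f)) l = cobd φ (l.map f) := by
  induction l generalizing φ with
  | nil => simp
  | cons x l ih =>
    simp only [cobd_cons, List.map_cons]
    rw [ih (fun t => φ (f x :: t))]

/-- A linear functional commutes with the coboundary in an auxiliary variable. -/
lemma map_cobd {A : Type*} (T : (A → R) →ₗ[R] R) (f : List X → A → R) (l : List X) :
    T (fun a => cobd (fun t => f t a) l) = cobd (fun t => T (f t)) l := by
  induction l generalizing f with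
  | nil => exact T.map_zero
  | cons x l ih =>
    simp only [cobd_cons]
    rw [← ih (fun t => f (x :: t)), ← map_sub]
    rfl

/-- The prism operator between two maps of vertices. -/
def prism (f g : X → Y) : (List Y → R) → List X → R
  | _, [] => 0
  | φ, x :: l => φ (f x :: g x :: l.map g) - prism f g (fun t => φ (f x :: t)) l

lemma prism_sub (f g : X → Y) (φ ψ : List Y → R) (l : List X) :
    prism f g (fun t => φ t - ψ t) l = prism f g φ l - prism f g ψ l := by
  induction l generalizing φ ψ with
  | nil => simp [prism]
  | cons x l ih => simp only [prism, ih]; ring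

lemma cobd_prism (f g : X → Y) (φ : List Y → R) (l : List X) :
    cobd (prism f g φ) l + prism f g (cobd φ) l = φ (l.map g) - φ (l.map f) := by
  induction l generalizing φ with
  | nil => simp [prism]
  | cons x l ih =>
    have h := ih (fun t => φ (f x :: t))
    simp only [prism, cobd_cons, List.map_cons, prism_sub]
    rw [cobd_sub, cobd_map g (fun t => φ (f x :: g x :: t))]
    linear_combination h

lemma prism_invariant (f g : X → Y) (σ : X → X) (τ : Y → Y) (hf : ∀ x, f (σ x) = τ (f x))
    (hg : ∀ x, g (σ x) = τ (g x)) (φ : List Y → R) (hφ : ∀ l, φ (l.map τ) = φ l) (l : List X) :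
    prism f g φ (l.map σ) = prism f g φ l := by
  have key : ∀ (l : List X) (φ ψ : List Y → R), (∀ l, φ (l.map τ) = ψ l) →
      prism f g φ (l.map σ) = prism f g ψ l := by
    intro l
    induction l with
    | nil => intros; rfl
    | cons x l ih =>
      intro φ ψ h
      simp only [prism, List.map_cons]
      rw [ih (fun t => φ (f (σ x) :: t)) (fun t => ψ (f x :: t)) fun t => by
        simp [← h, hf]]
      congr 1
      rw [← h]
      simp [hf, hg, Function.comp_def]
  exact key l φ φ hφ

/-- The shuffle (Eilenberg-Zilber) operator: the signed sum of the values of a cochain along all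
monotone lattice paths in the grid spanned by two simplices. -/
def shuffle (c : X → Y → W) : (List W → R) → List X → List Y → R
  | _, [], _ => 0
  | _, _ :: _, [] => 0
  | φ, x :: xs, y :: ys =>
    (if xs.length + ys.length = 0 then φ [c x y] else 0) +
      shuffle c (fun t => φ (c x y :: t)) xs (y :: ys) +
      (-1) ^ xs.length * shuffle c (fun t => φ (c x y :: t)) (x :: xs) ys
termination_by _ xs ys => xs.length + ys.length

@[simp] lemma shuffle_nil_left (c : X → Y → W) (φ : List W → R) (ys : List Y) :
    shuffle c φ [] ys = 0 := by
  rw [shuffle]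

@[simp] lemma shuffle_nil_right (c : X → Y → W) (φ : List W → R) (xs : List X) :
    shuffle c φ xs [] = 0 := by
  cases xs <;> rw [shuffle]

lemma shuffle_cons (c : X → Y → W) (φ : List W → R) (x : X) (xs : List X) (y : Y) (ys : List Y) :
    shuffle c φ (x :: xs) (y :: ys) =
      (if xs.length + ys.length = 0 then φ [c x y] else 0) +
      shuffle c (fun t => φ (c x y :: t)) xs (y :: ys) +
      (-1) ^ xs.length * shuffle c (fun t => φ (c x y :: t)) (x :: xs) ys := by
  rw [shuffle]

/-- Induction along the recursion of `shuffle`. -/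
lemma shuffle_induction {motive : List X → List Y → Prop}
    (nil_left : ∀ ys, motive [] ys) (nil_right : ∀ xs, motive xs [])
    (cons : ∀ x xs y ys, motive xs (y :: ys) → motive (x :: xs) ys → motive (x :: xs) (y :: ys))
    (xs : List X) (ys : List Y) : motive xs ys := by
  induction xs generalizing ys with
  | nil => exact nil_left ys
  | cons x xs ihx =>
    induction ys with
    | nil => exact nil_right _
    | cons y ys ihy => exact cons x xs y ys (ihx _) ihy

lemma shuffle_add (c : X → Y → W) (φ ψ : List W → R) (xs : List X) (ys : List Y) :
    shuffle c (fun t => φ t + ψ t) xs ys = shuffle c φ xs ys + shuffle c ψ xs ys := by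
  induction xs, ys using shuffle_induction generalizing φ ψ with
  | nil_left ys => simp
  | nil_right xs => simp
  | cons x xs y ys ih₁ ih₂ =>
    simp only [shuffle_cons, ih₁, ih₂]
    split_ifs <;> ring

lemma shuffle_mul_left (c : X → Y → W) (a : R) (φ : List W → R) (xs : List X) (ys : List Y) :
    shuffle c (fun t => a * φ t) xs ys = a * shuffle c φ xs ys := by
  induction xs, ys using shuffle_induction generalizing φ with
  | nil_left ys => simp
  | nil_right xs => simp
  | cons x xs y ys ih₁ ih₂ =>
    simp only [shuffle_cons, ih₁, ih₂]
    split_ifs <;> ring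

lemma shuffle_sub (c : X → Y → W) (φ ψ : List W → R) (xs : List X) (ys : List Y) :
    shuffle c (fun t => φ t - ψ t) xs ys = shuffle c φ xs ys - shuffle c ψ xs ys := by
  have h := shuffle_add c φ (fun t => -1 * ψ t) xs ys
  rw [shuffle_mul_left] at h
  simpa [sub_eq_add_neg] using h

lemma shuffle_map {X' Y' W' : Type*} (c : X → Y → W) (c' : X' → Y' → W') (f : X → X') (g : Y → Y')
    (h : W → W') (hc : ∀ x y, c' (f x) (g y) = h (c x y)) (φ : List W' → R) (xs : List X)
    (ys : List Y) :
    shuffle c' φ (xs.map f) (ys.map g) = shuffle c (fun t => φ (t.map h)) xs ys := by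
  induction xs, ys using shuffle_induction generalizing φ with
  | nil_left ys => simp
  | nil_right xs => simp
  | cons x xs y ys ih₁ ih₂ =>
    simp only [List.map_cons] at ih₁ ih₂ ⊢
    simp only [shuffle_cons, List.length_map, ih₁, ih₂, hc, List.map_cons, List.map_nil]

/-- The paths contributing to `shuffle` have the expected length and vertices. -/
lemma shuffle_eq_zero (c : X → Y → W) (φ : List W → R) (xs : List X) (ys : List Y)
    (h : ∀ t : List W, t.length + 1 = xs.length + ys.length →
      (∀ w ∈ t, ∃ x ∈ xs, ∃ y ∈ ys, w = c x y) → φ t = 0) : shuffle c φ xs ys = 0 := by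
  induction xs, ys using shuffle_induction generalizing φ with
  | nil_left ys => simp
  | nil_right xs => simp
  | cons x xs y ys ih₁ ih₂ =>
    rw [shuffle_cons, ih₁, ih₂]
    · split_ifs with h0
      · rw [h [c x y]]
        · simp
        · simp; omega
        · simp
      · simp
    · intro t ht hw
      refine h _ (by simp at ht ⊢; omega) fun w hw' => ?_
      rcases List.mem_cons.1 hw' with rfl | hw'
      · exact ⟨x, by simp, y, by simp, rfl⟩
      · obtain ⟨a, ha, b, hb, e⟩ := hw w hw'
        exact ⟨a, ha, b, by simp [hb], e⟩
    · intro t ht hw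
      refine h _ (by simp at ht ⊢; omega) fun w hw' => ?_
      rcases List.mem_cons.1 hw' with rfl | hw'
      · exact ⟨x, by simp, y, by simp, rfl⟩
      · obtain ⟨a, ha, b, hb, e⟩ := hw w hw'
        exact ⟨a, by simp [ha], b, hb, e⟩

/-- The shuffle operator satisfies the Leibniz rule. -/
lemma shuffle_cobd (c : X → Y → W) (φ : List W → R) (xs : List X) (ys : List Y) :
    shuffle c (cobd φ) xs ys = cobd (fun t => shuffle c φ t ys) xs -
      (-1) ^ xs.length * cobd (fun t => shuffle c φ xs t) ys +
      if xs.length = 1 ∧ ys.length = 1 then φ [] else 0 := by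
  induction xs, ys using shuffle_induction generalizing φ with
  | nil_left ys => simp
  | nil_right xs => simp
  | cons x xs y ys ih₁ ih₂ =>
    rw [shuffle_cons]
    simp only [cobd_cons, shuffle_sub]
    rw [ih₁, ih₂]
    simp only [shuffle_cons, cobd_cons, cobd_add]
    rw [cobd_sign_mul, cobd_mul_left]
    have b₁ : cobd (fun t : List X => if t.length + ys.length = 0 then φ [c x y] else 0) xs =
        if xs.length = 1 ∧ ys.length = 0 then φ [c x y] else 0 := by
      by_cases h : ys.length = 0
      · simpa [h] using cobd_ite_length (φ [c x y]) xs
      · simp [h]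
    have b₂ : cobd (fun t : List Y => if xs.length + t.length = 0 then φ [c x y] else 0) ys =
        if xs.length = 0 ∧ ys.length = 1 then φ [c x y] else 0 := by
      by_cases h : xs.length = 0
      · simpa [h] using cobd_ite_length (φ [c x y]) ys
      · simp [h]
    rw [b₁, b₂]
    have hs : ((-1 : R) ^ xs.length) * ((-1) ^ xs.length) = 1 := by
      rw [← mul_pow]; simp
    by_cases hx : xs.length = 0
    · by_cases hy : ys.length = 0
      · simp [List.length_eq_zero_iff.1 hx, List.length_eq_zero_iff.1 hy]
      · simp only [List.length_cons, hx]
        simp [hy]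
        rw [List.length_eq_zero_iff.1 hx]
        simp
        split_ifs <;> ring
    · simp only [List.length_cons, pow_succ]
      simp [hx]
      by_cases hy : ys.length = 0
      · rw [List.length_eq_zero_iff.1 hy]
        simp
        split_ifs <;> ring
      · have hy' : ys ≠ [] := by rintro rfl; simp at hy
        simp [hy']
        ring

/-- The Alexander-Whitney operator: the sum over all ways to cut a simplex at a vertex. -/
def cut : (List X → List X → R) → List X → R
  | _, [] => 0
  | χ, x :: l => χ [x] (x :: l) + cut (fun p s => χ (x :: p) s) l

@[simp] lemma cut_nil (χ : List X → List X → R) : cut χ [] = 0 := rfl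

lemma cut_cons (χ : List X → List X → R) (x : X) (l : List X) :
    cut χ (x :: l) = χ [x] (x :: l) + cut (fun p s => χ (x :: p) s) l := rfl

lemma cut_add (χ ψ : List X → List X → R) (l : List X) :
    cut (fun p s => χ p s + ψ p s) l = cut χ l + cut ψ l := by
  induction l generalizing χ ψ with
  | nil => simp
  | cons x l ih => simp only [cut_cons, ih]; ring

lemma cut_mul_left (a : R) (χ : List X → List X → R) (l : List X) :
    cut (fun p s => a * χ p s) l = a * cut χ l := by
  induction l generalizing χ with
  | nil => simp
  | cons x l ih => simp only [cut_cons, ih]; ring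

lemma cut_sub (χ ψ : List X → List X → R) (l : List X) :
    cut (fun p s => χ p s - ψ p s) l = cut χ l - cut ψ l := by
  induction l generalizing χ ψ with
  | nil => simp
  | cons x l ih => simp only [cut_cons, ih]; ring

@[simp] lemma cut_zero (l : List X) : cut (fun _ _ => (0 : R)) l = 0 := by
  simpa using cut_mul_left (0 : R) (fun _ _ => (0 : R)) l

/-- The cuts of `l` are the pairs `(l.take (i + 1), l.drop i)`. -/
lemma cut_eq_zero (χ : List X → List X → R) (l : List X)
    (h : ∀ i < l.length, χ (l.take (i + 1)) (l.drop i) = 0) : cut χ l = 0 := by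
  induction l generalizing χ with
  | nil => rfl
  | cons x l ih =>
    rw [cut_cons, ih]
    · simpa using h 0
    · intro i hi
      simpa using h (i + 1) (by simpa using hi)

lemma cut_congr {χ ψ : List X → List X → R} {l : List X}
    (h : ∀ i < l.length, χ (l.take (i + 1)) (l.drop i) = ψ (l.take (i + 1)) (l.drop i)) :
    cut χ l = cut ψ l := by
  rw [← sub_eq_zero, ← cut_sub]
  exact cut_eq_zero _ _ fun i hi => sub_eq_zero.2 (h i hi)

lemma cut_map (f : X → Y) (χ : List Y → List Y → R) (l : List X) :
    cut χ (l.map f) = cut (fun p s => χ (p.map f) (s.map f)) l := by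
  induction l generalizing χ with
  | nil => rfl
  | cons x l ih => simp only [List.map_cons, cut_cons, ih]; simp

/-- The Alexander-Whitney operator is a chain map. -/
lemma cut_cobd (χ : List X → List X → R) (hχ : ∀ p, χ p [] = 0) (l : List X) :
    cut (fun p s => cobd (fun t => χ t s) p - (-1) ^ p.length * cobd (χ p) s) l =
      cobd (cut χ) l + χ [] l := by
  induction l generalizing χ with
  | nil => simp [hχ]
  | cons x l ih =>
    have h := ih (fun p s => χ (x :: p) s) fun p => hχ _
    have e : cut (fun p s => cobd (fun t => χ t s) (x :: p) -
        (-1) ^ (x :: p).length * cobd (χ (x :: p)) s) l =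
        cut χ l - cut (fun p s => cobd (fun t => χ (x :: t) s) p -
          (-1) ^ p.length * cobd (χ (x :: p)) s) l := by
      rw [← cut_sub]
      congr 1
      funext p s
      rw [cobd_cons, List.length_cons, pow_succ]
      ring
    rw [cut_cons, e, h]
    simp only [cobd_cons, cut_cons, cobd_add]
    simp
    ring

end Basic

section Words

variable {G H R : Type*} [CommRing R]

/-- Prepend a letter to an infinite word. -/
def wcons (x : G) (w : ℕ → G) : ℕ → G
  | 0 => x
  | j + 1 => w j

/-- Iterated subdivision: a chain map sending a simplex on letters to a chain of simplices on
words. A word of level `L` is eventually constant from the position `L` on. -/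
def wordOp : ℕ → (List (ℕ → G) → R) → List G → R
  | 0, φ, gs => φ (gs.map fun g _ => g)
  | L + 1, φ, gs => cut (fun p s => wordOp L (fun ws => shuffle wcons φ p ws) s) gs

lemma wordOp_add (L : ℕ) (φ ψ : List (ℕ → G) → R) (gs : List G) :
    wordOp L (fun t => φ t + ψ t) gs = wordOp L φ gs + wordOp L ψ gs := by
  induction L generalizing φ ψ gs with
  | zero => rfl
  | succ L ih => simp only [wordOp, shuffle_add, ih, cut_add]

lemma wordOp_mul_left (L : ℕ) (a : R) (φ : List (ℕ → G) → R) (gs : List G) :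
    wordOp L (fun t => a * φ t) gs = a * wordOp L φ gs := by
  induction L generalizing φ gs with
  | zero => rfl
  | succ L ih => simp only [wordOp, shuffle_mul_left, ih, cut_mul_left]

/-- `wordOp` at a fixed simplex as a linear functional. -/
def wordOpHom (L : ℕ) (gs : List G) : (List (ℕ → G) → R) →ₗ[R] R where
  toFun φ := wordOp L φ gs
  map_add' φ ψ := wordOp_add L φ ψ gs
  map_smul' a φ := wordOp_mul_left L a φ gs

lemma wordOp_sub (L : ℕ) (φ ψ : List (ℕ → G) → R) (gs : List G) :
    wordOp L (fun t => φ t - ψ t) gs = wordOp L φ gs - wordOp L ψ gs :=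
  (wordOpHom L gs).map_sub φ ψ

@[simp] lemma wordOp_zero (L : ℕ) (gs : List G) :
    wordOp L (fun _ : List (ℕ → G) => (0 : R)) gs = 0 :=
  (wordOpHom L gs).map_zero

lemma wordOp_nil (L : ℕ) (φ : List (ℕ → G) → R) (hφ : φ [] = 0) : wordOp L φ [] = 0 := by
  cases L with
  | zero => exact hφ
  | succ L => rfl

/-- `wordOp` is a chain map. -/
lemma wordOp_cobd (L : ℕ) (φ : List (ℕ → G) → R) (hφ : φ [] = 0) (gs : List G) :
    wordOp L (cobd φ) gs = cobd (wordOp L φ) gs := by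
  induction L generalizing φ gs with
  | zero => exact (cobd_map (fun (g : G) (_ : ℕ) => g) φ gs).symm
  | succ L ih =>
    have h := cut_cobd (fun p s => wordOp L (fun ws => shuffle wcons φ p ws) s)
      (fun p => wordOp_nil L _ (by simp)) gs
    have h0 : wordOp L (fun ws => shuffle wcons φ [] ws) gs = 0 := by simp
    rw [h0, add_zero] at h
    rw [show cobd (wordOp (L + 1) φ) gs =
      cobd (cut fun p s => wordOp L (fun ws => shuffle wcons φ p ws) s) gs from rfl, ← h]
    simp only [wordOp]
    congr 1
    funext p s
    have e : (fun ws => shuffle wcons (cobd φ) p ws) = fun ws =>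
        cobd (fun t => shuffle wcons φ t ws) p -
          (-1) ^ p.length * cobd (fun t => shuffle wcons φ p t) ws := by
      funext ws
      rw [shuffle_cobd, hφ]
      simp
    rw [e, wordOp_sub, wordOp_mul_left, ih _ (by simp)]
    congr 1
    exact map_cobd (wordOpHom L s) (fun t ws => shuffle wcons φ t ws) p

/-- `wordOp` is natural in the alphabet. -/
lemma wordOp_map (L : ℕ) (f : G → H) (φ : List (ℕ → H) → R) (gs : List G) :
    wordOp L φ (gs.map f) = wordOp L (fun ws => φ (ws.map fun w j => f (w j))) gs := by
  induction L generalizing φ gs with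
  | zero => simp [wordOp, Function.comp_def]
  | succ L ih =>
    simp only [wordOp, cut_map, ih]
    congr 1
    funext p s
    congr 1
    funext ws
    refine shuffle_map wcons wcons f (fun w j => f (w j)) (fun w j => f (w j)) ?_ φ p ws
    intro x w
    funext j
    cases j <;> rfl

/-- A list `ws` of words is slow along `gs` if the letters of all its words at a position `j < L`
lie in a window of `gs`, where consecutive windows overlap only at their end points. -/
def SlowAlong (L : ℕ) (gs : List G) (ws : List (ℕ → G)) : Prop :=
  ws.length = gs.length ∧ ∃ s : ℕ → ℕ, Monotone s ∧ s 0 = 0 ∧ s L < gs.length ∧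
    ∀ w ∈ ws, ∀ j < L, ∃ t, s j ≤ t ∧ t ≤ s (j + 1) ∧ gs[t]? = some (w j)

/-- `wordOp` only depends on simplices which are slow along the given one. -/
lemma wordOp_eq_zero (L : ℕ) (φ : List (ℕ → G) → R) (gs : List G) (hgs : gs ≠ [])
    (h : ∀ ws, SlowAlong L gs ws → φ ws = 0) : wordOp L φ gs = 0 := by
  induction L generalizing φ gs with
  | zero =>
    refine h _ ⟨by simp, fun _ => 0, monotone_const, rfl, ?_, by simp⟩
    exact List.length_pos_iff.2 hgs
  | succ L ih =>
    refine cut_eq_zero _ _ fun i hi => ih _ _ (by simpa using hi) ?_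
    rintro ws ⟨hlen, s, hs, hs0, hsL, hw⟩
    refine shuffle_eq_zero _ _ _ _ fun t ht htw => h t ⟨?_, ?_⟩
    · simp at ht hlen ⊢
      omega
    · refine ⟨fun j => Nat.casesOn j 0 fun j => i + s j, monotone_nat_of_le_succ ?_, rfl, ?_, ?_⟩
      · rintro (_ | j)
        · simp
        · exact Nat.add_le_add_left (hs (Nat.le_succ j)) i
      · simp at hsL ⊢
        omega
      · intro w hwt j hj
        obtain ⟨x, hx, y, hy, rfl⟩ := htw w hwt
        cases j with
        | zero =>
          obtain ⟨a, ha, rfl⟩ := List.mem_iff_getElem.1 hx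
          simp only [List.length_take] at ha
          refine ⟨a, by simp, by simp only [hs0]; omega, ?_⟩
          simp only [wcons, List.getElem_take]
          exact List.getElem?_eq_getElem _
        | succ j =>
          obtain ⟨a, ha, ha', e⟩ := hw y hy j (by omega)
          refine ⟨i + a, by simpa using ha, by simpa using ha', ?_⟩
          rw [List.getElem?_drop] at e
          exact e

/-- Vanishing on lists with two equal neighbours. -/
def Normalized (ε : List G → R) : Prop :=
  ∀ l₁ a l₂, ε (l₁ ++ a :: a :: l₂) = 0

lemma shuffle_snd (ε : List H → R) (hε : Normalized ε) (h0 : ε [] = 0) (xs : List G)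
    (ys : List H) :
    shuffle (fun _ y => y) ε xs ys = if xs.length = 1 then ε ys else 0 := by
  by_cases hys : ys = []
  · simp [hys, h0]
  clear h0
  induction xs, ys using shuffle_induction generalizing ε with
  | nil_left ys => simp
  | nil_right xs => exact absurd rfl hys
  | cons x xs y ys ih₁ ih₂ =>
    have hε' : Normalized fun t => ε (y :: t) := fun l₁ a l₂ => hε (y :: l₁) a l₂
    have hd : ε (y :: y :: ys) = 0 := hε [] y ys
    rw [shuffle_cons, ih₁ _ hε' (by simp)]
    cases ys with
    | nil => cases xs <;> simp [hd]
    | cons y' ys => rw [ih₂ _ hε' (by simp)]; cases xs <;> simp [hd]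

/-- Evaluation of `wordOp` on cochains which only see the tail of a word. -/
lemma wordOp_tail (L : ℕ) (ε : List G → R) (hε : Normalized ε) (h0 : ε [] = 0) (gs : List G) :
    wordOp L (fun ws => ε (ws.map fun w => w L)) gs = ε gs := by
  induction L generalizing gs with
  | zero => simp [wordOp, Function.comp_def]
  | succ L ih =>
    simp only [wordOp]
    have e : ∀ (p : List G) (ws : List (ℕ → G)),
        shuffle wcons (fun ws => ε (ws.map fun w => w (L + 1))) p ws =
          (if p.length = 1 then 1 else 0) * ε (ws.map fun w => w L) := by
      intro p ws
      rw [← shuffle_map wcons (fun _ y => y) id (fun w : ℕ → G => w L)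
        (fun w : ℕ → G => w (L + 1)) (fun _ _ => rfl), shuffle_snd ε hε h0]
      simp
    simp only [e, wordOp_mul_left, ih]
    cases gs with
    | nil => simp [h0]
    | cons x l =>
      rw [cut_cons, cut_eq_zero]
      · simp
      · intro i hi
        have : l ≠ [] := List.length_pos_iff.1 (by omega)
        simp [this]

end Words

section Cup

variable {X Y R : Type*} [CommRing R]

/-- The cup product of cochains. -/
def cup (α β : List X → R) : List X → R :=
  cut fun p s => α p * β s

@[simp] lemma cup_nil (α β : List X → R) : cup α β [] = 0 := rfl

lemma cup_cons (α β : List X → R) (x : X) (l : List X) :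
    cup α β (x :: l) = α [x] * β (x :: l) + cup (fun t => α (x :: t)) β l := rfl

lemma cup_eq_zero (α β : List X → R) (l : List X)
    (h : ∀ i < l.length, α (l.take (i + 1)) * β (l.drop i) = 0) : cup α β l = 0 :=
  cut_eq_zero _ l h

lemma cup_add_left (α α' β : List X → R) (l : List X) :
    cup (fun t => α t + α' t) β l = cup α β l + cup α' β l := by
  simp only [cup, add_mul, cut_add]

lemma cup_mul_left (a : R) (α β : List X → R) (l : List X) :
    cup (fun t => a * α t) β l = a * cup α β l := by
  simp only [cup, mul_assoc, cut_mul_left]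

lemma cup_map (f : X → Y) (α β : List Y → R) (l : List X) :
    cup α β (l.map f) = cup (fun t => α (t.map f)) (fun t => β (t.map f)) l :=
  cut_map f _ l

lemma cup_assoc (α β γ : List X → R) (l : List X) :
    cup (cup α β) γ l = cup α (cup β γ) l := by
  induction l generalizing α with
  | nil => rfl
  | cons x l ih =>
    rw [cup_cons, cup_cons α (cup β γ), cup_cons β γ]
    simp only [cup_cons α β, cup_add_left, cup_mul_left, ih, cup_nil]
    ring

lemma cobd_cup (α β : List X → R) (hα : ∀ l, cobd α l = 0) (hβ : ∀ l, cobd β l = 0)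
    (hα0 : α [] = 0) (hβ0 : β [] = 0) (l : List X) : cobd (cup α β) l = 0 := by
  have h := cut_cobd (fun p s => α p * β s) (fun p => by simp [hβ0]) l
  have e : (fun p s : List X => cobd (fun t => α t * β s) p -
      (-1) ^ p.length * cobd (fun t => α p * β t) s) = fun _ _ => 0 := by
    funext p s
    rw [cobd_mul_right, cobd_mul_left, hα, hβ]
    simp
  rw [e, cut_zero, hα0, zero_mul, add_zero] at h
  exact h.symm

lemma Normalized.cup {α β : List X → R} (hα : Normalized α) (hβ : Normalized β) :
    Normalized (cup α β) := by
  intro l₁ a l₂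
  induction l₁ generalizing α with
  | nil =>
    have h : ∀ p, α (a :: a :: p) = 0 := fun p => hα [] a p
    have h' : β (a :: a :: l₂) = 0 := hβ [] a l₂
    simp only [List.nil_append, cup_cons, h, h']
    rw [cup_eq_zero] <;> simp
  | cons x l₁ ih =>
    have h : β (x :: (l₁ ++ a :: a :: l₂)) = 0 := hβ (x :: l₁) a l₂
    simp only [List.cons_append, cup_cons, h]
    rw [ih fun l₁ a l₂ => hα (x :: l₁) a l₂]
    simp

/-- The unit cochain, as a function on lists. -/
def unitCochain (l : List X) : R :=
  if l.length = 1 then 1 else 0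

lemma cup_unitCochain (α : List X → R) (l : List X) (hl : l ≠ []) :
    cup α unitCochain l = α l := by
  induction l generalizing α with
  | nil => exact absurd rfl hl
  | cons x l ih =>
    rw [cup_cons]
    by_cases h : l = []
    · simp [h, unitCochain]
    · rw [ih _ h]
      simp [unitCochain, h]

/-- The iterated cup product `ε (n - 1) ∪ … ∪ ε 0`. -/
def cupSeq (ε : ℕ → List X → R) : ℕ → List X → R
  | 0 => unitCochain
  | n + 1 => cup (ε n) (cupSeq ε n)

@[simp] lemma cupSeq_nil (ε : ℕ → List X → R) (n : ℕ) : cupSeq ε n [] = 0 := by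
  cases n with
  | zero => simp [cupSeq, unitCochain]
  | succ n => rfl

lemma cupSeq_map (f : X → Y) (ε : ℕ → List Y → R) (n : ℕ) (l : List X) :
    cupSeq ε n (l.map f) = cupSeq (fun i t => ε i (t.map f)) n l := by
  induction n generalizing l with
  | zero => simp [cupSeq, unitCochain]
  | succ n ih =>
    simp only [cupSeq, cup_map]
    congr 1
    funext t
    exact ih t

lemma cobd_cupSeq (ε : ℕ → List X → R) (hε : ∀ i l, cobd (ε i) l = 0) (hε0 : ∀ i, ε i [] = 0)
    (n : ℕ) (l : List X) : cobd (cupSeq ε n) l = 0 := by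
  induction n generalizing l with
  | zero =>
    rcases l with _ | ⟨x, _ | ⟨y, _ | ⟨z, l⟩⟩⟩ <;> simp [cupSeq, unitCochain, cobd_cons]
  | succ n ih => exact cobd_cup _ _ (hε n) ih (hε0 n) (cupSeq_nil ε n) l

lemma Normalized.cupSeq {ε : ℕ → List X → R} (hε : ∀ i, Normalized (ε i)) (n : ℕ) :
    Normalized (cupSeq ε n) := by
  induction n with
  | zero =>
    intro l₁ a l₂
    simp only [ListCochain.cupSeq, unitCochain]
    rw [if_neg]
    simp only [List.length_append, List.length_cons]
    omega
  | succ n ih => exact (hε n).cup ih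

/-- The simplices supporting an iterated cup product contain faces supporting its factors. -/
lemma exists_subset_of_cupSeq_ne_zero (ε : ℕ → List X → R) (n : ℕ) (l : List X)
    (h : cupSeq ε n l ≠ 0) (i : ℕ) (hi : i < n) : ∃ t, t ⊆ l ∧ ε i t ≠ 0 := by
  induction n generalizing l with
  | zero => omega
  | succ n ih =>
    by_contra! H
    refine h (cup_eq_zero _ _ _ fun j hj => ?_)
    rcases Nat.lt_succ_iff_lt_or_eq.1 hi with hi' | rfl
    · by_cases h0 : cupSeq ε n (l.drop j) = 0
      · rw [h0, mul_zero]
      · obtain ⟨t, ht, ht'⟩ := ih _ h0 hi'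
        exact absurd (H t fun a ha => List.drop_subset _ _ (ht ha)) ht'
    · rw [H _ (List.take_subset _ _), zero_mul]

lemma cupSeq_add (ε : List X → R) (m n : ℕ) (l : List X) :
    cup (cupSeq (fun _ => ε) m) (cupSeq (fun _ => ε) n) l = cupSeq (fun _ => ε) (m + n) l := by
  induction m generalizing l with
  | zero =>
    rw [zero_add]
    cases l with
    | nil => simp
    | cons x l =>
      rw [cup_cons, cup_eq_zero]
      · simp [cupSeq, unitCochain]
      · intro i hi
        have : l ≠ [] := List.length_pos_iff.1 (by omega)
        simp [cupSeq, unitCochain, this]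
  | succ m ih =>
    rw [Nat.succ_add]
    simp only [cupSeq]
    rw [cup_assoc]
    congr 1
    funext t
    exact ih t

lemma cupSeq_mul (ε : List X → R) (m n : ℕ) (l : List X) :
    cupSeq (fun _ => cupSeq (fun _ => ε) m) n l = cupSeq (fun _ => ε) (m * n) l := by
  induction n generalizing l with
  | zero => rfl
  | succ n ih =>
    have e : cupSeq (fun _ => cupSeq (fun _ => ε) m) n = cupSeq (fun _ => ε) (m * n) :=
      funext ih
    rw [cupSeq, e, cupSeq_add, Nat.mul_succ, add_comm]

/-- `φ` vanishes off the simplices of dimension `d`. -/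
def HasDegree (d : ℕ) (φ : List X → R) : Prop :=
  ∀ l, l.length ≠ d + 1 → φ l = 0

lemma HasDegree.cup {d d' : ℕ} {α β : List X → R} (hα : HasDegree d α) (hβ : HasDegree d' β) :
    HasDegree (d + d') (cup α β) := by
  refine fun l hl => cup_eq_zero _ _ _ fun i hi => ?_
  by_cases h : i = d
  · rw [hβ, mul_zero]
    rw [List.length_drop]
    omega
  · rw [hα, zero_mul]
    rw [List.length_take]
    omega

lemma HasDegree.cupSeq {d : ℕ} {ε : List X → R} (hε : HasDegree d ε) (n : ℕ) :
    HasDegree (n * d) (cupSeq (fun _ => ε) n) := by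
  induction n with
  | zero =>
    intro l hl
    simp only [ListCochain.cupSeq, unitCochain]
    rw [if_neg (by simpa using hl)]
  | succ n ih =>
    rw [Nat.succ_mul, add_comm]
    exact hε.cup ih

end Cup

section Vandermonde

variable {F : Type*} [Field F]

/-- The Vandermonde product of a list. -/
def vdm : List F → F
  | [] => 1
  | x :: l => (l.map fun y => y - x).prod * vdm l

lemma vdm_cons (x : F) (l : List F) : vdm (x :: l) = (l.map fun y => y - x).prod * vdm l := rfl

lemma vdm_add (a : F) (l : List F) : vdm (l.map fun x => a + x) = vdm l := by
  induction l with
  | nil => rfl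
  | cons x l ih => simp [vdm_cons, ih, Function.comp_def]

lemma vdm_ne_zero {l : List F} : vdm l ≠ 0 ↔ l.Nodup := by
  induction l with
  | nil => simp [vdm]
  | cons x l ih =>
    rw [vdm_cons, mul_ne_zero_iff, ih, List.nodup_cons, Ne, List.prod_eq_zero_iff]
    simp [sub_eq_zero]

lemma vdm_append (l₁ l₂ : List F) :
    vdm (l₁ ++ l₂) = vdm l₁ * (l₂.map fun y => (l₁.map fun x => y - x).prod).prod * vdm l₂ := by
  induction l₁ with
  | nil => simp [vdm]
  | cons x l₁ ih =>
    simp only [List.cons_append, vdm_cons, ih, List.map_append, List.prod_append, List.map_cons,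
      List.prod_cons, List.prod_map_mul]
    ring

lemma vdm_swap (l₁ : List F) (a b : F) (l₂ : List F) :
    vdm (l₁ ++ a :: b :: l₂) = -vdm (l₁ ++ b :: a :: l₂) := by
  induction l₁ with
  | nil => simp only [List.nil_append, vdm_cons, List.map_cons, List.prod_cons]; ring
  | cons x l₁ ih =>
    simp only [List.cons_append, vdm_cons, ih, List.map_append, List.prod_append, List.map_cons,
      List.prod_cons]
    ring

lemma vdm_ofFn {n : ℕ} (v : Fin n → F) : vdm (List.ofFn v) = (Matrix.vandermonde v).det := by
  rw [Matrix.det_vandermonde]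
  induction n with
  | zero => simp [vdm]
  | succ n ih =>
    rw [List.ofFn_succ, vdm_cons, ih, Fin.prod_univ_succ, List.map_ofFn, List.prod_ofFn]
    simp [Fin.prod_Ioi_succ]

lemma cobd_ofFn {X R : Type*} [CommRing R] {n : ℕ} (φ : List X → R) (v : Fin (n + 1) → X) :
    cobd φ (List.ofFn v) =
      ∑ i : Fin (n + 1), (-1) ^ (i : ℕ) * φ (List.ofFn fun j => v (i.succAbove j)) := by
  induction n generalizing φ with
  | zero => simp [cobd_cons]
  | succ n ih =>
    rw [List.ofFn_succ, cobd_cons, ih, Fin.sum_univ_succ (n := n + 1), sub_eq_add_neg,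
      ← Finset.sum_neg_distrib]
    congr 1
    · simp
    · refine Finset.sum_congr rfl fun i _ => ?_
      rw [List.ofFn_succ]
      simp [pow_succ]

lemma cobd_vdm (l : List F) (hl : 2 ≤ l.length) : cobd vdm l = 0 := by
  obtain ⟨n, hn⟩ : ∃ n, l.length = n + 2 := ⟨l.length - 2, by omega⟩
  obtain ⟨v, rfl⟩ : ∃ v : Fin (n + 2) → F, l = List.ofFn v :=
    ⟨fun i => l.get (i.cast hn.symm), by rw [← List.ofFn_congr hn, List.ofFn_get]⟩
  let A : Matrix (Fin (n + 2)) (Fin (n + 2)) F := fun i j => v i ^ ((j : ℕ) - 1)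
  have hA : A.det = 0 := Matrix.det_zero_of_column_eq (i := 0) (j := 1) (by simp) fun i => by
    simp [A]
  rw [cobd_ofFn, ← hA, Matrix.det_succ_column_zero]
  refine Finset.sum_congr rfl fun i _ => ?_
  rw [vdm_ofFn]
  have : A i 0 = 1 := by simp [A]
  rw [this, mul_one]
  rfl

end Vandermonde

section EulerCochain

variable {G F : Type*} [AddCommGroup G] [Field F]

/-- The cochain whose value on `k` group elements is the Vandermonde product of their images. -/
def vdmCochain (k : ℕ) (ι : G →+ F) (l : List G) : F :=
  if l.length = k then vdm (l.map ι) else 0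

lemma vdmCochain_map_add (k : ℕ) (ι : G →+ F) (a : G) (l : List G) :
    vdmCochain k ι (l.map fun x => a + x) = vdmCochain k ι l := by
  simp only [vdmCochain, List.length_map]
  congr 1
  rw [← vdm_add (ι a) (l.map ι)]
  simp [Function.comp_def]

lemma hasDegree_vdmCochain (d : ℕ) (ι : G →+ F) : HasDegree d (vdmCochain (d + 1) ι) :=
  fun _ hl => if_neg hl

lemma vdmCochain_nil (d : ℕ) (ι : G →+ F) : vdmCochain (d + 1) ι [] = 0 :=
  hasDegree_vdmCochain d ι [] (by simp)

lemma cobd_vdmCochain (d : ℕ) (ι : G →+ F) (l : List G) :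
    cobd (vdmCochain (d + 1) ι) l = 0 := by
  by_cases h : l.length = d + 2
  · rw [cobd_congr (ψ := fun t => vdm (t.map ι)), cobd_map, cobd_vdm]
    · simp [h]
    · intro t ht
      rw [vdmCochain, if_pos (by omega)]
  · rw [cobd_congr (ψ := fun _ => 0), cobd_zero]
    intro t ht
    exact hasDegree_vdmCochain d ι t (by omega)

lemma nodup_of_vdmCochain_ne_zero {k : ℕ} {ι : G →+ F} {l : List G} (h : vdmCochain k ι l ≠ 0) :
    l.length = k ∧ l.Nodup := by
  unfold vdmCochain at h
  split_ifs at h with hk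
  · exact ⟨hk, (vdm_ne_zero.1 h).of_map _⟩
  · exact absurd rfl h

lemma mem_of_vdmCochain_ne_zero [Fintype G] {ι : G →+ F} {l : List G}
    (h : vdmCochain (Fintype.card G) ι l ≠ 0) (g : G) : g ∈ l := by
  classical
  obtain ⟨hl, hn⟩ := nodup_of_vdmCochain_ne_zero h
  have : l.toFinset = Finset.univ := by
    rw [← Finset.card_eq_iff_eq_univ, List.toFinset_card_of_nodup hn, hl]
  rw [← List.mem_toFinset, this]
  exact Finset.mem_univ g

lemma normalized_vdmCochain (k : ℕ) (ι : G →+ F) : Normalized (vdmCochain k ι) := by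
  intro l₁ a l₂
  by_contra h
  have := (nodup_of_vdmCochain_ne_zero h).2
  rw [List.nodup_append] at this
  simp at this

lemma vdmCochain_swap (k : ℕ) (ι : G →+ F) (l₁ : List G) (a b : G) (l₂ : List G) :
    vdmCochain k ι (l₁ ++ a :: b :: l₂) = -vdmCochain k ι (l₁ ++ b :: a :: l₂) := by
  simp only [vdmCochain, List.length_append, List.length_cons, List.map_append, List.map_cons,
    vdm_swap _ (ι a) (ι b)]
  split_ifs <;> simp

end EulerCochain

section ShuffleCut

variable {X Y W R : Type*} [CommRing R]

lemma cut_congr_of_length {χ ψ : List X → List X → R} {l : List X}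
    (h : ∀ p s, p ≠ [] → p.length + s.length = l.length + 1 → χ p s = ψ p s) :
    cut χ l = cut ψ l := by
  refine cut_congr fun i hi => h _ _ ?_ ?_
  · exact List.length_pos_iff.1 (by rw [List.length_take]; omega)
  · rw [List.length_take, List.length_drop]
    omega

/-- The sum over the cuts of `ys` of the products of shuffles with the two halves of a cut of a
second simplex. -/
def shuffleCut (c : X → Y → W) (χ : List W → List W → R) (xs₁ xs₂ : List X) (ys : List Y) : R :=
  cut (fun ys₁ ys₂ => (-1) ^ ((ys₁.length + 1) * (xs₂.length + 1)) *
    shuffle c (fun p => shuffle c (χ p) xs₂ ys₂) xs₁ ys₁) ys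

lemma shuffleCut_nil (c : X → Y → W) (χ : List W → List W → R) (xs : List X) (ys : List Y) :
    shuffleCut c χ [] xs ys = 0 := by
  simp [shuffleCut]

lemma shuffleCut_cons (c : X → Y → W) (χ : List W → List W → R) (x : X) (xs₁ xs₂ : List X)
    (y : Y) (ys : List Y) :
    shuffleCut c χ (x :: xs₁) xs₂ (y :: ys) =
      (if xs₁.length = 0 then shuffle c (χ [c x y]) xs₂ (y :: ys) else 0) +
      shuffleCut c (fun p => χ (c x y :: p)) xs₁ xs₂ (y :: ys) +
      (-1) ^ (xs₁.length + xs₂.length + 1) *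
        shuffleCut c (fun p => χ (c x y :: p)) (x :: xs₁) xs₂ ys := by
  simp only [shuffleCut, cut_cons, shuffle_cons, shuffle_nil_right]
  rw [← cut_mul_left, add_assoc, add_assoc, add_assoc, ← cut_add]
  have h1 : ∀ a : ℕ, (-1 : R) ^ (([y].length + 1) * (a + 1)) = 1 := fun a =>
    Even.neg_one_pow ⟨a + 1, by simp; ring⟩
  rw [h1]
  have e : cut (fun (q : List Y) (r : List Y) =>
      (-1 : R) ^ (((y :: q).length + 1) * (xs₂.length + 1)) *
        ((if xs₁.length + q.length = 0 then shuffle c (χ [c x y]) xs₂ r else 0) +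
          shuffle c (fun t => shuffle c (χ (c x y :: t)) xs₂ r) xs₁ (y :: q) +
          (-1) ^ xs₁.length * shuffle c (fun t => shuffle c (χ (c x y :: t)) xs₂ r) (x :: xs₁) q))
      ys = cut (fun (q : List Y) (r : List Y) =>
      (-1 : R) ^ (((y :: q).length + 1) * (xs₂.length + 1)) *
          shuffle c (fun t => shuffle c (χ (c x y :: t)) xs₂ r) xs₁ (y :: q) +
        (-1) ^ (xs₁.length + xs₂.length + 1) * ((-1) ^ ((q.length + 1) * (xs₂.length + 1)) *
          shuffle c (fun t => shuffle c (χ (c x y :: t)) xs₂ r) (x :: xs₁) q)) ys := by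
    refine cut_congr_of_length fun q r hq _ => ?_
    replace hq : q.length ≠ 0 := by simpa using hq
    have hs : (-1 : R) ^ (((y :: q).length + 1) * (xs₂.length + 1)) * (-1) ^ xs₁.length =
        (-1) ^ (xs₁.length + xs₂.length + 1) * (-1) ^ ((q.length + 1) * (xs₂.length + 1)) := by
      rw [← pow_add, ← pow_add]
      congr 1
      simp only [List.length_cons]
      ring
    simp only [hq, add_eq_zero, and_false, if_false]
    linear_combination shuffle c (fun t => shuffle c (χ (c x y :: t)) xs₂ r) (x :: xs₁) q * hs
  rw [e]
  simp only [List.length_nil, add_zero]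
  ring

/-- Compatibility of shuffles and cuts. -/
lemma shuffle_cut (c : X → Y → W) (χ : List W → List W → R) (xs : List X) (ys : List Y) :
    shuffle c (cut χ) xs ys = cut (fun xs₁ xs₂ => shuffleCut c χ xs₁ xs₂ ys) xs := by
  induction xs, ys using shuffle_induction generalizing χ with
  | nil_left ys => simp
  | nil_right xs => simp [shuffleCut]
  | cons x xs y ys ih₁ ih₂ =>
    have e : cut (fun p s => shuffleCut c χ (x :: p) s (y :: ys)) xs =
        cut (fun p s => shuffleCut c (fun p => χ (c x y :: p)) p s (y :: ys) +
          (-1) ^ xs.length * shuffleCut c (fun p => χ (c x y :: p)) (x :: p) s ys) xs := by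
      refine cut_congr_of_length fun p s hp hl => ?_
      rw [shuffleCut_cons, if_neg (by simpa using hp), zero_add, hl, pow_add, pow_add]
      simp
    rw [cut_cons, e, cut_add, cut_mul_left, shuffleCut_cons, shuffleCut_nil,
      shuffle_cons, shuffle_cons]
    simp only [cut_cons, shuffle_add, ih₁, ih₂]
    simp only [cut_nil, List.length_nil, List.length_cons, pow_succ, pow_add]
    split_ifs <;> simp <;> ring

lemma shuffle_cup (c : X → Y → W) (α β : List W → R) (xs : List X) (ys : List Y) :
    shuffle c (cup α β) xs ys = cut (fun xs₁ xs₂ => cut (fun ys₁ ys₂ =>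
      (-1) ^ ((ys₁.length + 1) * (xs₂.length + 1)) *
        (shuffle c α xs₁ ys₁ * shuffle c β xs₂ ys₂)) ys) xs := by
  rw [cup, shuffle_cut]
  congr 1
  funext xs₁ xs₂
  simp only [shuffleCut]
  congr 1
  funext ys₁ ys₂
  congr 1
  simp only [shuffle_mul_left]
  rw [mul_comm, ← shuffle_mul_left]
  simp only [mul_comm]

end ShuffleCut

section CharP

variable {F : Type*} [Field F] (p : ℕ) [Fact p.Prime] [CharP F p]

lemma neg_one_pow_mul_pred (m : ℕ) : (-1 : F) ^ (m * (p - 1)) = 1 := by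
  have hp : p = p - 1 + 1 := (Nat.succ_pred_prime Fact.out).symm
  have h : (-1 : F) ^ (p - 1 + 1) = -1 := by rw [← hp]; exact neg_one_pow_char F p
  have h' : (-1 : F) ^ (p - 1) = 1 := by
    rw [pow_succ] at h
    linear_combination -h
  rw [mul_comm, pow_mul, h', one_pow]

lemma prod_sub_zmod (z : F) :
    ∏ c : ZMod p, (z - ZMod.castHom (dvd_refl p) F c) = z ^ p - z := by
  have hp : 1 < p := (Fact.out : p.Prime).one_lt
  have hmonic : (Polynomial.X ^ p - Polynomial.X : Polynomial (ZMod p)).Monic :=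
    Polynomial.monic_X_pow_sub (by simpa using hp)
  have hroots : (Polynomial.X ^ p - Polynomial.X : Polynomial (ZMod p)).roots =
      Finset.univ.val := by
    have := FiniteField.roots_X_pow_card_sub_X (ZMod p)
    rwa [ZMod.card] at this
  have h := Polynomial.prod_multiset_X_sub_C_of_monic_of_roots_card_eq hmonic (by
    rw [hroots, FiniteField.X_pow_card_sub_X_natDegree_eq _ hp]
    simp [ZMod.card])
  rw [hroots] at h
  have h' := congrArg (Polynomial.eval₂ (ZMod.castHom (dvd_refl p) F) z) h
  change Polynomial.eval₂ _ z (∏ c : ZMod p, (Polynomial.X - Polynomial.C c)) = _ at h'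
  rw [Polynomial.eval₂_finsetProd] at h'
  simpa using h'

variable {p}

lemma addMonoidHom_zmod_apply (f : ZMod p →+ F) (c : ZMod p) :
    f c = ZMod.castHom (dvd_refl p) F c * f 1 := by
  obtain ⟨n, rfl⟩ := ZMod.natCast_zmod_surjective c
  rw [map_natCast (ZMod.castHom _ F), ← nsmul_eq_mul, ← map_nsmul, nsmul_one]

lemma prod_add_zmod (f : ZMod p →+ F) (z : F) :
    ∏ c : ZMod p, (z + f c) = z ^ p - f 1 ^ (p - 1) * z := by
  have hp : p = p - 1 + 1 := (Nat.succ_pred_prime Fact.out).symm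
  by_cases hu : f 1 = 0
  · have h0 : ∀ c, f c = 0 := fun c => by rw [addMonoidHom_zmod_apply f c, hu, mul_zero]
    have : p - 1 ≠ 0 := by have := (Fact.out : p.Prime).one_lt; omega
    simp [h0, this, ZMod.card]
  · have h := prod_sub_zmod p (-z / f 1)
    have e : ∀ c : ZMod p, z + f c =
        -f 1 * (-z / f 1 - ZMod.castHom (dvd_refl p) F c) := by
      intro c
      rw [addMonoidHom_zmod_apply f c]
      field_simp
      ring
    rw [Finset.prod_congr rfl fun c _ => e c, Finset.prod_mul_distrib, h, Finset.prod_const,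
      Finset.card_univ, ZMod.card, neg_pow (f 1), neg_one_pow_char]
    have h1 : (-z / f 1) ^ p = -(z ^ p / f 1 ^ p) := by
      rw [div_pow, neg_pow, neg_one_pow_char, neg_one_mul, neg_div]
    have h2 : f 1 ^ p = f 1 ^ (p - 1) * f 1 := by rw [← pow_succ, ← hp]
    have h3 : f 1 ^ (p - 1) ≠ 0 := pow_ne_zero _ hu
    rw [h1, h2]
    field_simp
    ring

variable {H : Type*} [AddCommGroup H]

/-- The norm of an additive map along the first factor, which is additive in the second factor. -/
def fibreNorm (ι : ZMod p × H →+ F) : H →+ F where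
  toFun y := ∏ c : ZMod p, ι (c, y)
  map_zero' := Finset.prod_eq_zero (Finset.mem_univ 0) ι.map_zero
  map_add' y y' := by
    have e : ∀ y : H, ∏ c : ZMod p, ι (c, y) = ι (0, y) ^ p -
        (ι.comp (AddMonoidHom.inl (ZMod p) H)) 1 ^ (p - 1) * ι (0, y) := by
      intro y
      rw [← prod_add_zmod (ι.comp (AddMonoidHom.inl (ZMod p) H))]
      refine Finset.prod_congr rfl fun c _ => ?_
      simp [← map_add]
    have h : ι (0, y + y') = ι (0, y) + ι (0, y') := by simp [← map_add]
    rw [e, e, e, h, add_pow_char]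
    ring

lemma fibreNorm_apply (ι : ZMod p × H →+ F) (y : H) :
    fibreNorm ι y = ∏ c : ZMod p, ι (c, y) := rfl

/-- The additive map on the second factor induced by an additive map on a product. -/
def fibreMap (ι : ZMod p × H →+ F) : H →+ F :=
  ((frobenius F p : F →+* F) : F →+ F).comp (fibreNorm ι)

lemma fibreMap_apply (ι : ZMod p × H →+ F) (y : H) : fibreMap ι y = fibreNorm ι y ^ p := rfl

lemma fibreMap_injective {ι : ZMod p × H →+ F} (hι : Function.Injective ι) :
    Function.Injective (fibreMap ι) := by
  rw [injective_iff_map_eq_zero]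
  intro y hy
  rw [fibreMap_apply, fibreNorm_apply] at hy
  have h := eq_zero_of_pow_eq_zero hy
  obtain ⟨c, -, hc⟩ := Finset.prod_eq_zero_iff.1 h
  have := hι (hc.trans ι.map_zero.symm)
  exact (Prod.ext_iff.1 this).2

lemma prod_sub_of_nodup (ι : ZMod p × H →+ F) (q : List (ZMod p)) (hq : q.length = p)
    (hn : q.Nodup) (x : ZMod p) (y y' : H) :
    (q.map fun c => ι (x, y') - ι (c, y)).prod = fibreNorm ι (y' - y) := by
  have hu : q.toFinset = Finset.univ := by
    rw [← Finset.card_eq_iff_eq_univ, List.toFinset_card_of_nodup hn, hq, ZMod.card]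
  rw [← List.prod_toFinset _ hn, hu, fibreNorm_apply]
  refine Fintype.prod_equiv (Equiv.subLeft x) _ _ fun c => ?_
  rw [← map_sub]
  rfl

end CharP

section Row

variable {X Y W R : Type*} [CommRing R]

lemma shuffle_singleton (c : X → Y → W) (φ : List W → R) (xs : List X) (y : Y) (hxs : xs ≠ []) :
    shuffle c φ xs [y] = φ (xs.map fun x => c x y) := by
  induction xs generalizing φ with
  | nil => exact absurd rfl hxs
  | cons x xs ih =>
    rw [shuffle_cons]
    by_cases h : xs = []
    · simp [h]
    · rw [ih _ h]
      simp [h]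

/-- Decomposition of the lattice paths according to the initial segment in the first row. -/
lemma shuffle_row (c : X → Y → W) (φ : List W → R) (xs : List X) (y y' : Y) (ys : List Y) :
    shuffle c φ xs (y :: y' :: ys) = cut (fun q s => (-1) ^ (s.length + 1) *
      shuffle c (fun t => φ (q.map (fun x => c x y) ++ t)) s (y' :: ys)) xs := by
  induction xs generalizing φ with
  | nil => simp
  | cons x xs ih =>
    rw [shuffle_cons, ih, cut_cons]
    simp [pow_succ]
    ring

lemma shuffle_eq_zero_of_lt [Fintype X] (φ : List (X × Y) → R) (hφ : ∀ t, ¬t.Nodup → φ t = 0)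
    (xs : List X) (ys : List Y) (h : Fintype.card X * ys.length + 1 < xs.length + ys.length) :
    shuffle Prod.mk φ xs ys = 0 := by
  classical
  refine shuffle_eq_zero _ _ _ _ fun t ht hw => hφ t fun hn => ?_
  have h1 : t.toFinset ⊆ Finset.univ ×ˢ ys.toFinset := by
    intro w hwt
    obtain ⟨x, -, y, hy, rfl⟩ := hw w (by simpa using hwt)
    simpa using hy
  have h2 := Finset.card_le_card h1
  rw [List.toFinset_card_of_nodup hn, Finset.card_product, Finset.card_univ] at h2
  have h3 := Nat.mul_le_mul_left (Fintype.card X) (List.toFinset_card_le ys)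
  omega

end Row

section Window

variable {F : Type*} [Field F] {p : ℕ} [Fact p.Prime] {H : Type*} [AddCommGroup H]

/-- The restriction of an additive map to the first factor. -/
abbrev baseMap (ι : ZMod p × H →+ F) : ZMod p →+ F := ι.comp (AddMonoidHom.inl (ZMod p) H)

lemma vdm_map_row (ι : ZMod p × H →+ F) (q : List (ZMod p)) (y : H) :
    vdm ((q.map fun x => (x, y)).map ι) = vdm (q.map (baseMap ι)) := by
  rw [← vdm_add (ι (0, y)) (q.map (baseMap ι))]
  simp [Function.comp_def, ← map_add]

/-- A Vandermonde cochain with a weight depending on the second coordinates. -/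
def weightedVdm (ι : ZMod p × H →+ F) (g : H → F) (t : List (ZMod p × H)) : F :=
  vdm (t.map ι) * (t.map fun w => g w.2).prod

lemma weightedVdm_of_not_nodup (ι : ZMod p × H →+ F) (g : H → F) (t : List (ZMod p × H))
    (ht : ¬t.Nodup) : weightedVdm ι g t = 0 := by
  have : vdm (t.map ι) = 0 := by
    by_contra h
    exact ht ((vdm_ne_zero.1 h).of_map _)
  rw [weightedVdm, this, zero_mul]

lemma shuffle_vdmCochain_of_lt (ι : ZMod p × H →+ F) (d : ℕ)
    (xs : List (ZMod p)) (ys : List H) (hys : ys.length ≤ d) :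
    shuffle Prod.mk (vdmCochain (p * (d + 1)) ι) xs ys = 0 := by
  by_cases h : xs.length + ys.length = p * (d + 1) + 1
  · refine shuffle_eq_zero_of_lt _ (fun t ht => ?_) _ _ ?_
    · by_contra h'
      exact ht (nodup_of_vdmCochain_ne_zero h').2
    · rw [ZMod.card, h]
      have := (Fact.out : p.Prime).pos
      have := Nat.mul_lt_mul_of_pos_left (Nat.lt_succ_of_le hys) this
      simp only [Nat.succ_eq_add_one] at this
      omega
  · refine shuffle_eq_zero _ _ _ _ fun t ht _ => if_neg ?_
    omega

lemma shuffle_cupSeq_vdmCochain_of_lt (ι : ZMod p × H →+ F) (d n : ℕ)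
    (xs : List (ZMod p)) (ys : List H) (hys : ys.length ≤ n * d) :
    shuffle Prod.mk (cupSeq (fun _ => vdmCochain (p * (d + 1)) ι) n) xs ys = 0 := by
  induction n generalizing xs ys with
  | zero =>
    have : ys = [] := List.length_eq_zero_iff.1 (by omega)
    simp [this]
  | succ n ih =>
    rw [cupSeq, shuffle_cup, ← cut_zero xs]
    refine cut_congr_of_length fun xs₁ xs₂ _ _ => ?_
    rw [← cut_zero ys]
    refine cut_congr_of_length fun ys₁ ys₂ _ hl => ?_
    rw [Nat.succ_mul] at hys
    by_cases h : ys₁.length ≤ d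
    · rw [shuffle_vdmCochain_of_lt ι d _ _ h, zero_mul, mul_zero]
    · rw [ih _ _ (by omega), mul_zero, mul_zero]

variable [CharP F p]

lemma weightedVdm_row_append {ι : ZMod p × H →+ F} (g : H → F) (q : List (ZMod p)) (y : H)
    (hq : q.length = p) (hn : q.Nodup) (t : List (ZMod p × H)) :
    weightedVdm ι g (q.map (fun x => (x, y)) ++ t) = vdm (q.map (baseMap ι)) * g y ^ p *
      weightedVdm ι (fun y' => g y' * fibreNorm ι (y' - y)) t := by
  have e : (fun w : ZMod p × H => (q.map fun c => ι w - ι (c, y)).prod) =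
      fun w => fibreNorm ι (w.2 - y) :=
    funext fun w => prod_sub_of_nodup ι q hq hn w.1 y w.2
  simp only [weightedVdm, List.map_append, vdm_append, vdm_map_row, List.prod_append,
    List.prod_map_mul]
  simp only [List.map_map, Function.comp_def, e, List.map_const', List.prod_replicate, hq]
  ring

/-- The lattice paths passing through all the rows factor the weighted Vandermonde cochain. -/
lemma shuffle_weightedVdm {ι : ZMod p × H →+ F} (hι : Function.Injective ι) (g : H → F)
    (xs : List (ZMod p)) (y : H) (ys : List H)
    (hxs : xs.length = (ys.length + 1) * (p - 1) + 1) :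
    shuffle Prod.mk (weightedVdm ι g) xs (y :: ys) =
      cupSeq (fun _ => vdmCochain p (baseMap ι)) (ys.length + 1) xs *
        (((y :: ys).map fun y => g y ^ p).prod * vdm ((y :: ys).map (fibreMap ι))) := by
  have hp : 1 < p := (Fact.out : p.Prime).one_lt
  have hinj : Function.Injective (baseMap ι) := by
    intro a b hab
    exact (Prod.ext_iff.1 (hι hab)).1
  induction ys generalizing g y xs with
  | nil =>
    simp only [List.length_nil, zero_add, one_mul] at hxs
    have hx0 : xs ≠ [] := by rintro rfl; simp at hxs
    have hx : xs.length = p := by omega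
    rw [shuffle_singleton _ _ _ _ hx0]
    simp only [cupSeq, List.length_nil]
    rw [cup_unitCochain _ _ hx0, vdmCochain, if_pos hx, weightedVdm, vdm_map_row]
    simp [vdm, Function.comp_def, hx]
  | cons y' ys ih =>
    rw [shuffle_row]
    simp only [List.length_cons] at hxs ⊢
    rw [cupSeq, cup, mul_comm, ← cut_mul_left]
    refine cut_congr_of_length fun q s hq hl => ?_
    rw [Nat.add_mul _ 1, one_mul] at hxs
    rcases lt_trichotomy q.length p with hlt | heq | hgt
    · rw [vdmCochain, if_neg hlt.ne, zero_mul, mul_zero, shuffle_eq_zero_of_lt, mul_zero]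
      · intro t ht
        exact weightedVdm_of_not_nodup ι g _ fun h => ht (List.nodup_append.1 h).2.1
      · have e : p * (ys.length + 1) = (ys.length + 1) * (p - 1) + (ys.length + 1) := by
          conv_lhs => rw [← Nat.succ_pred_prime (Fact.out : p.Prime)]
          simp only [Nat.pred_eq_sub_one, Nat.succ_eq_add_one]
          ring
        rw [ZMod.card, List.length_cons, e]
        omega
    · by_cases hn : q.Nodup
      · have hs : s.length = (ys.length + 1) * (p - 1) + 1 := by omega
        rw [funext fun t => weightedVdm_row_append g q y heq hn t, shuffle_mul_left,
          ih _ s y' hs, vdmCochain, if_pos heq, hs, add_assoc, pow_add, neg_one_pow_mul_pred,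
          List.map_cons (l := y' :: ys), List.map_cons (l := y' :: ys), vdm_cons, List.prod_cons]
        simp only [mul_pow, List.prod_map_mul, List.map_map, Function.comp_def, fibreMap_apply,
          map_sub, sub_pow_char]
        ring
      · have h0 : vdm (q.map (baseMap ι)) = 0 := by
          by_contra h
          exact hn ((vdm_ne_zero.1 h).of_map _)
        have h1 : ∀ t, weightedVdm ι g (q.map (fun x => (x, y)) ++ t) = 0 := by
          intro t
          refine weightedVdm_of_not_nodup ι g _ fun h => hn ?_
          exact (List.nodup_append.1 h).1.of_map _
        simp only [h1]
        rw [shuffle_eq_zero _ _ _ _ fun _ _ _ => rfl, vdmCochain, if_pos heq, h0]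
        simp
    · have hn : ¬q.Nodup := by
        intro h
        have := h.length_le_card
        rw [ZMod.card] at this
        omega
      have h1 : ∀ t, weightedVdm ι g (q.map (fun x => (x, y)) ++ t) = 0 := by
        intro t
        refine weightedVdm_of_not_nodup ι g _ fun h => hn ?_
        exact (List.nodup_append.1 h).1.of_map _
      simp only [h1]
      rw [shuffle_eq_zero _ _ _ _ fun _ _ _ => rfl, vdmCochain, if_neg hgt.ne']
      simp

lemma shuffle_vdmCochain {ι : ZMod p × H →+ F} (hι : Function.Injective ι) (d : ℕ)
    (xs : List (ZMod p)) (ys : List H) (hys : ys.length = d + 1) :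
    shuffle Prod.mk (vdmCochain (p * (d + 1)) ι) xs ys =
      cupSeq (fun _ => vdmCochain p (baseMap ι)) (d + 1) xs *
        vdmCochain (d + 1) (fibreMap ι) ys := by
  have hp : p - 1 + 1 = p := Nat.succ_pred_prime Fact.out
  have e : p * (d + 1) = (d + 1) * (p - 1) + (d + 1) := by
    conv_lhs => rw [← hp]
    ring
  by_cases h : xs.length = (d + 1) * (p - 1) + 1
  · have h1 : shuffle Prod.mk (vdmCochain (p * (d + 1)) ι) xs ys =
        shuffle Prod.mk (weightedVdm ι fun _ => 1) xs ys := by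
      rw [← sub_eq_zero, ← shuffle_sub]
      refine shuffle_eq_zero _ _ _ _ fun t ht _ => ?_
      rw [vdmCochain, if_pos (by omega), weightedVdm]
      simp
    rw [h1]
    cases ys with
    | nil => simp at hys
    | cons y ys =>
      have hl : ys.length = d := by simpa using hys
      rw [shuffle_weightedVdm hι _ _ _ _ (by rw [hl, h]), vdmCochain, if_pos hys, hl]
      simp
  · have h1 : HasDegree ((d + 1) * (p - 1))
        (cupSeq (fun _ => vdmCochain p (baseMap ι)) (d + 1)) := by
      have := hasDegree_vdmCochain (p - 1) (baseMap ι)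
      rw [hp] at this
      exact this.cupSeq (d + 1)
    rw [h1 _ h, zero_mul]
    refine shuffle_eq_zero _ _ _ _ fun t ht _ => if_neg ?_
    omega

/-- The shuffle of a power of the Vandermonde cochain of a product in the lowest bidegree. -/
lemma shuffle_cupSeq_vdmCochain {ι : ZMod p × H →+ F} (hι : Function.Injective ι) (d n : ℕ)
    (xs : List (ZMod p)) (ys : List H) (hys : ys.length = n * d + 1) :
    shuffle Prod.mk (cupSeq (fun _ => vdmCochain (p * (d + 1)) ι) n) xs ys =
      cupSeq (fun _ => vdmCochain p (baseMap ι)) (n * (d + 1)) xs *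
        cupSeq (fun _ => vdmCochain (d + 1) (fibreMap ι)) n ys := by
  have hp : p - 1 + 1 = p := Nat.succ_pred_prime Fact.out
  induction n generalizing xs ys with
  | zero =>
    rw [zero_mul] at hys ⊢
    obtain ⟨y, rfl⟩ := List.length_eq_one_iff.1 hys
    by_cases hx : xs = []
    · simp [hx]
    · rw [shuffle_singleton _ _ _ _ hx]
      simp [cupSeq, unitCochain]
  | succ n ih =>
    have e : (n + 1) * (d + 1) = (d + 1) + n * (d + 1) := by ring
    rw [e, ← cupSeq_add, cupSeq, shuffle_cup]
    rw [show cupSeq (fun _ => vdmCochain (d + 1) (fibreMap ι)) (n + 1) ys =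
      cup (vdmCochain (d + 1) (fibreMap ι))
        (cupSeq (fun _ => vdmCochain (d + 1) (fibreMap ι)) n) ys from rfl, cup, cup]
    conv_rhs => rw [mul_comm, ← cut_mul_left]
    refine cut_congr_of_length fun xs₁ xs₂ _ _ => ?_
    conv_rhs => rw [mul_comm, ← cut_mul_left]
    refine cut_congr_of_length fun ys₁ ys₂ _ hl => ?_
    rw [Nat.succ_mul] at hys
    rcases lt_trichotomy ys₁.length (d + 1) with hlt | heq | hgt
    · rw [shuffle_vdmCochain_of_lt ι d _ _ (by omega),
        hasDegree_vdmCochain d (fibreMap ι) ys₁ hlt.ne]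
      simp
    · rw [shuffle_vdmCochain hι d _ _ heq, ih _ _ (by omega)]
      by_cases h : xs₂.length = n * (d + 1) * (p - 1) + 1
      · have hs : (-1 : F) ^ ((ys₁.length + 1) * (xs₂.length + 1)) = 1 := by
          rw [mul_comm, pow_mul, h, add_assoc, pow_add (-1 : F) (n * (d + 1) * (p - 1)),
            neg_one_pow_mul_pred]
          simp
        rw [hs]
        ring
      · have := hasDegree_vdmCochain (p - 1) (baseMap ι)
        rw [hp] at this
        rw [this.cupSeq (n * (d + 1)) xs₂ h]
        simp
    · rw [shuffle_cupSeq_vdmCochain_of_lt ι d n _ _ (by omega),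
        hasDegree_vdmCochain d (fibreMap ι) ys₁ hgt.ne']
      simp

end Window

section Cycle

variable {G F : Type*} [AddCommGroup G] [Field F]

/-- A functional on cochains is an equivariant cycle of dimension `N` if it only depends on the
values on `N`-simplices and kills the coboundaries of translation invariant cochains. -/
structure IsCycle (N : ℕ) (Z : (List G → F) →ₗ[F] F) : Prop where
  eq_zero : ∀ φ : List G → F, (∀ l, l.length = N + 1 → φ l = 0) → Z φ = 0
  cobd_eq_zero : ∀ φ : List G → F, (∀ a l, φ (l.map fun x => a + x) = φ l) → φ [] = 0 →
    Z (cobd φ) = 0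

lemma IsCycle.congr {N : ℕ} {Z : (List G → F) →ₗ[F] F} (hZ : IsCycle N Z) {φ ψ : List G → F}
    (h : ∀ l, l.length = N + 1 → φ l = ψ l) : Z φ = Z ψ := by
  rw [← sub_eq_zero, ← map_sub]
  exact hZ.eq_zero _ fun l hl => sub_eq_zero.2 (h l hl)

end Cycle

section ZModCycle

variable (p : ℕ) [Fact p.Prime] (F : Type*) [Field F]

/-- The standard even-dimensional cycles of a cyclic group. -/
def zmodCycle : ℕ → ZMod p → ((List (ZMod p) → F) →ₗ[F] F)
  | 0, x => LinearMap.proj [x]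
  | r + 1, x => ∑ y, (zmodCycle r y).comp (LinearMap.funLeft F F fun t => x :: (x + 1) :: t)

variable {p F}

lemma zmodCycle_zero (x : ZMod p) (φ : List (ZMod p) → F) : zmodCycle p F 0 x φ = φ [x] := rfl

lemma zmodCycle_succ (r : ℕ) (x : ZMod p) (φ : List (ZMod p) → F) :
    zmodCycle p F (r + 1) x φ = ∑ y, zmodCycle p F r y fun t => φ (x :: (x + 1) :: t) := by
  simp only [zmodCycle, LinearMap.sum_apply]
  rfl

lemma zmodCycle_congr {r : ℕ} {x : ZMod p} {φ ψ : List (ZMod p) → F}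
    (h : ∀ t, t.length = 2 * r → φ (x :: t) = ψ (x :: t)) :
    zmodCycle p F r x φ = zmodCycle p F r x ψ := by
  induction r generalizing x φ ψ with
  | zero => exact h [] rfl
  | succ r ih =>
    simp only [zmodCycle_succ]
    refine Finset.sum_congr rfl fun y _ => ih fun t ht => h _ ?_
    simp only [List.length_cons]
    omega

lemma zmodCycle_add (r : ℕ) (a x : ZMod p) (φ : List (ZMod p) → F) :
    zmodCycle p F r (a + x) φ = zmodCycle p F r x fun t => φ (t.map fun y => a + y) := by
  induction r generalizing x φ with
  | zero => rfl
  | succ r ih =>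
    simp only [zmodCycle_succ]
    refine Fintype.sum_equiv (Equiv.addLeft (-a)) _ _ fun y => ?_
    obtain ⟨z, rfl⟩ : ∃ z, y = a + z := ⟨-a + y, by abel⟩
    rw [ih]
    simp [add_assoc]

lemma cobd_cons_cons {X R : Type*} [CommRing R] (φ : List X → R) (x y : X) (l : List X) :
    cobd φ (x :: y :: l) = φ (y :: l) - φ (x :: l) + cobd (fun t => φ (x :: y :: t)) l := by
  rw [cobd_cons, cobd_cons]
  ring

lemma sum_zmodCycle_cobd [CharP F p] (r : ℕ) (φ : List (ZMod p) → F) :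
    ∑ x, zmodCycle p F r x (cobd φ) = 0 := by
  induction r generalizing φ with
  | zero => simp [zmodCycle_zero, cobd_cons, ZMod.card]
  | succ r ih =>
    have e : ∀ x y : ZMod p, (zmodCycle p F r y fun t => cobd φ (x :: (x + 1) :: t)) =
        (zmodCycle p F r y fun t => φ ((x + 1) :: t)) - (zmodCycle p F r y fun t => φ (x :: t)) +
          zmodCycle p F r y (cobd fun t => φ (x :: (x + 1) :: t)) := by
      intro x y
      rw [← map_sub, ← map_add]
      congr 1
      funext t
      exact cobd_cons_cons φ x (x + 1) t
    simp only [zmodCycle_succ, e, Finset.sum_add_distrib, ih, Finset.sum_sub_distrib]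
    rw [Finset.sum_const_zero, add_zero, sub_eq_zero]
    exact Fintype.sum_equiv (Equiv.addRight 1) _ _ fun x => rfl

lemma isCycle_zmodCycle [CharP F p] (r : ℕ) (x : ZMod p) :
    IsCycle (2 * r) (zmodCycle p F r x) where
  eq_zero φ h := by
    rw [zmodCycle_congr (ψ := 0) fun t ht => h (x :: t) (by simp [ht]), map_zero]
  cobd_eq_zero φ h h0 := by
    cases r with
    | zero => simp [zmodCycle_zero, cobd_cons, h0]
    | succ r =>
      have e : ∀ y : ZMod p, (zmodCycle p F r y fun t => cobd φ (x :: (x + 1) :: t)) =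
          (zmodCycle p F r y fun t => φ ((x + 1) :: t)) -
            (zmodCycle p F r y fun t => φ (x :: t)) +
            zmodCycle p F r y (cobd fun t => φ (x :: (x + 1) :: t)) := by
        intro y
        rw [← map_sub, ← map_add]
        congr 1
        funext t
        exact cobd_cons_cons φ x (x + 1) t
      simp only [zmodCycle_succ, e, Finset.sum_add_distrib, Finset.sum_sub_distrib]
      rw [sum_zmodCycle_cobd, add_zero, sub_eq_zero]
      symm
      refine Fintype.sum_equiv (Equiv.addLeft 1) _ _ fun y => ?_
      change _ = zmodCycle p F r (1 + y) _
      rw [zmodCycle_add]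
      congr 1
      funext t
      rw [← h 1, List.map_cons, add_comm 1 x]

lemma zmodCycle_cup (m r : ℕ) (x : ZMod p) {α β : List (ZMod p) → F} (hα : HasDegree (2 * m) α)
    (κ : F) (hβ : ∀ u, zmodCycle p F r u β = κ) :
    zmodCycle p F (m + r) x (cup α β) = zmodCycle p F m x α * κ := by
  induction m generalizing x α with
  | zero =>
    rw [zero_add, zmodCycle_zero, ← hβ x, ← smul_eq_mul, ← map_smul]
    refine zmodCycle_congr fun t _ => ?_
    rw [cup_cons, cup_eq_zero, add_zero]
    · rfl
    · intro i hi
      rw [hα, zero_mul]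
      simp
      exact List.length_pos_iff.1 (by omega)
  | succ m ih =>
    rw [Nat.succ_add, zmodCycle_succ, zmodCycle_succ, Finset.sum_mul]
    refine Finset.sum_congr rfl fun y _ => ?_
    rw [← ih]
    · congr 1
      funext t
      rw [cup_cons, cup_cons, hα [x], hα [x, x + 1]]
      · simp
      · simp
      · simp
    · intro l hl
      refine hα _ ?_
      simp only [List.length_cons]
      omega

lemma zmodCycle_cupSeq (m n : ℕ) (x : ZMod p) {α : List (ZMod p) → F} (hα : HasDegree (2 * m) α)
    (κ : F) (hκ : ∀ u, zmodCycle p F m u α = κ) :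
    zmodCycle p F (m * n) x (cupSeq (fun _ => α) n) = κ ^ n := by
  induction n generalizing x with
  | zero => simp [zmodCycle_zero, cupSeq, unitCochain]
  | succ n ih =>
    rw [Nat.mul_succ, add_comm, cupSeq, zmodCycle_cup m _ x hα _ ih, hκ, pow_succ, mul_comm]

end ZModCycle

section Residues

variable {p : ℕ}

/-- The residues `0, …, c - 1` in increasing order. -/
def residues (p c : ℕ) : List (ZMod p) :=
  (List.range c).map Nat.cast

lemma residues_succ (c : ℕ) : residues p (c + 1) = residues p c ++ [(c : ZMod p)] := by
  simp [residues, List.range_succ]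

lemma natCast_notMem_residues {c : ℕ} (hc : c < p) : (c : ZMod p) ∉ residues p c := by
  simp only [residues, List.mem_map, List.mem_range, not_exists, not_and]
  intro a ha h
  have := congrArg ZMod.val h
  rw [ZMod.val_cast_of_lt (ha.trans hc), ZMod.val_cast_of_lt hc] at this
  omega

lemma nodup_residues : (residues p p).Nodup := by
  refine List.Nodup.map_on ?_ List.nodup_range
  intro a ha b hb h
  have := congrArg ZMod.val h
  rwa [ZMod.val_cast_of_lt (List.mem_range.1 ha), ZMod.val_cast_of_lt (List.mem_range.1 hb)] at this

end Residues

section Domino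

variable {p : ℕ} [Fact p.Prime] {F : Type*} [Field F]

/-- The sum of the values of a cochain on the concatenations of `j` pairs `t, t + 1`. -/
def dominoSum : ℕ → (List (ZMod p) → F) → F
  | 0, φ => φ []
  | j + 1, φ => ∑ t, dominoSum j fun l => φ (t :: (t + 1) :: l)

/-- The sum of the values of a cochain on the concatenations of `j` pairs `t, t + 1` and a final
point. -/
def dominoPointSum : ℕ → (List (ZMod p) → F) → F
  | 0, φ => ∑ t, φ [t]
  | j + 1, φ => ∑ t, dominoPointSum j fun l => φ (t :: (t + 1) :: l)

lemma dominoSum_zero (j : ℕ) : dominoSum j (fun _ : List (ZMod p) => (0 : F)) = 0 := by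
  induction j with
  | zero => rfl
  | succ j ih => simp [dominoSum, ih]

lemma dominoPointSum_zero (j : ℕ) : dominoPointSum j (fun _ : List (ZMod p) => (0 : F)) = 0 := by
  induction j with
  | zero => simp [dominoPointSum]
  | succ j ih => simp [dominoPointSum, ih]

lemma sum_zmodCycle (j : ℕ) (φ : List (ZMod p) → F) :
    ∑ x, zmodCycle p F j x φ = dominoPointSum j φ := by
  induction j generalizing φ with
  | zero => rfl
  | succ j ih => simp only [zmodCycle_succ, dominoPointSum, ih]

/-- An alternating cochain which only sees simplices of distinct vertices containing `c` but not
`c - 1`. -/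
structure Exposes (c : ZMod p) (φ : List (ZMod p) → F) : Prop where
  swap : ∀ l₁ a b l₂, φ (l₁ ++ a :: b :: l₂) = -φ (l₁ ++ b :: a :: l₂)
  nodup : ∀ l, ¬l.Nodup → φ l = 0
  mem : ∀ l, c ∉ l → φ l = 0
  pred : ∀ t l, t + 1 = c → t ∈ l → φ l = 0

lemma Exposes.rotate {c : ZMod p} {φ : List (ZMod p) → F} (h : Exposes c φ) (t u : ZMod p)
    (l : List (ZMod p)) : φ (t :: u :: c :: l) = φ (c :: t :: u :: l) := by
  have h1 := h.swap [t] u c l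
  have h2 := h.swap [] t c (u :: l)
  simp only [List.cons_append, List.nil_append] at h1 h2
  rw [h1, h2, neg_neg]

lemma Exposes.rotate_two {c : ZMod p} {φ : List (ZMod p) → F} (h : Exposes c φ) (t u d : ZMod p)
    (l : List (ZMod p)) : φ (t :: u :: c :: d :: l) = φ (c :: d :: t :: u :: l) := by
  have h1 := h.swap [c, t] u d l
  have h2 := h.swap [c] t d (u :: l)
  simp only [List.cons_append, List.nil_append] at h1 h2
  rw [h.rotate, h1, h2, neg_neg]

lemma Exposes.cons_cons {c : ZMod p} {φ : List (ZMod p) → F} (h : Exposes c φ) {t u : ZMod p}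
    (ht : c ≠ t) (hu : c ≠ u) : Exposes c fun l => φ (t :: u :: l) where
  swap l₁ a b l₂ := h.swap (t :: u :: l₁) a b l₂
  nodup l hl := h.nodup _ fun h' => hl h'.of_cons.of_cons
  mem l hl := h.mem _ (by simp [ht, hu, hl])
  pred s l hs hl := h.pred s _ hs (by simp [hl])

lemma Exposes.dominoSum_eq {c : ZMod p} {φ : List (ZMod p) → F} (h : Exposes c φ) (j : ℕ) :
    dominoSum j φ = j * dominoSum (j - 1) fun l => φ (c :: (c + 1) :: l) := by
  induction j generalizing φ with
  | zero => simpa [dominoSum] using h.mem [] (by simp)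
  | succ j ih =>
    have e : ∀ t, (dominoSum j fun l => φ (t :: (t + 1) :: l)) =
        j * (dominoSum (j - 1) fun l => φ (c :: (c + 1) :: t :: (t + 1) :: l)) +
          if t = c then dominoSum j fun l => φ (c :: (c + 1) :: l) else 0 := by
      intro t
      by_cases ht : t = c
      · subst ht
        have : (fun l => φ (t :: (t + 1) :: t :: (t + 1) :: l)) = fun _ => 0 :=
          funext fun l => h.nodup _ (by simp)
        simp [this, dominoSum_zero]
      · by_cases hu : t + 1 = c
        · have h1 : (fun l => φ (t :: (t + 1) :: l)) = fun _ => 0 :=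
            funext fun l => h.pred t _ hu (by simp)
          have h2 : (fun l => φ (c :: (c + 1) :: t :: (t + 1) :: l)) = fun _ => 0 :=
            funext fun l => h.nodup _ (by simp [hu])
          simp [h1, h2, dominoSum_zero, ht]
        · rw [ih (h.cons_cons (Ne.symm ht) (Ne.symm hu)), if_neg ht, add_zero]
          rw [show (fun l => φ (t :: (t + 1) :: c :: (c + 1) :: l)) =
            fun l => φ (c :: (c + 1) :: t :: (t + 1) :: l) from
              funext fun l => h.rotate_two _ _ _ _]
    rw [dominoSum, Finset.sum_congr rfl fun t _ => e t, Finset.sum_add_distrib]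
    rw [Finset.sum_ite_eq' Finset.univ c, if_pos (Finset.mem_univ c), ← Finset.mul_sum]
    cases j with
    | zero => simp
    | succ j =>
      simp only [Nat.add_sub_cancel, dominoSum]
      push_cast
      ring

lemma Exposes.dominoPointSum_eq {c : ZMod p} {φ : List (ZMod p) → F} (h : Exposes c φ) (j : ℕ) :
    dominoPointSum j φ = (dominoSum j fun l => φ (c :: l)) +
      j * dominoPointSum (j - 1) fun l => φ (c :: (c + 1) :: l) := by
  induction j generalizing φ with
  | zero =>
    simp only [dominoPointSum, dominoSum, Nat.cast_zero, zero_mul, add_zero]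
    refine Finset.sum_eq_single c (fun t _ ht => h.mem _ (by simpa using ht.symm)) ?_
    simp
  | succ j ih =>
    have e : ∀ t, (dominoPointSum j fun l => φ (t :: (t + 1) :: l)) =
        (dominoSum j fun l => φ (c :: t :: (t + 1) :: l)) +
        j * (dominoPointSum (j - 1) fun l => φ (c :: (c + 1) :: t :: (t + 1) :: l)) +
          if t = c then dominoPointSum j fun l => φ (c :: (c + 1) :: l) else 0 := by
      intro t
      by_cases ht : t = c
      · subst ht
        have h1 : (fun l => φ (t :: (t + 1) :: t :: (t + 1) :: l)) = fun _ => 0 :=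
          funext fun l => h.nodup _ (by simp)
        have h2 : (fun l => φ (t :: t :: (t + 1) :: l)) = fun _ => 0 :=
          funext fun l => h.nodup _ (by simp)
        simp [h1, h2, dominoSum_zero, dominoPointSum_zero]
      · by_cases hu : t + 1 = c
        · have h1 : (fun l => φ (t :: (t + 1) :: l)) = fun _ => 0 :=
            funext fun l => h.pred t _ hu (by simp)
          have h2 : (fun l => φ (c :: (c + 1) :: t :: (t + 1) :: l)) = fun _ => 0 :=
            funext fun l => h.nodup _ (by simp [hu])
          have h3 : (fun l => φ (c :: t :: (t + 1) :: l)) = fun _ => 0 :=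
            funext fun l => h.nodup _ (by simp [hu])
          simp [h1, h2, h3, dominoSum_zero, dominoPointSum_zero, ht]
        · rw [ih (h.cons_cons (Ne.symm ht) (Ne.symm hu)), if_neg ht, add_zero]
          rw [show (fun l => φ (t :: (t + 1) :: c :: (c + 1) :: l)) =
            fun l => φ (c :: (c + 1) :: t :: (t + 1) :: l) from
              funext fun l => h.rotate_two _ _ _ _,
            show (fun l => φ (t :: (t + 1) :: c :: l)) = fun l => φ (c :: t :: (t + 1) :: l) from
              funext fun l => h.rotate _ _ _]
    rw [dominoPointSum, Finset.sum_congr rfl fun t _ => e t, Finset.sum_add_distrib,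
      Finset.sum_add_distrib]
    rw [Finset.sum_ite_eq' Finset.univ c, if_pos (Finset.mem_univ c), ← Finset.mul_sum]
    rw [show (dominoSum (j + 1) fun l => φ (c :: l)) =
      ∑ t, dominoSum j fun l => φ (c :: t :: (t + 1) :: l) from rfl]
    cases j with
    | zero => simp
    | succ j =>
      simp only [Nat.add_sub_cancel, dominoPointSum]
      push_cast
      ring

lemma exposes_residues (ι : ZMod p →+ F) {c : ℕ} (hc : c < p) (hc0 : 0 < c) :
    Exposes (c : ZMod p) fun l => vdmCochain p ι (residues p c ++ l) where
  swap l₁ a b l₂ := by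
    simp only [← List.append_assoc]
    exact vdmCochain_swap p ι _ a b l₂
  nodup l hl := by
    by_contra h
    exact hl (List.nodup_append.1 (nodup_of_vdmCochain_ne_zero h).2).2.1
  mem l hl := by
    by_contra h
    have h' := mem_of_vdmCochain_ne_zero (ι := ι) (by rwa [ZMod.card]) (c : ZMod p)
    rcases List.mem_append.1 h' with h' | h'
    · exact natCast_notMem_residues hc h'
    · exact hl h'
  pred t l ht hl := by
    by_contra h
    have h' := (List.nodup_append.1 (nodup_of_vdmCochain_ne_zero h).2).2.2
    obtain ⟨c, rfl⟩ : ∃ d, c = d + 1 := ⟨c - 1, by omega⟩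
    have : t = (c : ZMod p) := by simpa using ht
    exact h' t (by simp [residues_succ, this]) t hl rfl

lemma dominoSum_residues (ι : ZMod p →+ F) (j c : ℕ) (hc0 : 0 < c) (hc : c + 2 * j = p) :
    (dominoSum j fun l => vdmCochain p ι (residues p c ++ l)) =
      j.factorial * vdmCochain p ι (residues p p) := by
  induction j generalizing c with
  | zero =>
    have : c = p := by omega
    simp [dominoSum, this]
  | succ j ih =>
    have h := ih (c + 2) (by omega) (by omega)
    simp only [residues_succ, List.append_assoc, List.cons_append, List.nil_append,
      Nat.cast_add, Nat.cast_one] at h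
    rw [(exposes_residues ι (by omega) hc0).dominoSum_eq, Nat.add_sub_cancel, h,
      Nat.factorial_succ]
    push_cast
    ring

lemma dominoPointSum_residues (ι : ZMod p →+ F) (j c : ℕ) (hc0 : 0 < c)
    (hc : c + 2 * j + 1 = p) :
    (dominoPointSum j fun l => vdmCochain p ι (residues p c ++ l)) =
      (j + 1).factorial * vdmCochain p ι (residues p p) := by
  induction j generalizing c with
  | zero =>
    have h := dominoSum_residues ι 0 (c + 1) (by omega) (by omega)
    simp only [residues_succ, List.append_assoc, List.cons_append, List.nil_append] at h
    rw [(exposes_residues ι (by omega) hc0).dominoPointSum_eq, h]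
    simp
  | succ j ih =>
    have h := ih (c + 2) (by omega) (by omega)
    have h' := dominoSum_residues ι (j + 1) (c + 1) (by omega) (by omega)
    simp only [residues_succ, List.append_assoc, List.cons_append, List.nil_append,
      Nat.cast_add, Nat.cast_one] at h h'
    rw [(exposes_residues ι (by omega) hc0).dominoPointSum_eq, Nat.add_sub_cancel, h, h',
      Nat.factorial_succ (j + 1)]
    push_cast
    ring

lemma zmodCycle_vdmCochain (ι : ZMod p →+ F) (j : ℕ) (hj : p = 2 * (j + 1) + 1) (x : ZMod p) :
    zmodCycle p F (j + 1) x (vdmCochain p ι) =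
      (j + 1).factorial * vdmCochain p ι (residues p p) := by
  have h := zmodCycle_add (j + 1) x 0 (vdmCochain p ι)
  simp only [vdmCochain_map_add, add_zero] at h
  rw [h, ← dominoPointSum_residues ι j 2 (by omega) (by omega), zmodCycle_succ, sum_zmodCycle]
  simp [residues, List.range_succ]

lemma zmodCycle_vdmCochain_two [Fact (Nat.Prime 2)] (ι : ZMod 2 →+ F) (x : ZMod 2) :
    zmodCycle 2 F 1 x (cupSeq (fun _ => vdmCochain 2 ι) 2) = ι 1 ^ 2 := by
  have e : ∀ y, cupSeq (fun _ => vdmCochain 2 ι) 2 [x, x + 1, y] = ι 1 * ι (y - (x + 1)) := by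
    intro y
    simp [cupSeq, cup_cons, vdmCochain, unitCochain, vdm]
  simp only [zmodCycle_succ, zmodCycle_zero, e]
  rw [← Finset.mul_sum, pow_two]
  congr 1
  rw [Fintype.sum_equiv (Equiv.subRight (x + 1)) (fun y => ι (y - (x + 1))) ι fun _ => rfl]
  refine (Fin.sum_univ_two ι).trans ?_
  change ι (0 : ZMod 2) + ι (1 : ZMod 2) = ι 1
  rw [map_zero, zero_add]

/-- Cyclic groups of prime order carry even-dimensional cycles detecting the powers of the
Vandermonde cochains. -/
lemma exists_isCycle_zmod [CharP F p] (n : ℕ) (hn : Even n) :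
    ∃ Z : (List (ZMod p) → F) →ₗ[F] F, IsCycle (n * (p - 1)) Z ∧
      ∀ ι : ZMod p →+ F, Function.Injective ι →
        Z (cupSeq (fun _ => vdmCochain p ι) n) ≠ 0 := by
  rcases (Fact.out : p.Prime).eq_two_or_odd' with rfl | ⟨m, hm⟩
  · obtain ⟨n, rfl⟩ := hn
    refine ⟨zmodCycle 2 F n 0, ?_, fun ι hι => ?_⟩
    · convert isCycle_zmodCycle (F := F) (p := 2) n 0 using 1
      omega
    · have hd : HasDegree (2 * 1) (cupSeq (fun _ => vdmCochain 2 ι) 2) :=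
        (hasDegree_vdmCochain 1 ι).cupSeq 2
      have h := zmodCycle_cupSeq 1 n 0 hd _ (zmodCycle_vdmCochain_two ι)
      rw [one_mul, funext (cupSeq_mul (vdmCochain 2 ι) 2 n), two_mul] at h
      rw [h]
      refine pow_ne_zero _ (pow_ne_zero _ fun h0 => ?_)
      exact one_ne_zero (hι (h0.trans ι.map_zero.symm))
  · have hp := (Fact.out : p.Prime).one_lt
    obtain ⟨j, rfl⟩ : ∃ j, m = j + 1 := ⟨m - 1, by omega⟩
    refine ⟨zmodCycle p F ((j + 1) * n) 0, ?_, fun ι hι => ?_⟩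
    · convert isCycle_zmodCycle (F := F) (p := p) ((j + 1) * n) 0 using 1
      rw [show p - 1 = 2 * (j + 1) by omega]
      ring
    · have hd : HasDegree (2 * (j + 1)) (vdmCochain p ι) := by
        intro l hl
        exact if_neg (by omega)
      rw [zmodCycle_cupSeq (j + 1) n 0 hd _ (zmodCycle_vdmCochain ι j hm)]
      refine pow_ne_zero _ (mul_ne_zero ?_ ?_)
      · rw [Ne, CharP.cast_eq_zero_iff F p, (Fact.out : p.Prime).dvd_factorial]
        omega
      · rw [vdmCochain, if_pos (by simp [residues]), vdm_ne_zero]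
        exact nodup_residues.map hι

end Domino

section Product

variable {G H F : Type*} [Field F]

/-- The cross product of two functionals on cochains. -/
def crossProd (Z' : (List G → F) →ₗ[F] F) (Z'' : (List H → F) →ₗ[F] F) :
    (List (G × H) → F) →ₗ[F] F where
  toFun φ := Z' fun xs => Z'' fun ys => shuffle Prod.mk φ xs ys
  map_add' φ ψ := by
    rw [← map_add]
    congr 1
    funext xs
    simp only [Pi.add_apply]
    rw [← map_add]
    congr 1
    funext ys
    exact shuffle_add Prod.mk φ ψ xs ys
  map_smul' a φ := by
    simp only [RingHom.id_apply]
    rw [← map_smul]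
    congr 1
    funext xs
    simp only [Pi.smul_apply]
    rw [← map_smul]
    congr 1
    funext ys
    exact shuffle_mul_left Prod.mk a φ xs ys

lemma crossProd_apply (Z' : (List G → F) →ₗ[F] F) (Z'' : (List H → F) →ₗ[F] F)
    (φ : List (G × H) → F) :
    crossProd Z' Z'' φ = Z' fun xs => Z'' fun ys => shuffle Prod.mk φ xs ys := rfl

lemma IsCycle.crossProd [AddCommGroup G] [AddCommGroup H] {N' N'' : ℕ}
    {Z' : (List G → F) →ₗ[F] F} {Z'' : (List H → F) →ₗ[F] F}
    (hZ' : IsCycle N' Z') (hZ'' : IsCycle N'' Z'') :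
    IsCycle (N' + N'') (crossProd Z' Z'') where
  eq_zero φ h := by
    refine hZ'.eq_zero _ fun xs hxs => hZ''.eq_zero _ fun ys hys => ?_
    exact shuffle_eq_zero _ _ _ _ fun t ht _ => h t (by omega)
  cobd_eq_zero φ hφ h0 := by
    have hx : ∀ a xs ys, shuffle Prod.mk φ (xs.map fun x => a + x) ys =
        shuffle Prod.mk φ xs ys := by
      intro a xs ys
      have h := shuffle_map Prod.mk Prod.mk (fun x : G => a + x) (fun y : H => y)
        (fun w => (a, 0) + w) (fun x y => by simp) φ xs ys
      rw [List.map_id'] at h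
      rw [h]
      simp only [hφ]
    have hy : ∀ b xs ys, shuffle Prod.mk φ xs (ys.map fun y => b + y) =
        shuffle Prod.mk φ xs ys := by
      intro b xs ys
      have h := shuffle_map Prod.mk Prod.mk (fun x : G => x) (fun y : H => b + y)
        (fun w => (0, b) + w) (fun x y => by simp) φ xs ys
      rw [List.map_id'] at h
      rw [h]
      simp only [hφ]
    have e : ∀ xs, (Z'' fun ys => shuffle Prod.mk (cobd φ) xs ys) =
        cobd (fun t => Z'' fun ys => shuffle Prod.mk φ t ys) xs := by
      intro xs
      rw [← map_cobd Z'' (fun t ys => shuffle Prod.mk φ t ys)]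
      have h := hZ''.cobd_eq_zero (fun t => shuffle Prod.mk φ xs t) (fun b ys => hy b xs ys)
        (by simp)
      rw [← sub_eq_zero, ← map_sub]
      have e' : ((fun ys => shuffle Prod.mk (cobd φ) xs ys) -
          fun ys => cobd (fun t => shuffle Prod.mk φ t ys) xs) =
          (-(-1) ^ xs.length : F) • cobd fun t => shuffle Prod.mk φ xs t := by
        funext ys
        simp only [Pi.sub_apply, Pi.smul_apply, smul_eq_mul, shuffle_cobd, h0, ite_self]
        ring
      rw [e', map_smul, h, smul_zero]
    simp only [crossProd_apply, e]
    refine hZ'.cobd_eq_zero _ (fun a l => ?_) ?_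
    · simp only [hx]
    · simp only [shuffle_nil_left]
      exact Z''.map_zero

end Product

/-- Over a field of characteristic `p`, some group of order `p ^ ν` and exponent `p` carries
cycles detecting the even powers of the Vandermonde cochains. -/
lemma exists_isCycle (F : Type*) [Field F] (p : ℕ) [Fact p.Prime] [CharP F p] (ν : ℕ) :
    ∃ (G : Type) (_ : AddCommGroup G) (_ : Module (ZMod p) G), Nat.card G = p ^ ν ∧
      ∀ n, Even n → ∃ Z : (List G → F) →ₗ[F] F, IsCycle (n * (p ^ ν - 1)) Z ∧
        ∀ ι : G →+ F, Function.Injective ι →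
          Z (cupSeq (fun _ => vdmCochain (p ^ ν) ι) n) ≠ 0 := by
  induction ν with
  | zero =>
    refine ⟨PUnit, inferInstance, inferInstance, by simp, fun n _ => ?_⟩
    refine ⟨LinearMap.proj [PUnit.unit], ⟨fun φ h => h _ (by simp), fun φ _ h0 => ?_⟩,
      fun ι _ => ?_⟩
    · simp [cobd_cons, h0]
    · suffices h : cupSeq (fun _ => vdmCochain (p ^ 0) ι) n [PUnit.unit] = 1 by
        rw [LinearMap.proj_apply, h]
        exact one_ne_zero
      clear * -
      induction n with
      | zero => simp [cupSeq, unitCochain]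
      | succ n ih => simpa [cupSeq, cup_cons, vdmCochain, vdm] using ih
  | succ ν ih =>
    obtain ⟨H, _, _, hH, h⟩ := ih
    have hp : 0 < p ^ ν := pow_pos (Fact.out : p.Prime).pos ν
    obtain ⟨d, hd⟩ : ∃ d, p ^ ν = d + 1 := ⟨p ^ ν - 1, by omega⟩
    rw [hd] at h
    refine ⟨ZMod p × H, inferInstance, inferInstance, ?_, fun n hn => ?_⟩
    · rw [Nat.card_prod, hH, Nat.card_zmod, pow_succ']
    obtain ⟨Z', hZ', hne'⟩ := exists_isCycle_zmod (F := F) (p := p) (n * (d + 1)) (hn.mul_right _)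
    obtain ⟨Z'', hZ'', hne''⟩ := h n hn
    refine ⟨crossProd Z' Z'', ?_, fun ι hι => ?_⟩
    · convert hZ'.crossProd hZ'' using 1
      obtain ⟨q, rfl⟩ : ∃ q, p = q + 1 := ⟨p - 1, by have := (Fact.out : p.Prime).pos; omega⟩
      rw [pow_succ', hd, Nat.add_sub_cancel, Nat.add_sub_cancel, mul_assoc, ← mul_add]
      congr 1
      rw [Nat.sub_eq_iff_eq_add (by nlinarith)]
      ring
    · rw [pow_succ', hd, crossProd_apply]
      have e : ∀ xs, (Z'' fun ys =>
          shuffle Prod.mk (cupSeq (fun _ => vdmCochain (p * (d + 1)) ι) n) xs ys) =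
          Z'' (cupSeq (fun _ => vdmCochain (d + 1) (fibreMap ι)) n) *
            cupSeq (fun _ => vdmCochain p (baseMap ι)) (n * (d + 1)) xs := by
        intro xs
        rw [mul_comm (Z'' _), ← smul_eq_mul (cupSeq _ _ xs), ← map_smul]
        refine hZ''.congr fun ys hys => ?_
        rw [shuffle_cupSeq_vdmCochain hι d n xs ys (by simpa using hys)]
        rfl
      simp only [e]
      change Z' (Z'' _ • cupSeq _ _) ≠ 0
      rw [map_smul, smul_eq_mul]
      refine mul_ne_zero (hne'' _ (fibreMap_injective hι)) (hne' _ fun a b hab => ?_)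
      exact (Prod.ext_iff.1 (hι hab)).1

/-- A group of exponent `p` and order `p ^ ν` embeds into the field with `p ^ ν` elements. -/
lemma exists_injective_galoisField (p : ℕ) [Fact p.Prime] {ν : ℕ} (hν : ν ≠ 0) {G : Type*}
    [AddCommGroup G] [Module (ZMod p) G] (hG : Nat.card G = p ^ ν) :
    ∃ ι : G →+ GaloisField p ν, Function.Injective ι := by
  have : Finite G := Nat.finite_of_card_ne_zero (by rw [hG]; exact pow_ne_zero _ (NeZero.ne p))
  have h1 : Module.finrank (ZMod p) G = ν := by
    have h := Module.natCard_eq_pow_finrank (K := ZMod p) (V := G)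
    rw [hG, Nat.card_zmod] at h
    exact (Nat.pow_right_injective (Fact.out : p.Prime).two_le h).symm
  have e : G ≃ₗ[ZMod p] GaloisField p ν :=
    LinearEquiv.ofFinrankEq _ _ (by rw [h1, GaloisField.finrank p hν])
  exact ⟨e.toLinearMap.toAddMonoidHom, e.injective⟩

/-- A finite family of equivariant labellings of words takes all the values on some slow
collection of words. -/
theorem exists_slowAlong (p : ℕ) [Fact p.Prime] {ν : ℕ} (hν : ν ≠ 0) (n : ℕ) (hn : Even n) :
    ∃ (G : Type) (_ : AddCommGroup G), Nat.card G = p ^ ν ∧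
      ∀ (L : ℕ) (A : ℕ → (ℕ → G) → G), (∀ i g w, A i (fun j => g + w j) = g + A i w) →
        ∃ gs ws, gs.length = n * (p ^ ν - 1) + 1 ∧ SlowAlong L gs ws ∧
          ∀ i < n, ∀ g, ∃ w ∈ ws, A i w = g := by
  obtain ⟨G, _, _, hG, h⟩ := exists_isCycle (GaloisField p ν) p ν
  obtain ⟨ι, hι⟩ := exists_injective_galoisField p hν hG
  obtain ⟨Z, hZ, hne⟩ := h n hn
  refine ⟨G, inferInstance, hG, fun L A hA => ?_⟩
  have hp : 0 < p ^ ν := pow_pos (Fact.out : p.Prime).pos ν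
  have : Finite G := Nat.finite_of_card_ne_zero (by omega)
  have := Fintype.ofFinite G
  rw [Nat.card_eq_fintype_card] at hG
  obtain ⟨d, hd⟩ : ∃ d, p ^ ν = d + 1 := ⟨p ^ ν - 1, by omega⟩
  rw [hd] at hne hG hZ ⊢
  let ε : ℕ → List (ℕ → G) → GaloisField p ν := fun i l =>
    vdmCochain (d + 1) ι (l.map fun w => w i)
  let E := cupSeq ε n
  let B : (ℕ → G) → ℕ → G := fun w i => A i w
  let B₀ : (ℕ → G) → ℕ → G := fun w _ => w L
  have hE : cobd E = fun _ => 0 := by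
    funext l
    refine cobd_cupSeq ε (fun i l => ?_) (fun i => vdmCochain_nil d ι) n l
    exact (cobd_map (fun w : ℕ → G => w i) _ l).trans (cobd_vdmCochain d ι _)
  have hEinv : ∀ g l, E (l.map fun w j => g + w j) = E l := by
    intro g l
    simp only [E]
    rw [cupSeq_map]
    congr 1
    funext i t
    simp only [ε, List.map_map]
    rw [← vdmCochain_map_add (d + 1) ι g (t.map fun w => w i), List.map_map]
    rfl
  have hprism : ∀ l, cobd (prism B B₀ E) l = E (l.map B₀) - E (l.map B) := by
    intro l
    have h := cobd_prism B B₀ E l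
    have h0 := prism_sub B B₀ (fun _ => (0 : GaloisField p ν)) (fun _ => 0) l
    rw [sub_self, sub_self] at h0
    rw [hE, h0, add_zero] at h
    exact h
  have hkill : Z (wordOp L (cobd (prism B B₀ E))) = 0 := by
    rw [funext fun gs => wordOp_cobd L (prism B B₀ E) rfl gs]
    refine hZ.cobd_eq_zero _ (fun g l => ?_) (wordOp_nil L _ rfl)
    rw [wordOp_map]
    congr 1
    funext ws
    exact prism_invariant B B₀ _ (fun w j => g + w j) (fun w => funext fun i => hA i g w)
      (fun w => rfl) E (hEinv g) ws
  have hlast : Z (wordOp L fun ws => E (ws.map B₀)) ≠ 0 := by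
    convert hne ι hι using 2
    funext gs
    have h := wordOp_tail L (cupSeq (fun _ => vdmCochain (d + 1) ι) n)
      (Normalized.cupSeq (fun _ => normalized_vdmCochain _ ι) n) (cupSeq_nil _ n) gs
    rw [← h]
    congr 1
    funext ws
    simp only [E]
    rw [cupSeq_map, cupSeq_map]
    congr 1
    funext i t
    simp [ε, B₀, Function.comp_def]
  have hfirst : Z (wordOp L fun ws => E (ws.map B)) ≠ 0 := by
    rw [funext hprism, funext fun gs => wordOp_sub L (fun ws => E (ws.map B₀))
      (fun ws => E (ws.map B)) gs] at hkill
    change Z ((wordOp L fun ws => E (ws.map B₀)) - wordOp L fun ws => E (ws.map B)) = 0 at hkill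
    rw [map_sub, sub_eq_zero] at hkill
    rwa [← hkill]
  obtain ⟨gs, hgs, hw⟩ : ∃ gs : List G, gs.length = n * d + 1 ∧
      wordOp L (fun ws => E (ws.map B)) gs ≠ 0 := by
    by_contra! H
    exact hfirst (hZ.eq_zero _ H)
  obtain ⟨ws, hws, hEws⟩ : ∃ ws, SlowAlong L gs ws ∧ E (ws.map B) ≠ 0 := by
    by_contra! H
    exact hw (wordOp_eq_zero L _ gs (by rintro rfl; simp at hgs) H)
  refine ⟨gs, ws, hgs, hws, fun i hi g => ?_⟩
  obtain ⟨t, ht, hεt⟩ := exists_subset_of_cupSeq_ne_zero ε n _ hEws i hi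
  simp only [ε, ← hG] at hεt
  obtain ⟨u, hu, rfl⟩ := List.mem_map.1 (mem_of_vdmCochain_ne_zero hεt g)
  obtain ⟨w, hw, rfl⟩ := List.mem_map.1 (ht hu)
  exact ⟨w, hw, rfl⟩

section BoundedDifferences

/-- Hoeffding's lemma for a random variable of oscillation at most one, without the optimal
constant. -/
lemma expect_exp_mul_le_of_osc {R : Type*} [Fintype R] [Nonempty R] (X : R → ℝ)
    (hX : ∀ x y, |X x - X y| ≤ 1) (t : ℝ) :
    𝔼 x, Real.exp (t * X x) ≤ Real.exp (t * 𝔼 x, X x + t ^ 2 / 2) := by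
  set μ := 𝔼 x, X x with hμ
  have hdev : ∀ x, |X x - μ| ≤ 1 := by
    intro x
    have e : X x - μ = 𝔼 y, (X x - X y) := by
      rw [Finset.expect_sub_distrib, Fintype.expect_const]
    rw [e]
    exact (Finset.abs_expect_le _ _).trans
      (Finset.expect_le Finset.univ_nonempty fun y _ => hX x y)
  have hle : ∀ x, Real.exp (t * X x) ≤
      Real.exp (t * μ) * (Real.cosh t + (X x - μ) * Real.sinh t) := by
    intro x
    have h := Real.exp_mul_le_cosh_add_mul_sinh (hdev x) t
    calc Real.exp (t * X x) = Real.exp (t * μ) * Real.exp ((X x - μ) * t) := by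
          rw [← Real.exp_add]
          ring_nf
      _ ≤ _ := by gcongr
  refine (Finset.expect_le_expect fun x _ => hle x).trans ?_
  rw [← Finset.mul_expect, Finset.expect_add_distrib, Fintype.expect_const, ← Finset.expect_mul,
    Finset.expect_sub_distrib, Fintype.expect_const, ← hμ, sub_self, zero_mul, add_zero,
    Real.exp_add]
  gcongr
  exact Real.cosh_le_exp_half_sq t

variable {α R : Type*} [Fintype α] [DecidableEq α] [Fintype R]

/-- Resampling one coordinate does not change expectations. -/
lemma expect_expect_update (b : α) (h : (α → R) → ℝ) :
    𝔼 r : α → R, 𝔼 x, h (Function.update r b x) = 𝔼 r, h r := by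
  by_cases hR : Nonempty R
  · have e : 𝔼 z : (α → R) × R, h (Function.update z.1 b z.2) = 𝔼 z : (α → R) × R, h z.1 := by
      have inv : Function.Involutive fun z : (α → R) × R => (Function.update z.1 b z.2, z.1 b) := by
        intro z
        simp
      exact Fintype.expect_equiv inv.toPerm _ _ fun z => rfl
    rw [← Finset.univ_product_univ, Finset.expect_product, Finset.expect_product] at e
    rw [e]
    exact Finset.expect_congr rfl fun r _ => Fintype.expect_const (h r)
  · rw [not_nonempty_iff] at hR
    have : IsEmpty (α → R) := ⟨fun r => hR.elim (r b)⟩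
    simp

lemma expect_apply (b : α) [Nonempty R] (g : R → ℝ) : 𝔼 r : α → R, g (r b) = 𝔼 x, g x := by
  rw [← expect_expect_update b]
  simp only [Function.update_self]
  exact Fintype.expect_const _

/-- The exponential moments of a function with bounded differences. -/
lemma expect_exp_mul_le [Nonempty R] (D : Finset α) (f : (α → R) → ℝ)
    (h1 : ∀ b ∈ D, ∀ r x, |f (Function.update r b x) - f r| ≤ 1)
    (h0 : ∀ b ∉ D, ∀ r x, f (Function.update r b x) = f r) (t : ℝ) :
    𝔼 r, Real.exp (t * f r) ≤ Real.exp (t * 𝔼 r, f r + t ^ 2 / 2 * D.card) := by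
  induction D using Finset.induction_on generalizing f with
  | empty =>
    have hf : ∀ r r', f r = f r' := by
      intro r r'
      suffices h : ∀ S : Finset α, f (S.piecewise r r') = f r' by
        simpa using h Finset.univ
      intro S
      induction S using Finset.induction_on with
      | empty => simp
      | insert b S _ ih =>
        rw [Finset.piecewise_insert, h0 b (by simp), ih]
    obtain ⟨r₀⟩ : Nonempty (α → R) := inferInstance
    simp only [hf _ r₀, Fintype.expect_const]
    simp
  | insert b D hb ih =>
    set g : (α → R) → ℝ := fun r => 𝔼 x, f (Function.update r b x) with hg
    have hmean : 𝔼 r, g r = 𝔼 r, f r := expect_expect_update b f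
    have hstep : ∀ r, 𝔼 x, Real.exp (t * f (Function.update r b x)) ≤
        Real.exp (t * g r) * Real.exp (t ^ 2 / 2) := by
      intro r
      rw [← Real.exp_add]
      refine expect_exp_mul_le_of_osc (fun x => f (Function.update r b x)) (fun x y => ?_) t
      have h := h1 b (Finset.mem_insert_self b D) (Function.update r b y) x
      rwa [Function.update_idem] at h
    have hg1 : ∀ c ∈ D, ∀ r y, |g (Function.update r c y) - g r| ≤ 1 := by
      intro c hc r y
      have hcb : c ≠ b := fun h => hb (h ▸ hc)
      simp only [hg]
      rw [← Finset.expect_sub_distrib]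
      refine (Finset.abs_expect_le _ _).trans
        (Finset.expect_le Finset.univ_nonempty fun x _ => ?_)
      rw [Function.update_comm hcb]
      exact h1 c (Finset.mem_insert_of_mem hc) _ _
    have hg0 : ∀ c ∉ D, ∀ r y, g (Function.update r c y) = g r := by
      intro c hc r y
      simp only [hg]
      refine Finset.expect_congr rfl fun x _ => ?_
      by_cases hcb : c = b
      · rw [hcb, Function.update_idem]
      · rw [Function.update_comm hcb]
        exact h0 c (by simp [hcb, hc]) _ _
    calc 𝔼 r, Real.exp (t * f r)
        = 𝔼 r, 𝔼 x, Real.exp (t * f (Function.update r b x)) :=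
          (expect_expect_update b fun r => Real.exp (t * f r)).symm
      _ ≤ 𝔼 r, Real.exp (t * g r) * Real.exp (t ^ 2 / 2) :=
          Finset.expect_le_expect fun r _ => hstep r
      _ = (𝔼 r, Real.exp (t * g r)) * Real.exp (t ^ 2 / 2) := (Finset.expect_mul _ _ _).symm
      _ ≤ Real.exp (t * 𝔼 r, g r + t ^ 2 / 2 * D.card) * Real.exp (t ^ 2 / 2) := by
          gcongr
          exact ih g hg1 hg0
      _ = Real.exp (t * 𝔼 r, f r + t ^ 2 / 2 * (insert b D).card) := by
          rw [← Real.exp_add, hmean, Finset.card_insert_of_notMem hb]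
          push_cast
          ring_nf

/-- Finitely many functions with bounded differences are simultaneously close to their means. -/
lemma exists_forall_abs_sub_expect_le [Nonempty R] {κ : Type*} [Fintype κ] (D : κ → Finset α)
    (f : κ → (α → R) → ℝ) (h1 : ∀ q, ∀ b ∈ D q, ∀ r x, |f q (Function.update r b x) - f q r| ≤ 1)
    (h0 : ∀ q, ∀ b ∉ D q, ∀ r x, f q (Function.update r b x) = f q r) (d : ℕ)
    (hd : ∀ q, (D q).card ≤ d) {t : ℝ} (ht : 0 < t) :
    ∃ r, ∀ q, |f q r - 𝔼 r, f q r| ≤ Real.log (2 * Fintype.card κ) / t + t * d / 2 := by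
  by_cases hκ : IsEmpty κ
  · obtain ⟨r⟩ : Nonempty (α → R) := inferInstance
    exact ⟨r, fun q => hκ.elim q⟩
  rw [not_isEmpty_iff] at hκ
  have hmom : ∀ q, ∀ s : ℝ, |s| = t →
      𝔼 r, Real.exp (s * (f q r - 𝔼 r, f q r)) ≤ Real.exp (t ^ 2 / 2 * d) := by
    intro q s hs
    have h := expect_exp_mul_le (D q) (f q) (h1 q) (h0 q) s
    have e : ∀ r, Real.exp (s * (f q r - 𝔼 r, f q r)) =
        Real.exp (s * f q r) * Real.exp (-(s * 𝔼 r, f q r)) := by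
      intro r
      rw [← Real.exp_add]
      ring_nf
    simp only [e]
    rw [← Finset.expect_mul]
    calc (𝔼 r, Real.exp (s * f q r)) * Real.exp (-(s * 𝔼 r, f q r))
        ≤ Real.exp (s * 𝔼 r, f q r + s ^ 2 / 2 * (D q).card) *
            Real.exp (-(s * 𝔼 r, f q r)) := by gcongr
      _ = Real.exp (t ^ 2 / 2 * (D q).card) := by
          rw [← Real.exp_add, ← hs, sq_abs]
          ring_nf
      _ ≤ Real.exp (t ^ 2 / 2 * d) := by
          gcongr
          exact hd q
  set Φ : (α → R) → ℝ := fun r => ∑ q, (Real.exp (t * (f q r - 𝔼 r, f q r)) +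
    Real.exp (-t * (f q r - 𝔼 r, f q r))) with hΦ
  have hexp : 𝔼 r, Φ r ≤ 2 * Fintype.card κ * Real.exp (t ^ 2 / 2 * d) := by
    simp only [hΦ]
    rw [Finset.expect_sum_comm]
    calc ∑ q, 𝔼 r, (Real.exp (t * (f q r - 𝔼 r, f q r)) +
          Real.exp (-t * (f q r - 𝔼 r, f q r)))
        ≤ ∑ _q : κ, (Real.exp (t ^ 2 / 2 * d) + Real.exp (t ^ 2 / 2 * d)) := by
          refine Finset.sum_le_sum fun q _ => ?_
          rw [Finset.expect_add_distrib]
          exact add_le_add (hmom q t (abs_of_pos ht)) (hmom q (-t) (by rw [abs_neg, abs_of_pos ht]))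
      _ = _ := by
          rw [Finset.sum_const, Finset.card_univ, nsmul_eq_mul]
          ring
  obtain ⟨r, -, hr⟩ := Finset.exists_le_of_expect_le Finset.univ_nonempty hexp
  refine ⟨r, fun q => ?_⟩
  have hκ0 : (0 : ℝ) < 2 * Fintype.card κ := by
    have := Fintype.card_pos (α := κ)
    positivity
  have hq : Real.exp (t * (f q r - 𝔼 r, f q r)) + Real.exp (-t * (f q r - 𝔼 r, f q r)) ≤
      2 * Fintype.card κ * Real.exp (t ^ 2 / 2 * d) := by
    refine le_trans ?_ hr
    exact Finset.single_le_sum (f := fun q => Real.exp (t * (f q r - 𝔼 r, f q r)) +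
      Real.exp (-t * (f q r - 𝔼 r, f q r))) (fun q _ => by positivity) (Finset.mem_univ q)
  have key : ∀ z : ℝ, Real.exp z ≤ 2 * Fintype.card κ * Real.exp (t ^ 2 / 2 * d) →
      z ≤ Real.log (2 * Fintype.card κ) + t ^ 2 / 2 * d := by
    intro z hz
    rw [← Real.exp_log hκ0, ← Real.exp_add] at hz
    exact Real.exp_le_exp.1 hz
  have e : Real.log (2 * Fintype.card κ) / t + t * d / 2 =
      (Real.log (2 * Fintype.card κ) + t ^ 2 / 2 * d) / t := by
    field_simp
  rw [e, le_div_iff₀ ht, ← abs_of_pos ht, ← abs_mul, abs_of_pos ht, abs_le']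
  constructor
  · rw [mul_comm]
    exact key _ (le_trans (le_add_of_nonneg_right (Real.exp_pos _).le) hq)
  · rw [mul_comm, ← neg_mul]
    exact key _ (le_trans (le_add_of_nonneg_left (Real.exp_pos _).le) hq)

end BoundedDifferences

section Words

variable {G : Type*}

/-- An equivariant function on words and letters is maximized by an equivariant choice of
letters. -/
lemma exists_equivariant_argmax [AddCommGroup G] [Finite G] (f : (ℕ → G) → G → ℝ)
    (hf : ∀ g w ℓ, f (fun j => g + w j) (g + ℓ) = f w ℓ) :
    ∃ A : (ℕ → G) → G, (∀ g w, A (fun j => g + w j) = g + A w) ∧ ∀ w ℓ, f w ℓ ≤ f w (A w) := by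
  choose a ha using fun h : G → ℝ => Finite.exists_max h
  refine ⟨fun w => w 0 + a fun ℓ => f w (w 0 + ℓ), fun g w => ?_, fun w ℓ => ?_⟩
  · simp only [add_assoc, hf]
  · have h := ha (fun ℓ => f w (w 0 + ℓ)) (-w 0 + ℓ)
    simpa using h

lemma sum_range_sub_of_monotone {s : ℕ → ℕ} (hs : Monotone s) (h0 : s 0 = 0) (m : ℕ) :
    ∑ b ∈ Finset.range m, (s (b + 1) - s b) = s m := by
  rw [Finset.sum_range_tsub hs, h0, Nat.sub_zero]

/-- Words in a slow collection differ in few positions. -/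
lemma SlowAlong.card_ne_lt [DecidableEq G] {L : ℕ} {gs : List G} {ws : List (ℕ → G)}
    (h : SlowAlong L gs ws) {w w' : ℕ → G} (hw : w ∈ ws) (hw' : w' ∈ ws) :
    ((Finset.range L).filter fun j => w j ≠ w' j).card < gs.length := by
  obtain ⟨-, s, hs, h0, hL, hsw⟩ := h
  refine lt_of_le_of_lt ?_ hL
  rw [← sum_range_sub_of_monotone hs h0 L, Finset.card_filter]
  refine Finset.sum_le_sum fun j hj => ?_
  rw [Finset.mem_range] at hj
  split_ifs with hne
  · by_contra hlt
    obtain ⟨t, ht, ht', e⟩ := hsw w hw j hj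
    obtain ⟨u, hu, hu', e'⟩ := hsw w' hw' j hj
    have : t = u := by omega
    subst this
    exact hne (Option.some_injective _ (e.symm.trans e'))
  · exact Nat.zero_le _

/-- The `b`-th block of length `B` of a word contains a letter `ℓ`, but is not constant. -/
def Mixed (B : ℕ) (w : ℕ → G) (b : ℕ) (ℓ : G) : Prop :=
  (∃ r < B, w (b * B + r) = ℓ) ∧ ∃ r < B, w (b * B + r) ≠ ℓ

/-- Few blocks of the words in a slow collection are mixed. -/
lemma SlowAlong.sum_card_mixed_lt [Fintype G] {m B : ℕ} {gs : List G} {ws : List (ℕ → G)}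
    (h : SlowAlong (m * B) gs ws) (w : G → ℕ → G) (hw : ∀ ℓ, w ℓ ∈ ws)
    [∀ ℓ b, Decidable (Mixed B (w ℓ) b ℓ)] :
    ∑ ℓ, ((Finset.range m).filter fun b => Mixed B (w ℓ) b ℓ).card < 2 * gs.length := by
  classical
  obtain ⟨-, s, hs, h0, hL, hsw⟩ := h
  have hsB : Monotone fun b => s (b * B) := fun a b hab => hs (Nat.mul_le_mul_right B hab)
  have hsum := sum_range_sub_of_monotone hsB (by simpa using h0) m
  suffices hb : ∑ ℓ, ((Finset.range m).filter fun b => Mixed B (w ℓ) b ℓ).card ≤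
      2 * ∑ b ∈ Finset.range m, (s ((b + 1) * B) - s (b * B)) by
    omega
  simp only [Finset.card_filter]
  rw [Finset.sum_comm, Finset.mul_sum]
  refine Finset.sum_le_sum fun b hb => ?_
  rw [← Finset.card_filter]
  rw [Finset.mem_range] at hb
  have hletter : ∀ ℓ, ∀ r < B, ∃ t, s (b * B) ≤ t ∧ t ≤ s ((b + 1) * B) ∧
      gs[t]? = some (w ℓ (b * B + r)) := by
    intro ℓ r hr
    have hlt : (b + 1) * B ≤ m * B := Nat.mul_le_mul_right B hb
    rw [add_mul, one_mul] at hlt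
    obtain ⟨t, ht, ht', e⟩ := hsw (w ℓ) (hw ℓ) (b * B + r) (by omega)
    refine ⟨t, (hs (by omega)).trans ht, ht'.trans (hs ?_), e⟩
    rw [add_mul, one_mul]
    omega
  have hle : s (b * B) ≤ s ((b + 1) * B) := hs (Nat.mul_le_mul_right B (Nat.le_succ b))
  rcases hle.eq_or_lt with heq | hlt
  · rw [Finset.filter_false_of_mem]
    · simp
    · rintro ℓ - ⟨⟨r, hr, e⟩, r', hr', hne⟩
      obtain ⟨t, ht, ht', et⟩ := hletter ℓ r hr
      obtain ⟨u, hu, hu', eu⟩ := hletter ℓ r' hr'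
      have : t = u := by omega
      subst this
      exact hne ((Option.some_injective _ (eu.symm.trans et)).trans e)
  · have hsub : (Finset.univ.filter fun ℓ => Mixed B (w ℓ) b ℓ).map Function.Embedding.some ⊆
        (Finset.Icc (s (b * B)) (s ((b + 1) * B))).image fun t => gs[t]? := by
      intro o ho
      simp only [Finset.mem_map, Finset.mem_filter, Finset.mem_univ, true_and] at ho
      obtain ⟨ℓ, ⟨⟨r, hr, e⟩, -⟩, rfl⟩ := ho
      obtain ⟨t, ht, ht', et⟩ := hletter ℓ r hr
      exact Finset.mem_image.2 ⟨t, Finset.mem_Icc.2 ⟨ht, ht'⟩, by rw [et, e]; rfl⟩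
    have hcard := (Finset.card_le_card hsub).trans Finset.card_image_le
    rw [Finset.card_map, Nat.card_Icc] at hcard
    omega

end Words

section Valuation

variable {α : Type*} [DecidableEq α] {u : Finset α → ℝ}

lemma abs_union_sub_le (hu : ∀ S j, |u (insert j S) - u S| ≤ 1) (S T : Finset α) :
    |u (S ∪ T) - u S| ≤ T.card := by
  induction T using Finset.induction_on with
  | empty => simp
  | insert b T hb ih =>
    rw [Finset.union_insert, Finset.card_insert_of_notMem hb]
    have h := abs_sub_le (u (insert b (S ∪ T))) (u (S ∪ T)) (u S)
    have h' := hu (S ∪ T) b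
    push_cast
    linarith

lemma abs_sub_le_card_sdiff (hu : ∀ S j, |u (insert j S) - u S| ≤ 1) (S T : Finset α) :
    |u S - u T| ≤ (S \ T).card + (T \ S).card := by
  have h1 := abs_union_sub_le hu T (S \ T)
  have h2 := abs_union_sub_le hu S (T \ S)
  rw [Finset.union_sdiff_self_eq_union] at h1 h2
  rw [Finset.union_comm, abs_sub_comm] at h2
  have h := abs_sub_le (u S) (u (T ∪ S)) (u T)
  linarith

/-- The value of a color class is Lipschitz in the coloring. -/
lemma abs_sub_le_card_ne [Fintype α] {G : Type*} [DecidableEq G]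
    (hu : ∀ S j, |u (insert j S) - u S| ≤ 1) (x y : α → G) (ℓ : G) :
    |u (Finset.univ.filter fun b => x b = ℓ) - u (Finset.univ.filter fun b => y b = ℓ)| ≤
      (Finset.univ.filter fun b => x b ≠ y b).card := by
  refine (abs_sub_le_card_sdiff hu _ _).trans ?_
  rw [← Nat.cast_add, Nat.cast_le, ← Finset.card_union_of_disjoint disjoint_sdiff_sdiff]
  refine Finset.card_le_card fun b => ?_
  simp only [Finset.mem_union, Finset.mem_sdiff, Finset.mem_filter, Finset.mem_univ, true_and]
  rintro (⟨rfl, h⟩ | ⟨rfl, h⟩)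
  · exact fun e => h e.symm
  · exact h

end Valuation

/-- The average value of a color class, when each item takes the color of a random letter of its
block in a word. -/
noncomputable def blockMean {G α : Type*} [Fintype α] [DecidableEq α] [DecidableEq G]
    (u : Finset α → ℝ) (idx : α → ℕ) (B : ℕ) (w : ℕ → G) (ℓ : G) : ℝ :=
  𝔼 r : α → Fin B, u (Finset.univ.filter fun b => w (idx b * B + r b) = ℓ)

/-- Slow collections of words with blocks of large length have similar block means. -/
lemma SlowAlong.abs_blockMean_sub_le {G α : Type*} [Fintype α] [DecidableEq α] [DecidableEq G]
    {u : Finset α → ℝ} (hu : ∀ S j, |u (insert j S) - u S| ≤ 1) {m B : ℕ} (hB : 0 < B)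
    {idx : α → ℕ} (hinj : Function.Injective idx) (hidx : ∀ b, idx b < m) {gs : List G}
    {ws : List (ℕ → G)} (h : SlowAlong (m * B) gs ws) (hgs : gs.length ≤ B) {w w' : ℕ → G}
    (hw : w ∈ ws) (hw' : w' ∈ ws) (ℓ : G) :
    |blockMean u idx B w ℓ - blockMean u idx B w' ℓ| ≤ 1 := by
  have : Nonempty (Fin B) := ⟨⟨0, hB⟩⟩
  have hcard : (∑ b, ∑ x : Fin B, if w (idx b * B + x) ≠ w' (idx b * B + x) then 1 else 0) ≤ B := by
    refine le_trans ?_ ((h.card_ne_lt hw hw').le.trans hgs)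
    rw [← Fintype.sum_prod_type', ← Finset.card_filter]
    refine Finset.card_le_card_of_injOn (fun z : α × Fin B => idx z.1 * B + z.2) ?_ ?_
    · rintro ⟨b, x⟩ hz
      simp only [Finset.coe_filter, Finset.mem_univ, true_and, Set.mem_ofPred_eq,
        Finset.mem_range] at hz ⊢
      refine ⟨?_, hz⟩
      have h1 : (idx b + 1) * B ≤ m * B := Nat.mul_le_mul_right B (hidx b)
      have h2 := x.2
      rw [add_mul, one_mul] at h1
      omega
    · rintro ⟨b, x⟩ - ⟨c, y⟩ - hz
      simp only at hz
      have h1 : idx b = idx c := by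
        have h := congrArg (· / B) hz
        simpa [Nat.mul_add_div hB, Nat.add_comm, Nat.add_mul_div_right _ _ hB,
          Nat.div_eq_of_lt x.2, Nat.div_eq_of_lt y.2] using h
      rw [h1] at hz
      exact Prod.ext (hinj h1) (Fin.ext (Nat.add_left_cancel hz))
  rw [blockMean, blockMean, ← Finset.expect_sub_distrib]
  refine (Finset.abs_expect_le _ _).trans ?_
  refine (Finset.expect_le_expect fun r _ => abs_sub_le_card_ne hu
    (fun b => w (idx b * B + r b)) (fun b => w' (idx b * B + r b)) ℓ).trans ?_
  simp only [Finset.card_filter, Nat.cast_sum]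
  rw [Finset.expect_sum_comm]
  rw [Finset.sum_congr rfl fun b _ => expect_apply b fun x : Fin B =>
    ((if w (idx b * B + x) ≠ w' (idx b * B + x) then 1 else 0 : ℕ) : ℝ)]
  simp only [Fintype.expect_eq_sum_div_card, Fintype.card_fin]
  rw [← Finset.sum_div, div_le_one (by exact_mod_cast hB)]
  exact_mod_cast hcard

/-- Fractional colorings, in which each item distributes its weight over a block of letters, and
which are almost fair although each color is shared by few items. -/
lemma exists_fractional_coloring (p : ℕ) [Fact p.Prime] {ν : ℕ} (hν : ν ≠ 0) {n : ℕ} {α : Type*}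
    [Fintype α] [DecidableEq α] (v : Fin n → Finset α → ℝ)
    (hv : ∀ i S j, |v i (insert j S) - v i S| ≤ 1) :
    ∃ (B : ℕ) (W : α → Fin B → Fin (p ^ ν)), 0 < B ∧
      (∀ ℓ, (Finset.univ.filter fun b => (∃ x, W b x = ℓ) ∧ ∃ x, W b x ≠ ℓ).card ≤ 2 * n + 4) ∧
      ∀ i ℓ ℓ', 𝔼 r : α → Fin B, v i (Finset.univ.filter fun b => W b (r b) = ℓ) ≤
        (𝔼 r : α → Fin B, v i (Finset.univ.filter fun b => W b (r b) = ℓ')) + 2 := by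
  classical
  set n' := 2 * (n / 2 + 1) with hn'
  obtain ⟨G, _, hG, h⟩ := exists_slowAlong p hν n' (even_two_mul _)
  have hk : 0 < p ^ ν := pow_pos (Fact.out : p.Prime).pos ν
  have : Finite G := Nat.finite_of_card_ne_zero (by omega)
  have := Fintype.ofFinite G
  rw [Nat.card_eq_fintype_card] at hG
  set m := Fintype.card α
  set B := n' * (p ^ ν - 1) + 1 with hB
  set idx : α → ℕ := fun b => Fintype.equivFin α b with hidx
  have hinj : Function.Injective idx := Fin.val_injective.comp (Fintype.equivFin α).injective
  let f : ℕ → (ℕ → G) → G → ℝ := fun i w ℓ =>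
    if hi : i < n then blockMean (v ⟨i, hi⟩) idx B w ℓ
    else (((Finset.range m).filter fun b => Mixed B w b ℓ).card : ℝ)
  have hf : ∀ i g w ℓ, f i (fun j => g + w j) (g + ℓ) = f i w ℓ := by
    intro i g w ℓ
    by_cases hi : i < n
    · simp [f, hi, blockMean]
    · simp only [f, dif_neg hi]
      exact congrArg (fun s : Finset ℕ => (s.card : ℝ))
        (Finset.filter_congr fun b _ => by simp [Mixed])
  choose A hA hmax using fun i => exists_equivariant_argmax (f i) (hf i)
  obtain ⟨gs, ws, hgs, hws, hall⟩ := h (m * B) A hA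
  obtain ⟨w₀, hw₀, hmixed⟩ : ∃ w ∈ ws, ∀ ℓ,
      ((Finset.range m).filter fun b => Mixed B w b ℓ).card ≤ 2 * n' := by
    choose w hw hwg using hall n (by omega)
    have hsum := hws.sum_card_mixed_lt w hw
    obtain ⟨g, -, hg⟩ : ∃ g ∈ Finset.univ,
        ((Finset.range m).filter fun b => Mixed B (w g) b g).card ≤ 2 * n' := by
      refine Finset.exists_le_of_sum_le (g := fun _ => 2 * n')
        (Finset.card_pos.1 (by rw [Finset.card_univ]; omega)) ?_
      rw [Finset.sum_const, Finset.card_univ, hG, smul_eq_mul]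
      obtain ⟨d, hd⟩ : ∃ d, p ^ ν = d + 1 := ⟨p ^ ν - 1, by omega⟩
      have hB' : B = n' * d + 1 := by rw [hB, hd, Nat.add_sub_cancel]
      have hn2 : 2 ≤ n' := by omega
      rw [hgs] at hsum
      rw [hd]
      nlinarith
    refine ⟨w g, hw g, fun ℓ => le_trans ?_ hg⟩
    have h := hmax n (w g) ℓ
    rw [hwg] at h
    simpa [f] using h
  let e : G ≃ Fin (p ^ ν) := Fintype.equivFinOfCardEq hG
  refine ⟨B, fun b x => e (w₀ (idx b * B + x)), by omega, fun ℓ => ?_, fun i ℓ ℓ' => ?_⟩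
  · refine le_trans ?_ ((hmixed (e.symm ℓ)).trans (by omega))
    refine Finset.card_le_card_of_injOn idx (fun b hb => ?_) hinj.injOn
    simp only [Finset.coe_filter, Finset.mem_univ, true_and, Set.mem_ofPred_eq,
      Finset.mem_range] at hb ⊢
    obtain ⟨⟨x, hx⟩, y, hy⟩ := hb
    refine ⟨(Fintype.equivFin α b).2, ⟨x, x.2, ?_⟩, y, y.2, ?_⟩
    · rw [← hx, e.symm_apply_apply]
    · exact fun h => hy (by rw [h, e.apply_symm_apply])
  · have hlip : ∀ w ∈ ws, ∀ ℓ, |blockMean (v i) idx B w₀ ℓ - blockMean (v i) idx B w ℓ| ≤ 1 :=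
      fun w hw ℓ => hws.abs_blockMean_sub_le (hv i) (by omega) hinj
        (fun b => (Fintype.equivFin α b).2) hgs.le hw₀ hw ℓ
    obtain ⟨w, hw, hwi⟩ := hall i (by omega) (e.symm ℓ')
    have h := hmax i w (e.symm ℓ)
    rw [hwi] at h
    simp only [f, i.2, dif_pos] at h
    have h1 := abs_le.1 (hlip w hw (e.symm ℓ))
    have h2 := abs_le.1 (hlip w hw (e.symm ℓ'))
    have h3 : blockMean (v i) idx B w₀ (e.symm ℓ) ≤ blockMean (v i) idx B w₀ (e.symm ℓ') + 2 := by
      linarith [h1.2, h2.1]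
    simpa only [blockMean, e.eq_symm_apply] using h3

/-- Random choices of letters turn fractional colorings into colorings. -/
lemma exists_coloring_of_fractional {n k B d : ℕ} (hB : 0 < B)
    {α : Type*} [Fintype α] [DecidableEq α] {v : Fin n → Finset α → ℝ}
    (hv : ∀ i S j, |v i (insert j S) - v i S| ≤ 1) (W : α → Fin B → Fin k)
    (hd : ∀ ℓ, (Finset.univ.filter fun b => (∃ x, W b x = ℓ) ∧ ∃ x, W b x ≠ ℓ).card ≤ d)
    {t : ℝ} (ht : 0 < t) :
    ∃ χ : α → Fin k, ∀ i ℓ, |v i (Finset.univ.filter fun b => χ b = ℓ) -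
      𝔼 r : α → Fin B, v i (Finset.univ.filter fun b => W b (r b) = ℓ)| ≤
        Real.log (2 * (n * k)) / t + t * d / 2 := by
  have : Nonempty (Fin B) := ⟨⟨0, hB⟩⟩
  have h1 : ∀ q : Fin n × Fin k, ∀ b (r : α → Fin B) (x : Fin B),
      |v q.1 (Finset.univ.filter fun c => W c (Function.update r b x c) = q.2) -
        v q.1 (Finset.univ.filter fun c => W c (r c) = q.2)| ≤ 1 := by
    intro q b r x
    refine (abs_sub_le_card_ne (hv q.1) (fun c => W c (Function.update r b x c))
      (fun c => W c (r c)) q.2).trans ?_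
    have hsub : (Finset.univ.filter fun c => W c (Function.update r b x c) ≠ W c (r c)) ⊆ {b} := by
      intro c hc
      by_contra hne
      simp [Function.update_of_ne (Finset.notMem_singleton.1 hne)] at hc
    exact_mod_cast (Finset.card_le_card hsub).trans_eq (Finset.card_singleton b)
  have h0 : ∀ q : Fin n × Fin k,
      ∀ b ∉ Finset.univ.filter fun b => (∃ x, W b x = q.2) ∧ ∃ x, W b x ≠ q.2,
      ∀ (r : α → Fin B) (x : Fin B),
        v q.1 (Finset.univ.filter fun c => W c (Function.update r b x c) = q.2) =
          v q.1 (Finset.univ.filter fun c => W c (r c) = q.2) := by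
    intro q b hb r x
    refine congrArg _ (Finset.filter_congr fun c _ => ?_)
    obtain rfl | hne := eq_or_ne c b
    · simp only [Finset.mem_filter, Finset.mem_univ, true_and, not_and, not_exists,
        not_not] at hb
      exact ⟨fun h => hb ⟨_, h⟩ _, fun h => hb ⟨_, h⟩ _⟩
    · rw [Function.update_of_ne hne]
  obtain ⟨r, hr⟩ := exists_forall_abs_sub_expect_le _
    (fun q r => v q.1 (Finset.univ.filter fun b => W b (r b) = q.2)) (fun q b _ => h1 q b) h0 d
    (fun q => hd q.2) ht
  refine ⟨fun b => W b (r b), fun i ℓ => ?_⟩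
  simpa using hr (i, ℓ)

end ListCochain

/-- **Non-additive multi-color discrepancy (main theorem).**
There is a universal constant `C > 0` such that: for every prime power `k = p ^ ν`,
every finite set of items `α`, and every family of `n` valuation functions
`v i : Finset α → ℝ` with marginals bounded by `1`, there is a partition of the
items into `k` color classes (given by the fibers of `χ : α → Fin k`) such that
for all colors `ℓ, ℓ'` and all agents `i`,
`|v i (S ℓ) - v i (S ℓ')| ≤ C * √(n * log (n * k))`. -/
theorem nonadditive_multicolor_discrepancy :
    ∃ C : ℝ, 0 < C ∧
      ∀ (p ν k n : ℕ), p.Prime → 1 ≤ ν → k = p ^ ν →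
      ∀ (α : Type) [Fintype α] [DecidableEq α]
        (v : Fin n → Finset α → ℝ),
        (∀ (i : Fin n) (S : Finset α) (j : α), |v i (insert j S) - v i S| ≤ 1) →
        ∃ χ : α → Fin k,
          ∀ (i : Fin n) (ℓ ℓ' : Fin k),
            |v i (Finset.univ.filter fun j => χ j = ℓ) -
              v i (Finset.univ.filter fun j => χ j = ℓ')| ≤
              C * Real.sqrt (n * Real.log (n * k)) := by
  refine ⟨14, by norm_num, ?_⟩
  intro p ν k n hp hν hkp α _ _ v hv
  have := Fact.mk hp
  have hν0 : ν ≠ 0 := by omega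
  have hk : 2 ≤ k := hkp ▸ hp.two_le.trans (Nat.le_self_pow hν0 p)
  obtain rfl | hn := eq_or_ne n 0
  · exact ⟨fun _ => ⟨0, by omega⟩, fun i => i.elim0⟩
  have hfrac := ListCochain.exists_fractional_coloring p hν0 v hv
  rw [← hkp] at hfrac
  obtain ⟨B, W, hB, hW, hfair⟩ := hfrac
  have hn1 : (1 : ℝ) ≤ n := by exact_mod_cast Nat.one_le_iff_ne_zero.2 hn
  have hnk : (2 : ℝ) ≤ n * k := by
    have : (2 : ℝ) ≤ k := by exact_mod_cast hk
    nlinarith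
  set L := Real.log (n * k) with hL
  have hlog2 : Real.log 2 ≤ L := Real.log_le_log two_pos hnk
  have hL0 : 1 / 4 ≤ L := by linarith [Real.log_two_gt_d9]
  set T := Real.sqrt (n * L) with hT
  have hTsq : T ^ 2 = n * L := Real.sq_sqrt (by positivity)
  have hT0 : 1 / 2 ≤ T := Real.le_sqrt_of_sq_le (by nlinarith)
  have ht : 0 < T / n := by positivity
  obtain ⟨χ, hχ⟩ := ListCochain.exists_coloring_of_fractional hB hv W hW ht
  have hbound : Real.log (2 * (n * k)) / (T / n) + T / n * (2 * n + 4 : ℕ) / 2 ≤ 5 * T := by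
    have h1 : Real.log (2 * (n * k)) / (T / n) ≤ 2 * T := by
      rw [div_le_iff₀ ht, Real.log_mul two_ne_zero (by positivity), ← hL]
      have : 2 * T * (T / n) = 2 * L := by
        field_simp
        linarith
      linarith
    have h2 : T / n * (2 * n + 4 : ℕ) / 2 ≤ 3 * T := by
      push_cast
      rw [div_mul_eq_mul_div, div_div, div_le_iff₀ (by positivity)]
      nlinarith
    linarith
  refine ⟨χ, fun i ℓ ℓ' => ?_⟩
  have h1 := abs_le.1 ((hχ i ℓ).trans hbound)
  have h2 := abs_le.1 ((hχ i ℓ').trans hbound)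
  rw [abs_le]
  constructor <;> linarith [h1.1, h1.2, h2.1, h2.2, hfair i ℓ ℓ', hfair i ℓ' ℓ]
end

section
/- There exists a universal constant C > 0 such that for every finite set M and every family of n ≥ 2 valuation functions v_1, …, v_n : 2^M → ℝ with marginals bounded by 1, there exists a bipartition M = S ∪ S^c with |v_i(S) − v_i(S^c)| ≤ C·√(n·log(2n)) for every i ∈ [n]. -/
/-- The sum over all orderings `i₁, i₂, …` of `I` of the products `⁅s₁, E i₁⁆ * ⁅s₂, E i₂⁆ * ⋯`
of commutators, written with `+` since it is used in characteristic two. -/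
def commutatorSum {R ι : Type*} [Ring R] [DecidableEq ι] (E : ι → R) : List R → Finset ι → R
  | [], I => if I = ∅ then 1 else 0
  | s :: ss, I => ∑ i ∈ I, (s * E i + E i * s) * commutatorSum E ss (I.erase i)

lemma sum_sum_erase_eq_zero {R ι : Type*} [AddCommGroup R] [DecidableEq ι]
    (h2 : ∀ x : R, x + x = 0) (f : ι → ι → R) (hf : ∀ i j, f i j = f j i) (I : Finset ι) :
    ∑ i ∈ I, ∑ j ∈ I.erase i, f i j = 0 := by
  induction I using Finset.induction_on with
  | empty => simp
  | insert a I ha ih =>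
    rw [Finset.sum_insert ha, Finset.erase_insert ha]
    have : ∀ i ∈ I, ∑ j ∈ (insert a I).erase i, f i j = f a i + ∑ j ∈ I.erase i, f i j := by
      intro i hi
      have hne : a ≠ i := by rintro rfl; exact ha hi
      rw [Finset.erase_insert_of_ne hne, Finset.sum_insert (by simp [ha]), hf]
    rw [Finset.sum_congr rfl this, Finset.sum_add_distrib, ih, add_zero, h2]

lemma sum_commutator_commutatorSum {R ι : Type*} [Ring R] [DecidableEq ι]
    (h2 : ∀ x : R, x + x = 0) (E : ι → R) (ss : List R)
    (hs : ∀ s ∈ ss, ∀ i j, s * (E i * E j + E j * E i) + (E i * E j + E j * E i) * s = 0)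
    (I : Finset ι) :
    ∑ i ∈ I, (commutatorSum E ss (I.erase i) * E i + E i * commutatorSum E ss (I.erase i)) = 0 := by
  induction ss generalizing I with
  | nil =>
    refine Finset.sum_eq_zero fun i _ => ?_
    simp only [commutatorSum]
    split_ifs
    · simp [h2]
    · simp
  | cons s ss ih =>
    have ih' := ih fun s' hs' => hs s' (List.mem_cons_of_mem _ hs')
    have key : ∀ i ∈ I, commutatorSum E (s :: ss) (I.erase i) * E i
          + E i * commutatorSum E (s :: ss) (I.erase i)
        = ∑ j ∈ I.erase i, ((s * E j + E j * s) * E i + E i * (s * E j + E j * s))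
            * commutatorSum E ss ((I.erase i).erase j)
          + ∑ j ∈ I.erase i, (s * E j + E j * s) * (commutatorSum E ss ((I.erase j).erase i) * E i
            + E i * commutatorSum E ss ((I.erase j).erase i)) := by
      intro i _
      simp only [commutatorSum]
      rw [Finset.sum_mul, Finset.mul_sum, ← Finset.sum_add_distrib, ← Finset.sum_add_distrib]
      refine Finset.sum_congr rfl fun j _ => ?_
      rw [Finset.erase_right_comm (a := j)]
      generalize commutatorSum E ss ((I.erase i).erase j) = P
      generalize s * E j + E j * s = Q
      have := h2 (Q * E i * P)
      calc Q * P * E i + E i * (Q * P)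
          = Q * P * E i + E i * Q * P + (Q * E i * P + Q * E i * P) := by
            rw [this]; noncomm_ring
        _ = _ := by noncomm_ring
    rw [Finset.sum_congr rfl key, Finset.sum_add_distrib, sum_sum_erase_eq_zero h2, zero_add]
    · rw [Finset.sum_comm' (t' := I) (s' := fun j => I.erase j)]
      · refine Finset.sum_eq_zero fun j _ => ?_
        rw [← Finset.mul_sum, ih', mul_zero]
      · intro i j
        simp only [Finset.mem_erase]
        tauto
    · intro i j
      rw [Finset.erase_right_comm (a := j)]
      congr 1
      have h := hs s (by simp) i j
      have h' := h2 (s * E i * E j + E j * s * E i + E i * s * E j + E j * E i * s)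
      rw [← sub_eq_zero, ← h]
      have h3 := h2 (s * E i * E j)
      have h4 := h2 (E j * E i * s)
      calc _ = s * E j * E i + E i * E j * s - s * E i * E j - E j * E i * s := by noncomm_ring
        _ = s * E j * E i + E i * E j * s - s * E i * E j - E j * E i * s
            + (s * E i * E j + s * E i * E j) + (E j * E i * s + E j * E i * s) := by
              rw [h3, h4]; simp
        _ = _ := by noncomm_ring

lemma sum_commutator_mul_commutatorSum {R ι : Type*} [Ring R] [DecidableEq ι]
    (h2 : ∀ x : R, x + x = 0) (E : ι → R) (s : R) (ss : List R)
    (hs : ∀ s ∈ ss, ∀ i j, s * (E i * E j + E j * E i) + (E i * E j + E j * E i) * s = 0)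
    (I : Finset ι) :
    commutatorSum E (s :: ss) I = ∑ i ∈ I, (s * commutatorSum E ss (I.erase i) * E i
      + E i * (s * commutatorSum E ss (I.erase i))) := by
  have h := sum_commutator_commutatorSum h2 E ss hs I
  have h' : ∑ i ∈ I, s * (commutatorSum E ss (I.erase i) * E i
      + E i * commutatorSum E ss (I.erase i)) = 0 := by
    rw [← Finset.mul_sum, h, mul_zero]
  rw [← add_zero (commutatorSum E (s :: ss) I), ← h', commutatorSum]
  rw [← Finset.sum_add_distrib]
  refine Finset.sum_congr rfl fun i _ => ?_
  generalize commutatorSum E ss (I.erase i) = P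
  have h3 := h2 (s * E i * P)
  calc _ = s * P * E i + E i * (s * P) + (s * E i * P + s * E i * P) := by noncomm_ring
    _ = _ := by rw [h3, add_zero]

open Classical in
/-- The shift in direction `i`, truncated to the region `V`. -/
noncomputable def truncShift {ι : Type*} [DecidableEq ι] (V : (ι → ℤ) → Prop) (i : ι) :
    Module.End (ZMod 2) ((ι → ℤ) → ZMod 2) where
  toFun f t := if V t ∧ V (t + Pi.single i 1) then f (t + Pi.single i 1) else 0
  map_add' f g := by ext t; simp only [Pi.add_apply]; split_ifs <;> simp
  map_smul' c f := by ext t; simp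

open Classical in
/-- The sum over all lattice paths in `V` from `t` which make one unit step in each direction of
`I`, of the products of the increments of `s₁, s₂, …` along the successive steps. -/
noncomputable def pathSum {ι : Type*} [DecidableEq ι] (V : (ι → ℤ) → Prop) :
    List ((ι → ℤ) → ZMod 2) → Finset ι → (ι → ℤ) → ZMod 2
  | [], I, _ => if I = ∅ then 1 else 0
  | s :: ss, I, t => ∑ i ∈ I, if V t ∧ V (t + Pi.single i 1) then
      (s t + s (t + Pi.single i 1)) * pathSum V ss (I.erase i) (t + Pi.single i 1) else 0

open Classical in
lemma commutatorSum_apply {ι : Type*} [DecidableEq ι] (V : (ι → ℤ) → Prop)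
    (ss : List ((ι → ℤ) → ZMod 2)) (I : Finset ι) (f : (ι → ℤ) → ZMod 2) (t : ι → ℤ) :
    commutatorSum (truncShift V) (ss.map (LinearMap.mulLeft (ZMod 2))) I f t
      = pathSum V ss I t * f (t + fun k => if k ∈ I then 1 else 0) := by
  induction ss generalizing I t with
  | nil =>
    simp only [List.map_nil, commutatorSum, pathSum]
    split_ifs with h
    · subst h
      simp
      congr 1
      ext; simp
    · simp
  | cons s ss ih =>
    simp only [List.map_cons, commutatorSum, pathSum, LinearMap.sum_apply, Finset.sum_apply,
      Finset.sum_mul]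
    refine Finset.sum_congr rfl fun i hi => ?_
    simp only [Module.End.mul_apply, LinearMap.add_apply, Pi.add_apply, LinearMap.mulLeft_apply,
      Pi.mul_apply]
    simp only [truncShift, LinearMap.coe_mk, AddHom.coe_mk, Pi.mul_apply]
    split_ifs with h
    · rw [ih]
      have : (t + Pi.single i 1 + fun k => if k ∈ I.erase i then (1 : ℤ) else 0)
          = t + fun k => if k ∈ I then 1 else 0 := by
        ext k
        by_cases hk : k = i
        · subst hk; simp [hi]
        · simp [hk]
      rw [this]
      ring
    · simp

lemma pathSum_ne_zero {ι : Type*} [DecidableEq ι] (V : (ι → ℤ) → Prop)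
    (ss : List ((ι → ℤ) → ZMod 2)) (I : Finset ι) (t : ι → ℤ) (ht : V t)
    (h : pathSum V ss I t ≠ 0) :
    V (t + fun k => if k ∈ I then 1 else 0) ∧ ∀ s ∈ ss, ∃ u u', V u ∧ V u' ∧ s u ≠ s u' ∧
      ∀ k, t k ≤ u k ∧ u k ≤ t k + (if k ∈ I then 1 else 0) ∧
        t k ≤ u' k ∧ u' k ≤ t k + (if k ∈ I then 1 else 0) := by
  induction ss generalizing I t with
  | nil =>
    simp only [pathSum, ne_eq, ite_eq_right_iff, one_ne_zero, imp_false, not_not] at h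
    subst h
    refine ⟨?_, by simp⟩
    convert ht using 1
    ext; simp
  | cons s ss ih =>
    rw [pathSum] at h
    obtain ⟨i, hi, h⟩ := Finset.exists_ne_zero_of_sum_ne_zero h
    split_ifs at h with hV
    swap
    · exact absurd rfl h
    obtain ⟨hend, hss⟩ := ih _ _ hV.2 (right_ne_zero_of_mul h)
    have hstep : ∀ k, (t + Pi.single i 1 : ι → ℤ) k + (if k ∈ I.erase i then (1 : ℤ) else 0)
        = t k + if k ∈ I then 1 else 0 := by
      intro k
      by_cases hk : k = i
      · subst hk; simp [hi]
      · simp [hk]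
    have hle : ∀ k, t k ≤ (t + Pi.single i 1 : ι → ℤ) k := by
      intro k
      by_cases hk : k = i
      · subst hk; simp
      · simp [hk]
    have hle' : ∀ k, (t + Pi.single i 1 : ι → ℤ) k ≤ t k + if k ∈ I then 1 else 0 := by
      intro k
      rw [← hstep]
      split_ifs <;> simp
    refine ⟨?_, ?_⟩
    · convert hend using 1
      ext k
      exact (hstep k).symm
    · intro s' hs'
      rcases List.mem_cons.1 hs' with rfl | hs'
      · refine ⟨t, t + Pi.single i 1, hV.1, hV.2, ?_, fun k => ⟨le_rfl, (hle k).trans (hle' k),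
          hle k, hle' k⟩⟩
        intro he
        rw [he] at h
        exact left_ne_zero_of_mul h (CharTwo.add_self_eq_zero _)
      · obtain ⟨u, u', hu, hu', hne, hk⟩ := hss s' hs'
        refine ⟨u, u', hu, hu', hne, fun k => ?_⟩
        have h1 := hk k
        rw [hstep] at h1
        have := hle k
        exact ⟨by linarith, h1.2.1, by linarith, h1.2.2.2⟩

lemma pathSum_map {ι κ : Type*} [DecidableEq ι] [DecidableEq κ] (V : (ι → ℤ) → Prop)
    (W : (κ → ℤ) → Prop) (e : ι ↪ κ) (φ : (ι → ℤ) → κ → ℤ) (hφ : ∀ t, W (φ t) ↔ V t)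
    (hstep : ∀ t i, φ (t + Pi.single i 1) = φ t + Pi.single (e i) 1)
    (ss : List ((κ → ℤ) → ZMod 2)) (I : Finset ι) (t : ι → ℤ) :
    pathSum W ss (I.map e) (φ t) = pathSum V (ss.map (· ∘ φ)) I t := by
  induction ss generalizing I t with
  | nil => simp [pathSum]
  | cons s ss ih =>
    classical
    simp only [pathSum, List.map_cons, Finset.sum_map, ← hstep, Function.comp_apply]
    refine Finset.sum_congr rfl fun i _ => ?_
    rw [← ih, Finset.map_erase]
    refine if_congr ?_ rfl rfl
    rw [hφ, hφ]

lemma pathSum_map_add_one {ι : Type*} [DecidableEq ι] (V : (ι → ℤ) → Prop)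
    (ss : List ((ι → ℤ) → ZMod 2)) (I : Finset ι) (t : ι → ℤ) :
    pathSum V (ss.map (· + 1)) I t = pathSum V ss I t := by
  induction ss generalizing I t with
  | nil => simp [pathSum]
  | cons s ss ih =>
    simp only [List.map_cons, pathSum, ih, Pi.add_apply, Pi.one_apply]
    refine Finset.sum_congr rfl fun i _ => ?_
    have : s t + 1 + (s (t + Pi.single i 1) + 1) = s t + s (t + Pi.single i 1) := by
      rw [add_add_add_comm, CharTwo.add_self_eq_zero, add_zero]
    rw [this]

/-- Weakly increasing positions of `n` cuts of the segment `[0, L]`. -/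
def IsCut (L : ℤ) {n : ℕ} (t : Fin n → ℤ) : Prop :=
  Monotone t ∧ ∀ i, 0 ≤ t i ∧ t i ≤ L

open Classical in
/-- The finite set of all positions of `n` cuts of the segment `[0, L]`. -/
noncomputable def cuts (L : ℤ) (n : ℕ) : Finset (Fin n → ℤ) :=
  (Fintype.piFinset fun _ => Finset.Icc 0 L).filter (IsCut L)

lemma mem_cuts {L : ℤ} {n : ℕ} {t : Fin n → ℤ} : t ∈ cuts L n ↔ IsCut L t := by
  simp only [cuts, Finset.mem_filter, Fintype.mem_piFinset, Finset.mem_Icc]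
  exact ⟨fun h => h.2, fun h => ⟨h.2, h⟩⟩

lemma isCut_add_single {L : ℤ} {n : ℕ} {t : Fin n → ℤ} {i j : Fin n} (ht : IsCut L t)
    (h : IsCut L (t + Pi.single i 1 + Pi.single j 1)) (hij : t i ≠ t j) :
    IsCut L (t + Pi.single i 1) := by
  have hv : ∀ k, (t + Pi.single i 1 : Fin n → ℤ) k = t k + if k = i then 1 else 0 := fun k => by
    simp [Pi.single_apply]
  have hw : ∀ k, (t + Pi.single i 1 + Pi.single j 1 : Fin n → ℤ) k
      = t k + (if k = i then 1 else 0) + if k = j then 1 else 0 := fun k => by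
    simp [Pi.single_apply]
  refine ⟨fun a b hab => ?_, fun a => ?_⟩
  · have h1 := ht.1 hab
    have h2 := h.1 hab
    rw [hw, hw] at h2
    rw [hv, hv]
    by_cases hai : a = i
    · subst hai
      by_cases hbj : b = j
      · subst hbj
        split_ifs <;> omega
      · split_ifs at h2 ⊢ <;> omega
    · split_ifs <;> omega
  · have h1 := ht.2 a
    have h2 := h.2 a
    rw [hw] at h2
    rw [hv]
    split_ifs at h2 ⊢ <;> omega

lemma truncShift_comm {L : ℤ} {n : ℕ} (s : (Fin n → ℤ) → ZMod 2)
    (hs : ∀ t i j, i ≠ j → t i = t j → s (t + Pi.single i 1 + Pi.single j 1) = s t)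
    (i j : Fin n) :
    LinearMap.mulLeft (ZMod 2) s * (truncShift (IsCut L) i * truncShift (IsCut L) j
        + truncShift (IsCut L) j * truncShift (IsCut L) i)
      + (truncShift (IsCut L) i * truncShift (IsCut L) j
        + truncShift (IsCut L) j * truncShift (IsCut L) i) * LinearMap.mulLeft (ZMod 2) s = 0 := by
  refine LinearMap.ext fun f => funext fun t => ?_
  simp only [Module.End.mul_apply, LinearMap.add_apply, Pi.add_apply, LinearMap.mulLeft_apply,
    Pi.mul_apply, LinearMap.zero_apply, Pi.zero_apply, truncShift, LinearMap.coe_mk, AddHom.coe_mk]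
  by_cases hij : i = j
  · subst hij
    split_ifs <;> simp [CharTwo.add_self_eq_zero]
  rw [add_right_comm t (Pi.single j 1)]
  by_cases ht : IsCut L t
  swap
  · simp [ht]
  by_cases h : IsCut L (t + Pi.single i 1 + Pi.single j 1)
  swap
  · simp [h]
  by_cases htij : t i = t j
  · simp only [hs t i j hij htij]
    split_ifs <;> simp [CharTwo.add_self_eq_zero]
  · have hi := isCut_add_single ht h htij
    have hj := isCut_add_single ht (add_right_comm t _ _ ▸ h) (Ne.symm htij)
    simp [ht, h, hi, hj, CharTwo.add_self_eq_zero]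

lemma isCut_add_one_iff {L : ℤ} {n : ℕ} {t : Fin (n + 1) → ℤ} {i : Fin (n + 1)} (ht : IsCut L t)
    (h : IsCut L (t + fun k => if k ∈ Finset.univ.erase i then 1 else 0)) :
    IsCut L ((t + fun k => if k ∈ Finset.univ.erase i then 1 else 0) + Pi.single i 1) ↔
      ¬ (i = Fin.last n ∧ t (Fin.last n) = L) := by
  have hv : (t + fun k => if k ∈ Finset.univ.erase i then 1 else 0) + Pi.single i 1
      = fun k => t k + 1 := by
    ext k
    by_cases hk : k = i
    · subst hk; simp
    · simp [hk]
  rw [hv]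
  constructor
  · rintro h1 ⟨rfl, hL⟩
    have := (h1.2 (Fin.last n)).2
    simp only [hL] at this
    omega
  · refine fun h1 => ⟨fun a b hab => by simpa using ht.1 hab, fun a => ?_⟩
    change 0 ≤ t a + 1 ∧ t a + 1 ≤ L
    have ha := (ht.2 a).1
    have hlast := (h.2 (Fin.last n)).2
    have hmono := ht.1 (Fin.le_last a)
    have hlast' := (ht.2 (Fin.last n)).2
    by_cases hi : i = Fin.last n
    · have : t (Fin.last n) ≠ L := fun hL => h1 ⟨hi, hL⟩
      omega
    · have : Fin.last n ≠ i := fun e => hi e.symm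
      simp only [Pi.add_apply, Finset.mem_erase, this, ne_eq, not_false_eq_true,
        Finset.mem_univ, and_self, if_true] at hlast
      omega

lemma isCut_sub_single_iff {L : ℤ} {n : ℕ} {t : Fin (n + 1) → ℤ} {i : Fin (n + 1)} (ht : IsCut L t)
    (h : IsCut L (t + fun k => if k ∈ Finset.univ.erase i then 1 else 0)) :
    IsCut L (t - Pi.single i 1) ↔ ¬ (i = 0 ∧ t 0 = 0) := by
  have hv : ∀ k, (t - Pi.single i 1 : Fin (n + 1) → ℤ) k = t k - if k = i then 1 else 0 :=
    fun k => by simp [Pi.single_apply]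
  have hw : ∀ k, (t + fun k => if k ∈ Finset.univ.erase i then (1 : ℤ) else 0) k
      = t k + if k = i then 0 else 1 := fun k => by
    by_cases hk : k = i <;> simp [hk]
  constructor
  · rintro h1 ⟨rfl, h0⟩
    have := (h1.2 0).1
    rw [hv] at this
    simp [h0] at this
  · refine fun h1 => ⟨fun a b hab => ?_, fun a => ?_⟩
    · have h2 := h.1 hab
      have h3 := ht.1 hab
      rw [hw, hw] at h2
      rw [hv, hv]
      by_cases hai : a = i
      · split_ifs <;> omega
      · by_cases hbi : b = i
        · simp only [hai, hbi, if_true, if_false] at h2 ⊢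
          subst hbi
          omega
        · simp only [hai, hbi, if_false]
          omega
    · have h2 := ht.2 a
      have h3 := ht.2 0
      have h4 := h.1 (Fin.zero_le i)
      rw [hw, hw] at h4
      rw [hv]
      by_cases hai : a = i
      · subst hai
        by_cases ha0 : a = 0
        · subst ha0
          have : t 0 ≠ 0 := fun e => h1 ⟨rfl, e⟩
          simp only [if_true]
          omega
        · simp only [if_true, Ne.symm ha0, if_false] at h4 ⊢
          omega
      · simp only [hai, if_false]
        omega

lemma sum_cuts_shift {L : ℤ} {n : ℕ} (i : Fin n) (c : (Fin n → ℤ) → ZMod 2) :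
    ∑ t ∈ cuts L n, truncShift (IsCut L) i c t
      = ∑ t ∈ cuts L n, open Classical in if IsCut L (t - Pi.single i 1) then c t else 0 := by
  classical
  simp only [truncShift, LinearMap.coe_mk, AddHom.coe_mk]
  rw [← Finset.sum_filter, ← Finset.sum_filter]
  refine Finset.sum_nbij' (· + Pi.single i 1) (· - Pi.single i 1) ?_ ?_ ?_ ?_ ?_
  · intro t
    simp only [Finset.mem_filter, mem_cuts, add_sub_cancel_right]
    tauto
  · intro t
    simp only [Finset.mem_filter, mem_cuts, sub_add_cancel]
    tauto
  · simp
  · simp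
  · simp

lemma sum_pathSum_cons {L : ℤ} {n : ℕ} (s : (Fin (n + 1) → ℤ) → ZMod 2)
    (ss : List ((Fin (n + 1) → ℤ) → ZMod 2))
    (hs : ∀ s ∈ ss, ∀ t i j, i ≠ j → t i = t j → s (t + Pi.single i 1 + Pi.single j 1) = s t) :
    ∑ t ∈ cuts L (n + 1), pathSum (IsCut L) (s :: ss) Finset.univ t
      = ∑ t ∈ cuts L (n + 1),
        ((if t (Fin.last n) = L then
            s t * pathSum (IsCut L) ss (Finset.univ.erase (Fin.last n)) t else 0)
          + if t 0 = 0 then s t * pathSum (IsCut L) ss (Finset.univ.erase 0) t else 0) := by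
  classical
  have h1 : ∀ t, pathSum (IsCut L) (s :: ss) Finset.univ t
      = ∑ i, (s t * pathSum (IsCut L) ss (Finset.univ.erase i) t
            * truncShift (IsCut L) i 1 (t + fun k => if k ∈ Finset.univ.erase i then 1 else 0)
          + truncShift (IsCut L) i (s * pathSum (IsCut L) ss (Finset.univ.erase i)) t) := by
    intro t
    have h := commutatorSum_apply (IsCut L) (s :: ss) Finset.univ 1 t
    rw [Pi.one_apply, mul_one] at h
    rw [← h, List.map_cons, sum_commutator_mul_commutatorSum, LinearMap.sum_apply,
      Finset.sum_apply]
    · refine Finset.sum_congr rfl fun i _ => ?_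
      simp only [Module.End.mul_apply, LinearMap.add_apply, Pi.add_apply, LinearMap.mulLeft_apply,
        Pi.mul_apply, commutatorSum_apply]
      congr 1
      · ring
      · refine congrFun (congrArg _ (funext fun t' => ?_)) t
        simp [commutatorSum_apply]
    · intro x
      exact LinearMap.ext fun f => funext fun t => CharTwo.add_self_eq_zero _
    · intro s' hs' i j
      obtain ⟨s', hs'', rfl⟩ := List.mem_map.1 hs'
      exact truncShift_comm s' (hs s' hs'') i j
  have h2 : ∀ i, ∑ t ∈ cuts L (n + 1), (s t * pathSum (IsCut L) ss (Finset.univ.erase i) t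
            * truncShift (IsCut L) i 1 (t + fun k => if k ∈ Finset.univ.erase i then 1 else 0)
          + truncShift (IsCut L) i (s * pathSum (IsCut L) ss (Finset.univ.erase i)) t)
      = ∑ t ∈ cuts L (n + 1), ((if i = Fin.last n ∧ t (Fin.last n) = L then
            s t * pathSum (IsCut L) ss (Finset.univ.erase i) t else 0)
          + if i = 0 ∧ t 0 = 0 then s t * pathSum (IsCut L) ss (Finset.univ.erase i) t else 0) := by
    intro i
    rw [Finset.sum_add_distrib, sum_cuts_shift, ← Finset.sum_add_distrib]
    refine Finset.sum_congr rfl fun t ht => ?_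
    rw [mem_cuts] at ht
    rw [Pi.mul_apply]
    by_cases h0 : pathSum (IsCut L) ss (Finset.univ.erase i) t = 0
    · simp [h0]
    have hend := (pathSum_ne_zero _ _ _ _ ht h0).1
    generalize s t * pathSum (IsCut L) ss (Finset.univ.erase i) t = c
    simp only [truncShift, LinearMap.coe_mk, AddHom.coe_mk, hend, true_and,
      isCut_add_one_iff ht hend, isCut_sub_single_iff ht hend, Pi.one_apply]
    have hc := CharTwo.add_self_eq_zero c
    split_ifs <;> first | contradiction | simp [hc]
  rw [Finset.sum_congr rfl fun t _ => h1 t, Finset.sum_comm, Finset.sum_congr rfl fun i _ => h2 i,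
    Finset.sum_comm]
  refine Finset.sum_congr rfl fun t _ => ?_
  rw [Finset.sum_add_distrib]
  congr 1
  · rw [Finset.sum_eq_single (Fin.last n)] <;> simp +contextual
  · rw [Finset.sum_eq_single 0] <;> simp +contextual

lemma isCut_cons_zero {L : ℤ} (hL : 0 ≤ L) {n : ℕ} (t : Fin n → ℤ) :
    IsCut L (Fin.cons 0 t : Fin (n + 1) → ℤ) ↔ IsCut L t := by
  constructor
  · refine fun h => ⟨fun a b hab => ?_, fun a => ?_⟩
    · simpa using h.1 (Fin.succ_le_succ_iff.2 hab)
    · simpa using h.2 a.succ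
  · refine fun h => ⟨fun a b => ?_, fun a => ?_⟩
    · refine Fin.cases ?_ (fun a => ?_) a <;> refine Fin.cases ?_ (fun b => ?_) b
      · simp
      · simp [(h.2 b).1]
      · simp
      · simpa using fun hab => h.1 hab
    · refine Fin.cases ?_ (fun a => ?_) a
      · simpa using hL
      · simpa using h.2 a

lemma isCut_snoc {L : ℤ} (hL : 0 ≤ L) {n : ℕ} (t : Fin n → ℤ) :
    IsCut L (Fin.snoc t L : Fin (n + 1) → ℤ) ↔ IsCut L t := by
  constructor
  · refine fun h => ⟨fun a b hab => ?_, fun a => ?_⟩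
    · simpa using h.1 (Fin.castSucc_le_castSucc_iff.2 hab)
    · simpa using h.2 a.castSucc
  · refine fun h => ⟨fun a b => ?_, fun a => ?_⟩
    · refine Fin.lastCases ?_ (fun a => ?_) a <;> refine Fin.lastCases ?_ (fun b => ?_) b
      · simp
      · simp [Fin.last_le_iff, (Fin.castSucc_lt_last b).ne]
      · simp [(h.2 a).2]
      · simpa using fun hab => h.1 hab
    · refine Fin.lastCases ?_ (fun a => ?_) a
      · simpa using hL
      · simpa using h.2 a

/-- The two-colouring of points at the positions `pos`, whose colour changes at each cut. -/
def cutColor {β : Type*} (pos : β → ℤ) {n : ℕ} (t : Fin n → ℤ) (p : β) : ZMod 2 :=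
  ∑ i, if t i ≤ pos p then 1 else 0

lemma cutColor_cons_zero {β : Type*} {pos : β → ℤ} (h : ∀ p, 0 ≤ pos p) {n : ℕ} (t : Fin n → ℤ) :
    cutColor pos (Fin.cons 0 t : Fin (n + 1) → ℤ) = cutColor pos t + 1 := by
  ext p
  rw [cutColor, Fin.sum_univ_succ]
  simp [cutColor, h, add_comm]

lemma cutColor_snoc {β : Type*} {pos : β → ℤ} {L : ℤ} (h : ∀ p, pos p < L) {n : ℕ}
    (t : Fin n → ℤ) :
    cutColor pos (Fin.snoc t L : Fin (n + 1) → ℤ) = cutColor pos t := by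
  ext p
  rw [cutColor, Fin.sum_univ_castSucc]
  simp [cutColor, h]

lemma cutColor_add_single_add_single {β : Type*} (pos : β → ℤ) {n : ℕ} (t : Fin n → ℤ)
    {i j : Fin n} (hij : i ≠ j) (h : t i = t j) :
    cutColor pos (t + Pi.single i 1 + Pi.single j 1) = cutColor pos t := by
  ext p
  simp only [cutColor]
  rw [← sub_eq_zero, ← Finset.sum_sub_distrib, ← Finset.add_sum_erase _ _ (Finset.mem_univ i),
    ← Finset.add_sum_erase _ _ (Finset.mem_erase.2 ⟨hij.symm, Finset.mem_univ j⟩),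
    Finset.sum_eq_zero, add_zero]
  · simp only [Pi.add_apply, Pi.single_eq_same, Pi.single_eq_of_ne hij, Pi.single_eq_of_ne hij.symm,
      h, add_zero]
    exact CharTwo.add_self_eq_zero _
  · intro k hk
    simp only [Finset.mem_erase, Finset.mem_univ, and_true] at hk
    simp [Pi.single_eq_of_ne hk.1, Pi.single_eq_of_ne hk.2]

lemma sum_pathSum_cutColor {β : Type*} {pos : β → ℤ} {L : ℤ} (hL : 0 ≤ L) (h0 : ∀ p, 0 ≤ pos p)
    (h1 : ∀ p, pos p < L) (Ss : List ((β → ZMod 2) → ZMod 2))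
    (hS : ∀ S ∈ Ss, ∀ x, S (x + 1) = S x + 1) :
    ∑ t ∈ cuts L Ss.length,
      pathSum (IsCut L) (Ss.map fun S t => S (cutColor pos t)) Finset.univ t = 1 := by
  induction Ss with
  | nil =>
    have : cuts L 0 = Finset.univ := by
      ext t
      simpa only [mem_cuts, IsCut, Finset.mem_univ, iff_true] using
        ⟨Subsingleton.monotone t, finZeroElim⟩
    simp [this, pathSum]
  | cons S Ss ih =>
    have ih := ih fun S' hS' => hS S' (List.mem_cons_of_mem _ hS')
    rw [List.map_cons, List.length_cons, sum_pathSum_cons, Finset.sum_add_distrib,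
      ← Finset.sum_filter, ← Finset.sum_filter]
    · have hlast : ∑ t ∈ cuts L (Ss.length + 1) with t (Fin.last _) = L, S (cutColor pos t)
            * pathSum (IsCut L) (Ss.map fun S t => S (cutColor pos t))
              (Finset.univ.erase (Fin.last _)) t
          = ∑ t ∈ cuts L Ss.length, S (cutColor pos t)
            * pathSum (IsCut L) (Ss.map fun S t => S (cutColor pos t)) Finset.univ t := by
        symm
        refine Finset.sum_nbij' (fun t => Fin.snoc t L) Fin.init ?_ ?_ ?_ ?_ ?_
        · intro t
          simp [mem_cuts, isCut_snoc hL]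
        · intro t
          simp only [Finset.mem_filter, mem_cuts]
          rintro ⟨ht, hl⟩
          rw [← isCut_snoc hL, ← hl, Fin.snoc_init_self]
          exact hl.symm ▸ ht
        · simp
        · intro t
          simp only [Finset.mem_filter]
          rintro ⟨-, hl⟩
          rw [← hl, Fin.snoc_init_self]
        · intro t _
          have he : Finset.univ.erase (Fin.last Ss.length)
              = Finset.univ.map Fin.castSuccEmb := by
            ext k
            refine Fin.lastCases ?_ (fun k => ?_) k <;> simp [(Fin.castSucc_lt_last _).ne]
          rw [cutColor_snoc h1, he, pathSum_map (IsCut L) (IsCut L) Fin.castSuccEmb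
            (fun t => (Fin.snoc t L : Fin (Ss.length + 1) → ℤ)) (isCut_snoc hL)]
          · rw [List.map_map]
            congr! 3
            ext S' t'
            simp [cutColor_snoc h1]
          · intro t i
            ext k
            refine Fin.lastCases ?_ (fun k => ?_) k <;> simp [Pi.single_apply]
      have hzero : ∑ t ∈ cuts L (Ss.length + 1) with t 0 = 0, S (cutColor pos t)
            * pathSum (IsCut L) (Ss.map fun S t => S (cutColor pos t)) (Finset.univ.erase 0) t
          = ∑ t ∈ cuts L Ss.length, (S (cutColor pos t) + 1)
            * pathSum (IsCut L) (Ss.map fun S t => S (cutColor pos t)) Finset.univ t := by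
        symm
        refine Finset.sum_nbij' (fun t => Fin.cons 0 t) Fin.tail ?_ ?_ ?_ ?_ ?_
        · intro t
          simp [mem_cuts, isCut_cons_zero hL]
        · intro t
          simp only [Finset.mem_filter, mem_cuts]
          rintro ⟨ht, hl⟩
          rw [← isCut_cons_zero hL, ← hl, Fin.cons_self_tail]
          exact ht
        · simp
        · intro t
          simp only [Finset.mem_filter]
          rintro ⟨-, hl⟩
          rw [← hl, Fin.cons_self_tail]
        · intro t _
          have he : Finset.univ.erase (0 : Fin (Ss.length + 1))
              = Finset.univ.map (Fin.succEmb _) := by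
            ext k
            refine Fin.cases ?_ (fun k => ?_) k <;> simp
          rw [cutColor_cons_zero h0, hS S (by simp), he, pathSum_map (IsCut L) (IsCut L)
            (Fin.succEmb _) (fun t => (Fin.cons 0 t : Fin (Ss.length + 1) → ℤ))
            (isCut_cons_zero hL), ← pathSum_map_add_one, List.map_map, List.map_map]
          · congr 2
            refine List.map_congr_left fun S' hS' => ?_
            ext t'
            simp [cutColor_cons_zero h0, hS S' (List.mem_cons_of_mem _ hS')]
          · intro t i
            ext k
            refine Fin.cases ?_ (fun k => ?_) k <;> simp [Pi.single_apply]
      rw [hlast, hzero, ← Finset.sum_add_distrib]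
      refine (Finset.sum_congr rfl fun t _ => ?_).trans ih
      rw [← add_mul, ← add_assoc, CharTwo.add_self_eq_zero, zero_add, one_mul]
    · intro s hs t i j hij htij
      obtain ⟨S', -, rfl⟩ := List.mem_map.1 hs
      simp only [cutColor_add_single_add_single pos t hij htij]

/-- A discrete Borsuk–Ulam theorem for the colourings given by `n` cuts. -/
theorem exists_cut_sign_changes {β : Type*} {pos : β → ℤ} {L : ℤ} (hL : 0 ≤ L)
    (h0 : ∀ p, 0 ≤ pos p) (h1 : ∀ p, pos p < L) {n : ℕ} (S : Fin n → (β → ZMod 2) → ZMod 2)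
    (hS : ∀ i x, S i (x + 1) = S i x + 1) :
    ∃ t : Fin n → ℤ, ∀ i, ∃ u u' : Fin n → ℤ, S i (cutColor pos u) ≠ S i (cutColor pos u') ∧
      ∀ k, t k ≤ u k ∧ u k ≤ t k + 1 ∧ t k ≤ u' k ∧ u' k ≤ t k + 1 := by
  have h := sum_pathSum_cutColor hL h0 h1 (List.ofFn S) (by
    intro S' hS'
    obtain ⟨i, rfl⟩ := (List.mem_ofFn' _ _).1 hS'
    exact hS i)
  obtain ⟨t, ht, hne⟩ := Finset.exists_ne_zero_of_sum_ne_zero (h ▸ one_ne_zero)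
  have h2 := (pathSum_ne_zero _ _ _ _ (mem_cuts.1 ht) hne).2
  have hlen : (List.ofFn S).length = n := List.length_ofFn
  revert t
  rw [hlen]
  intro t ht hne h2
  refine ⟨t, fun i => ?_⟩
  obtain ⟨u, u', -, -, hu, hk⟩ := h2 (fun t => S i (cutColor pos t))
    (List.mem_map.2 ⟨S i, (List.mem_ofFn' _ _).2 ⟨i, rfl⟩, rfl⟩)
  exact ⟨u, u', hu, fun k => by simpa using hk k⟩

open scoped BigOperators in
lemma expect_exp_sub_expect_le {ι : Type*} [Fintype ι] [Nonempty ι] (X : ι → ℝ) {c : ℝ}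
    (hc : c ≤ 1) (hX : ∀ a b, |X a - X b| ≤ c) :
    𝔼 a, Real.exp (X a - 𝔼 b, X b) ≤ Real.exp (c ^ 2) := by
  set μ := 𝔼 b, X b with hμ
  have hdev : ∀ a, |X a - μ| ≤ c := by
    intro a
    have : X a - μ = 𝔼 b, (X a - X b) := by
      rw [Finset.expect_sub_distrib, Fintype.expect_const]
    rw [this]
    refine (Finset.abs_expect_le _ _).trans ?_
    exact Finset.expect_le Finset.univ_nonempty fun b _ => hX a b
  have hle : ∀ a, Real.exp (X a - μ) ≤ 1 + (X a - μ) + c ^ 2 := by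
    intro a
    have h1 := Real.abs_exp_sub_one_sub_id_le ((hdev a).trans hc)
    have h2 := (abs_le.1 h1).2
    have h3 : (X a - μ) ^ 2 ≤ c ^ 2 := by
      rw [← sq_abs]
      exact pow_le_pow_left₀ (abs_nonneg _) (hdev a) 2
    linarith
  calc 𝔼 a, Real.exp (X a - μ) ≤ 𝔼 a, (1 + (X a - μ) + c ^ 2) :=
        Finset.expect_le_expect fun a _ => hle a
    _ = c ^ 2 + 1 := by
        rw [Finset.expect_add_distrib, Finset.expect_add_distrib, Finset.expect_sub_distrib,
          Fintype.expect_const, Fintype.expect_const, Fintype.expect_const]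
        ring
    _ ≤ _ := Real.add_one_le_exp _

open scoped BigOperators in
lemma expect_fin_cons {κ : Type*} [Fintype κ] {m : ℕ} (g : (Fin (m + 1) → κ) → ℝ) :
    𝔼 r, g r = 𝔼 a, 𝔼 r : Fin m → κ, g (Fin.cons a r) := by
  rw [← Fintype.expect_equiv (Fin.consEquiv fun _ : Fin (m + 1) => κ)
    (fun p => g (Fin.cons p.1 p.2)) g fun _ => rfl, ← Finset.univ_product_univ,
    Finset.expect_product]

open scoped BigOperators in
/-- The **McDiarmid inequality**, for uniform coordinates and in exponential form. -/
lemma expect_exp_sub_expect_le_of_bounded_differences {κ : Type*} [Fintype κ] [Nonempty κ] {m : ℕ}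
    (g : (Fin m → κ) → ℝ) (c : Fin m → ℝ) (hc : ∀ j, c j ≤ 1)
    (hg : ∀ r j a, |g (Function.update r j a) - g r| ≤ c j) :
    𝔼 r, Real.exp (g r - 𝔼 r', g r') ≤ Real.exp (∑ j, c j ^ 2) := by
  induction m with
  | zero => simp
  | succ m ih =>
    have htail : ∀ a, 𝔼 r : Fin m → κ, Real.exp (g (Fin.cons a r) - 𝔼 r', g (Fin.cons a r'))
        ≤ Real.exp (∑ j : Fin m, c j.succ ^ 2) := fun a =>
      ih (fun r => g (Fin.cons a r)) (fun j => c j.succ) (fun j => hc _) fun r j b => by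
        rw [Fin.cons_update]
        exact hg _ _ _
    have hhead := expect_exp_sub_expect_le (fun a => 𝔼 r : Fin m → κ, g (Fin.cons a r)) (hc 0)
      (by
        intro a b
        rw [← Finset.expect_sub_distrib]
        refine (Finset.abs_expect_le _ _).trans ?_
        refine Finset.expect_le Finset.univ_nonempty fun r _ => ?_
        have := hg (Fin.cons b r) 0 a
        rwa [Fin.update_cons_zero] at this)
    rw [expect_fin_cons, expect_fin_cons (fun r => g r), Fin.sum_univ_succ, Real.exp_add]
    refine le_trans ?_ (mul_le_mul_of_nonneg_right hhead (Real.exp_pos _).le)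
    rw [Finset.expect_mul]
    refine Finset.expect_le_expect fun a _ => ?_
    refine le_trans (le_of_eq ?_) (mul_le_mul_of_nonneg_left (htail a) (Real.exp_pos _).le)
    rw [Finset.mul_expect]
    refine Finset.expect_congr rfl fun r _ => ?_
    rw [← Real.exp_add]
    congr 1
    ring

open scoped BigOperators in
lemma exists_forall_abs_sub_expect_le {κ : Type*} [Fintype κ] [Nonempty κ] {m n : ℕ} (hn : 2 ≤ n)
    (g : Fin n → (Fin m → κ) → ℝ) (J : Finset (Fin m)) (hJ : J.card ≤ n)
    (hg : ∀ i r j a, |g i (Function.update r j a) - g i r| ≤ if j ∈ J then 2 else 0) :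
    ∃ r, ∀ i, |g i r - 𝔼 r', g i r'| ≤ 4 * √(n * Real.log (2 * n)) := by
  have hn' : (2 : ℝ) ≤ n := by exact_mod_cast hn
  set A := Real.log (2 * n) with hA
  have hA0 : 0 < A := Real.log_pos (by linarith)
  have hAn : A ≤ n := by
    rw [hA, Real.log_mul (by norm_num) (by linarith)]
    have h1 := Real.log_two_lt_d9
    have h2 := Real.log_le_sub_one_of_pos (x := (n : ℝ)) (by linarith)
    linarith
  have hexpA : Real.exp A = 2 * n := Real.exp_log (by linarith)
  set lam := √(A / n) / 2 with hlam
  have hlam0 : 0 < lam := by positivity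
  have hlamsq : n * (lam * 2) ^ 2 = A := by
    rw [hlam, div_mul_cancel₀ _ two_ne_zero, Real.sq_sqrt (by positivity)]
    field_simp
  have hlam1 : lam * 2 ≤ 1 := by
    rw [hlam, div_mul_cancel₀ _ two_ne_zero, Real.sqrt_le_one, div_le_one (by linarith)]
    exact hAn
  have hmain : ∀ i, ∀ ε : ℝ, |ε| = lam →
      𝔼 r, Real.exp (ε * (g i r - 𝔼 r', g i r')) ≤ 2 * n := by
    intro i ε hε
    have h := expect_exp_sub_expect_le_of_bounded_differences (fun r => ε * g i r)
      (fun j => if j ∈ J then lam * 2 else 0) (fun j => by split_ifs <;> linarith) (by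
        intro r j a
        rw [← mul_sub, abs_mul, hε]
        have := mul_le_mul_of_nonneg_left (hg i r j a) hlam0.le
        split_ifs at this ⊢ <;> simpa using this)
    simp only [← Finset.mul_expect, ← mul_sub] at h
    refine h.trans ?_
    rw [← hexpA, Real.exp_le_exp, ← hlamsq]
    simp only [ite_pow, ne_eq, OfNat.ofNat_ne_zero, not_false_eq_true, zero_pow,
      Finset.sum_ite_mem, Finset.univ_inter, Finset.sum_const, nsmul_eq_mul]
    gcongr
  obtain ⟨r, hr⟩ : ∃ r, ∑ i, (Real.exp (lam * (g i r - 𝔼 r', g i r'))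
      + Real.exp (-lam * (g i r - 𝔼 r', g i r'))) ≤ 4 * n ^ 2 := by
    have h1 : 𝔼 r, ∑ i, (Real.exp (lam * (g i r - 𝔼 r', g i r'))
        + Real.exp (-lam * (g i r - 𝔼 r', g i r'))) ≤ 4 * n ^ 2 := by
      rw [Finset.expect_sum_comm]
      refine (Finset.sum_le_sum fun i _ => ?_).trans_eq (b := ∑ _i : Fin n, 4 * (n : ℝ)) ?_
      · rw [Finset.expect_add_distrib]
        have e1 := hmain i lam (abs_of_pos hlam0)
        have e2 := hmain i (-lam) (by rw [abs_neg, abs_of_pos hlam0])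
        linarith
      · simp only [Finset.sum_const, Finset.card_univ, Fintype.card_fin, nsmul_eq_mul]
        ring
    obtain ⟨r, -, hr⟩ := Finset.exists_le_of_expect_le Finset.univ_nonempty h1
    exact ⟨r, hr⟩
  refine ⟨r, fun i => ?_⟩
  have hi := (Finset.single_le_sum (f := fun i => Real.exp (lam * (g i r - 𝔼 r', g i r'))
      + Real.exp (-lam * (g i r - 𝔼 r', g i r'))) (fun i _ => by positivity)
      (Finset.mem_univ i)).trans hr
  have h4 : 4 * (n : ℝ) ^ 2 = Real.exp (2 * A) := by
    rw [two_mul, Real.exp_add, hexpA]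
    ring
  have h5 : lam * (4 * √(n * A)) = 2 * A := by
    have : √(A / n) * √(n * A) = A := by
      rw [← Real.sqrt_mul (by positivity)]
      have : A / n * (n * A) = A ^ 2 := by field_simp
      rw [this, Real.sqrt_sq hA0.le]
    rw [hlam]
    linarith
  rw [h4] at hi
  have hp := Real.exp_pos (lam * (g i r - 𝔼 r', g i r'))
  have hq := Real.exp_pos (-lam * (g i r - 𝔼 r', g i r'))
  have h6 := Real.exp_le_exp.1 ((le_add_of_nonneg_right hq.le).trans hi)
  have h7 := Real.exp_le_exp.1 ((le_add_of_nonneg_left hp.le).trans hi)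
  rw [← h5] at h6 h7
  rw [neg_mul, ← mul_neg] at h7
  exact abs_le'.2 ⟨le_of_mul_le_mul_left h6 hlam0, le_of_mul_le_mul_left h7 hlam0⟩

lemma cutColor_eq_of_not_mem_range {β : Type*} {pos : β → ℤ} {n : ℕ} {t u : Fin n → ℤ}
    (hu : ∀ k, t k ≤ u k ∧ u k ≤ t k + 1) {p : β} (hp : ∀ k, t k ≠ pos p) :
    cutColor pos u p = cutColor pos t p := by
  refine Finset.sum_congr rfl fun k _ => if_congr ?_ rfl rfl
  have := hu k
  have := hp k
  omega

lemma card_cutColor_ne_le {β : Type*} [Fintype β] {pos : β → ℤ} (hpos : Function.Injective pos)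
    {n : ℕ} {t u u' : Fin n → ℤ} (hu : ∀ k, t k ≤ u k ∧ u k ≤ t k + 1)
    (hu' : ∀ k, t k ≤ u' k ∧ u' k ≤ t k + 1) :
    (Finset.univ.filter fun p => cutColor pos u p ≠ cutColor pos u' p).card ≤ n := by
  rw [← Finset.card_image_of_injective _ hpos]
  calc _ ≤ (Finset.univ.image t).card := Finset.card_le_card fun x hx => by
        obtain ⟨p, hp, rfl⟩ := Finset.mem_image.1 hx
        by_contra hcon
        have hp' : ∀ k, t k ≠ pos p := fun k hk => hcon (Finset.mem_image.2 ⟨k, by simp, hk⟩)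
        refine (Finset.mem_filter.1 hp).2 ?_
        rw [cutColor_eq_of_not_mem_range hu hp', cutColor_eq_of_not_mem_range hu' hp']
    _ ≤ _ := Finset.card_image_le.trans_eq (by simp)

lemma card_nonconstant_cutColor_le {m n N : ℕ} (t : Fin n → ℤ) :
    (Finset.univ.filter fun a : Fin m => ∃ c c' : Fin N,
      cutColor (fun p : Fin m × Fin N => (p.1 * N + p.2 : ℤ)) t (a, c)
        ≠ cutColor (fun p : Fin m × Fin N => (p.1 * N + p.2 : ℤ)) t (a, c')).card ≤ n := by
  have hinj : Function.Injective fun a : Fin m => (a : ℤ) := fun a b h => by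
    simpa [Fin.ext_iff] using h
  rw [← Finset.card_image_of_injective _ hinj]
  calc _ ≤ (Finset.univ.image fun k => t k / N).card := Finset.card_le_card fun x hx => by
        obtain ⟨a, ha, rfl⟩ := Finset.mem_image.1 hx
        obtain ⟨c, c', hne⟩ := (Finset.mem_filter.1 ha).2
        by_contra hcon
        refine hne (Finset.sum_congr rfl fun k _ => if_congr ?_ rfl rfl)
        have hk : t k / N ≠ a := fun hk => hcon (Finset.mem_image.2 ⟨k, by simp, hk⟩)
        have hN : (0 : ℤ) < N := by exact_mod_cast c.pos
        have h1 := c.2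
        have h2 := c'.2
        rcases lt_or_gt_of_ne hk with hk | hk
        · have h3 : t k < a * N := (Int.ediv_lt_iff_lt_mul hN).1 hk
          simp only
          constructor <;> intro <;> omega
        · have h3 : (a + 1) * N ≤ t k := (Int.le_ediv_iff_mul_le hN).1 hk
          rw [add_mul, one_mul] at h3
          simp only
          constructor <;> intro <;> omega
    _ ≤ _ := Finset.card_image_le.trans_eq (by simp)

lemma abs_sub_le_of_update {ι κ : Type*} [Fintype ι] [DecidableEq ι] [DecidableEq κ]
    {G : (ι → κ) → ℝ} {c : ℝ}
    (hG : ∀ x j b, |G (Function.update x j b) - G x| ≤ c) (x y : ι → κ) :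
    |G x - G y| ≤ ∑ a, if x a ≠ y a then c else 0 := by
  have key : ∀ I : Finset ι, |G (fun a => if a ∈ I then x a else y a) - G y|
      ≤ ∑ a ∈ I, if x a ≠ y a then c else 0 := by
    intro I
    induction I using Finset.induction_on with
    | empty => simp
    | insert b I hb ih =>
      rw [Finset.sum_insert hb]
      refine (abs_sub_le _ (G fun a => if a ∈ I then x a else y a) _).trans (add_le_add ?_ ih)
      have hup : (fun a => if a ∈ insert b I then x a else y a)
          = Function.update (fun a => if a ∈ I then x a else y a) b (x b) := by
        ext a
        by_cases hab : a = b
        · subst hab; simp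
        · simp [hab]
      rw [hup]
      split_ifs with hxy
      · exact hG _ _ _
      · rw [not_not.1 hxy, Function.update_eq_self_iff.2 (by simp [hb]), sub_self, abs_zero]
  simpa using key Finset.univ

open scoped BigOperators in
lemma expect_apply_coord {ι κ : Type*} [Fintype ι] [DecidableEq ι] [Fintype κ] [Nonempty κ]
    (h : κ → ℝ) (a : ι) : 𝔼 r : ι → κ, h (r a) = 𝔼 c, h c := by
  rw [Fintype.expect_equiv (Equiv.funSplitAt a κ) (fun r => h (r a)) (fun p => h p.1) fun _ => rfl,
    ← Finset.univ_product_univ, Finset.expect_product]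
  simp

open scoped BigOperators in
lemma abs_expect_sub_expect_le {ι κ γ : Type*} [Fintype ι] [DecidableEq ι] [Fintype κ] [Nonempty κ]
    [DecidableEq γ] {G : (ι → γ) → ℝ} {c : ℝ}
    (hG : ∀ x j b, |G (Function.update x j b) - G x| ≤ c) (x y : ι × κ → γ) :
    |𝔼 r : ι → κ, G (fun a => x (a, r a)) - 𝔼 r : ι → κ, G (fun a => y (a, r a))|
      ≤ (Finset.univ.filter fun p => x p ≠ y p).card * (c / Fintype.card κ) := by
  rw [← Finset.expect_sub_distrib]
  calc _ ≤ 𝔼 r : ι → κ, ∑ a, (if x (a, r a) ≠ y (a, r a) then c else 0) :=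
        (Finset.abs_expect_le _ _).trans
          (Finset.expect_le_expect fun r _ => abs_sub_le_of_update hG _ _)
    _ = ∑ a, 𝔼 b : κ, (if x (a, b) ≠ y (a, b) then c else 0) := by
        rw [Finset.expect_sum_comm]
        exact Finset.sum_congr rfl fun a _ =>
          expect_apply_coord (fun b => if x (a, b) ≠ y (a, b) then c else 0) a
    _ = (∑ p : ι × κ, if x p ≠ y p then c else 0) / Fintype.card κ := by
        rw [Fintype.sum_prod_type, Finset.sum_div]
        exact Finset.sum_congr rfl fun a _ => Fintype.expect_eq_sum_div_card _
    _ = _ := by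
        rw [← Finset.sum_filter, Finset.sum_const, nsmul_eq_mul, mul_div_assoc]

open scoped BigOperators in
/-- Two-colour discrepancy of odd functions with bounded differences, on linearly ordered items. -/
theorem exists_forall_abs_odd_le {m n : ℕ} (hn : 2 ≤ n) (G : Fin n → (Fin m → ZMod 2) → ℝ)
    (hodd : ∀ i x, G i (x + 1) = -G i x)
    (hG : ∀ i x j b, |G i (Function.update x j b) - G i x| ≤ 2) :
    ∃ x, ∀ i, |G i x| ≤ 8 * √(n * Real.log (2 * n)) := by
  have hn' : (2 : ℝ) ≤ n := by exact_mod_cast hn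
  rcases Nat.eq_zero_or_pos m with rfl | hm
  · refine ⟨0, fun i => ?_⟩
    have h := hodd i 0
    rw [Subsingleton.elim (0 + 1 : Fin 0 → ZMod 2) 0] at h
    rw [show G i 0 = 0 by linarith, abs_zero]
    positivity
  have : Nonempty (Fin n) := ⟨⟨0, by omega⟩⟩
  let pos : Fin m × Fin n → ℤ := fun p => p.1 * n + p.2
  let F : Fin n → (Fin m × Fin n → ZMod 2) → ℝ := fun i σ =>
    𝔼 r : Fin m → Fin n, G i fun a => σ (a, r a)
  have hFodd : ∀ i σ, F i (σ + 1) = -F i σ := by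
    intro i σ
    rw [← Finset.expect_neg_distrib]
    exact Finset.expect_congr rfl fun r _ => hodd i fun a => σ (a, r a)
  have hpos : Function.Injective pos := by
    rintro ⟨a, c⟩ ⟨b, d⟩ h
    have h' : (a : ℕ) * n + c = b * n + d := by
      have : ((a * n + c : ℕ) : ℤ) = (b * n + d : ℕ) := by push_cast; exact h
      exact_mod_cast this
    have h2 : (c : ℕ) = d := by
      simpa only [Nat.mul_add_mod_of_lt c.2, Nat.mul_add_mod_of_lt d.2] using congrArg (· % n) h'
    have h3 : (a : ℕ) = b := by
      rw [h2] at h'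
      exact Nat.eq_of_mul_eq_mul_right (by omega) (Nat.add_right_cancel h')
    exact Prod.ext (Fin.ext h3) (Fin.ext h2)
  let p₀ : Fin m × Fin n := (⟨0, hm⟩, ⟨0, by omega⟩)
  -- ties are broken by the colour of a fixed point
  let S : Fin n → (Fin m × Fin n → ZMod 2) → ZMod 2 := fun i σ =>
    if 0 < F i σ then 1 else if F i σ < 0 then 0 else σ p₀
  have hS : ∀ i σ, S i (σ + 1) = S i σ + 1 := by
    intro i σ
    simp only [S, hFodd, Left.neg_pos_iff, Left.neg_neg_iff, Pi.add_apply, Pi.one_apply]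
    rcases lt_trichotomy (F i σ) 0 with h | h | h
    · simp [h, h.not_gt]
    · simp [h]
    · simp [h, h.not_gt, CharTwo.add_self_eq_zero]
  obtain ⟨t, ht⟩ := exists_cut_sign_changes (pos := pos) (L := (m : ℤ) * n) (by positivity)
    (fun p => by positivity) (fun p => by
      have h1 : (p.1 : ℕ) * n + p.2 < m * n := by
        calc (p.1 : ℕ) * n + p.2 < p.1 * n + n := by have := p.2.2; omega
          _ = (p.1 + 1) * n := by ring
          _ ≤ m * n := Nat.mul_le_mul_right _ p.1.2
      change ((p.1 : ℕ) : ℤ) * n + ((p.2 : ℕ) : ℤ) < m * n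
      exact_mod_cast h1) S hS
  have hclose : ∀ i (u u' : Fin n → ℤ), (∀ k, t k ≤ u k ∧ u k ≤ t k + 1) →
      (∀ k, t k ≤ u' k ∧ u' k ≤ t k + 1) →
      |F i (cutColor pos u) - F i (cutColor pos u')| ≤ 2 := by
    intro i u u' hu hu'
    refine (abs_expect_sub_expect_le (hG i) _ _).trans ?_
    have hcard :
        ((Finset.univ.filter fun p => cutColor pos u p ≠ cutColor pos u' p).card : ℝ) ≤ n := by
      exact_mod_cast card_cutColor_ne_le hpos hu hu'
    rw [Fintype.card_fin]
    calc _ ≤ (n : ℝ) * (2 / n) := by gcongr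
      _ = 2 := by field_simp
  have hsmall : ∀ i, |F i (cutColor pos t)| ≤ 4 := by
    intro i
    obtain ⟨u, u', hne, hk⟩ := ht i
    have h1 := hclose i u u' (fun k => ⟨(hk k).1, (hk k).2.1⟩) fun k => (hk k).2.2
    have h2 := hclose i t u (fun k => ⟨le_rfl, by omega⟩) fun k => ⟨(hk k).1, (hk k).2.1⟩
    have h3 : |F i (cutColor pos u)| ≤ 2 := by
      simp only [S] at hne
      rw [abs_le] at h1 ⊢
      split_ifs at hne <;> first | exact absurd rfl hne | constructor <;> linarith
    rw [abs_le] at h2 h3 ⊢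
    constructor <;> linarith
  obtain ⟨r, hr⟩ := exists_forall_abs_sub_expect_le hn
    (fun i (r : Fin m → Fin n) => G i fun a => cutColor pos t (a, r a)) _
    (card_nonconstant_cutColor_le (m := m) (N := n) t) (by
      intro i r j c
      have hup : (fun a => cutColor pos t (a, Function.update r j c a))
          = Function.update (fun a => cutColor pos t (a, r a)) j (cutColor pos t (j, c)) := by
        ext a
        by_cases haj : a = j
        · subst haj; simp
        · simp [haj]
      simp only [hup]
      split_ifs with hj
      · exact hG _ _ _ _
      · simp only [Finset.mem_filter, Finset.mem_univ, true_and, not_exists, not_not] at hj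
        rw [Function.update_eq_self_iff.2 (hj c (r j)), sub_self, abs_zero])
  refine ⟨fun a => cutColor pos t (a, r a), fun i => ?_⟩
  have h1 := hr i
  have h2 := hsmall i
  have h3 : 1 ≤ √(n * Real.log (2 * n)) := by
    rw [Real.one_le_sqrt]
    have h4 := Real.log_two_gt_d9
    have h5 : Real.log 2 ≤ Real.log (2 * n) := Real.log_le_log (by norm_num) (by linarith)
    nlinarith
  change |_ - F i (cutColor pos t)| ≤ _ at h1
  rw [abs_le] at h1 h2 ⊢
  constructor <;> linarith

/-- **Two-color non-additive discrepancy.**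
There is a universal constant `C > 0` such that for every finite set of items `α`
and every family of `n ≥ 2` valuation functions with marginals bounded by `1`,
there is a bipartition `M = S ∪ Sᶜ` with
`|v i S - v i Sᶜ| ≤ C * √(n * log (2 * n))` for every agent `i`. -/
theorem nonadditive_twocolor_discrepancy :
    ∃ C : ℝ, 0 < C ∧
      ∀ (n : ℕ), 2 ≤ n →
      ∀ (α : Type) [Fintype α] [DecidableEq α]
        (v : Fin n → Finset α → ℝ),
        (∀ (i : Fin n) (S : Finset α) (j : α), |v i (insert j S) - v i S| ≤ 1) →
        ∃ S : Finset α,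
          ∀ i : Fin n, |v i S - v i Sᶜ| ≤ C * Real.sqrt (n * Real.log (2 * n)) := by
  refine ⟨8, by norm_num, fun n hn α _ _ v hv => ?_⟩
  let e := Fintype.equivFin α
  let T : (Fin (Fintype.card α) → ZMod 2) → Finset α :=
    fun x => Finset.univ.filter fun a => x (e a) = 1
  have htwo : ∀ z : ZMod 2, z = 0 ∨ z = 1 := by decide
  have hT : ∀ x, T (x + 1) = (T x)ᶜ := by
    intro x
    ext a
    rcases htwo (x (e a)) with h | h <;> simp [T, h]
  have hstep : ∀ i (S S' : Finset α) (a : α), (∀ b, b ≠ a → (b ∈ S ↔ b ∈ S')) →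
      |v i S - v i S'| ≤ 1 := by
    intro i S S' a h
    by_cases hS : a ∈ S <;> by_cases hS' : a ∈ S'
    · rw [show S = S' by ext b; by_cases hb : b = a <;> simp_all]
      simp
    · rw [show S = insert a S' by ext b; by_cases hb : b = a <;> simp_all]
      exact hv i S' a
    · rw [show S' = insert a S by ext b; by_cases hb : b = a <;> simp_all, abs_sub_comm]
      exact hv i S a
    · rw [show S = S' by ext b; by_cases hb : b = a <;> simp_all]
      simp
  obtain ⟨x, hx⟩ := exists_forall_abs_odd_le hn (fun i x => v i (T x) - v i (T x)ᶜ)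
    (by
      intro i x
      simp only [hT, compl_compl]
      ring)
    (by
      intro i x j b
      have hmem : ∀ a, a ≠ e.symm j → (a ∈ T (Function.update x j b) ↔ a ∈ T x) := by
        intro a ha
        have : e a ≠ j := fun h => ha (by rw [← h, e.symm_apply_apply])
        simp [T, this]
      have h1 := hstep i _ _ _ hmem
      have h2 := hstep i (T (Function.update x j b))ᶜ (T x)ᶜ (e.symm j) fun a ha => by
        simp [hmem a ha]
      rw [abs_le] at h1 h2 ⊢
      constructor <;> linarith)
  exact ⟨T x, hx⟩
end
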